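/- Set c_k := ω_d^{−2/d}·Γ(k + 2/d)/Γ(k) for k ∈ ℕ. Then as n → ∞, n^{2/d}·(γ_{n,2}·c_1 − γ_{n,1}·c_2)/(c_1 − c_2) converges to σ² in L¹; that is, E| n^{2/d}(γ_{n,2} c_1 − γ_{n,1} c_2)/(c_1 − c_2) − σ² | → 0. (Theorem 5.3 of the paper, with E[ρ_k²] = c_k.) -/

import Mathlib

open MeasureTheory ProbabilityTheory Filter Topology
open scoped RealInnerProductSpace

noncomputable section

/-- Euclidean space `ℝ^d`. -/
abbrev EucSp (d : ℕ) := EuclideanSpace ℝ (Fin d)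

/-- The property that `J i n k ω` is (a.s.) the index of the `k`-th nearest neighbour of
`X i ω` among `X 0 ω, …, X (n-1) ω`: it is an index `j < n`, `j ≠ i`, such that exactly
`k − 1` indices `ℓ < n`, `ℓ ≠ i`, satisfy `|X ℓ − X i| < |X j − X i|`. -/
def IsNNIndex {d : ℕ} {Ωp : Type*} [MeasureSpace Ωp]
    (X : ℕ → Ωp → EucSp d) (J : ℕ → ℕ → ℕ → Ωp → ℕ) : Prop :=
  ∀ i n k : ℕ, i < n → 1 ≤ k → k < n → ∀ᵐ ω ∂ℙ,
    J i n k ω < n ∧ J i n k ω ≠ i ∧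
      ((Finset.range n).filter fun ℓ => ℓ ≠ i ∧
        dist (X ℓ ω) (X i ω) < dist (X (J i n k ω) ω) (X i ω)).card = k - 1

/-- The Gamma statistic `γ_{n,k} = (2n)⁻¹ Σ_{i<n} (Y_{j(i,n,k),n} − Y_{i,n})²`, where
`Y_{i,n} = h(X_i) + n^{−1/d} e_i`. -/
def gammaStat {d : ℕ} {Ωp : Type*} (h : EucSp d → ℝ) (X : ℕ → Ωp → EucSp d)
    (e : ℕ → Ωp → ℝ) (J : ℕ → ℕ → ℕ → Ωp → ℕ) (n k : ℕ) (ω : Ωp) : ℝ :=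
  (2 * (n : ℝ))⁻¹ * ∑ i ∈ Finset.range n,
    ((h (X (J i n k ω) ω) + (n : ℝ) ^ (-1 / (d : ℝ)) * e (J i n k ω) ω)
      - (h (X i ω) + (n : ℝ) ^ (-1 / (d : ℝ)) * e i ω)) ^ 2

/-- The constant `c_k = ω_d^{−2/d} Γ(k + 2/d)/Γ(k) = E[ρ_k²]`, the second moment of the
`k`-th nearest-neighbour distance to the origin in a rate-one homogeneous Poisson
process. -/
def nnMoment (d k : ℕ) : ℝ :=
  (volume (Metric.closedBall (0 : EucSp d) 1)).toReal ^ (-2 / (d : ℝ)) *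
    Real.Gamma (k + 2 / (d : ℝ)) / Real.Gamma k


lemma integrable_of_bdd {α : Type*} [MeasurableSpace α] {μ : Measure α} [IsFiniteMeasure μ]
    {f : α → ℝ} (hf : Measurable f) (C : ℝ) (hC : ∀ x, |f x| ≤ C) : Integrable f μ :=
  Integrable.of_bound hf.aestronglyMeasurable C (Eventually.of_forall hC)

lemma pi_succ_integral {F : Type*} [MeasurableSpace F] (ν : Measure F) [IsProbabilityMeasure ν]
    (n : ℕ) (k : (Fin (n+1) → F) → ℝ) (hk : Measurable k) (C : ℝ) (hC : ∀ x, |k x| ≤ C) :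
    ∫ x, k x ∂(Measure.pi fun _ : Fin (n+1) => ν)
      = ∫ y, ∫ a, k (Fin.cons a y) ∂ν ∂(Measure.pi fun _ : Fin n => ν) := by
  have hmp := measurePreserving_piFinSuccAbove (fun _ : Fin (n+1) => ν) 0
  have h1 := hmp.symm.integral_comp (MeasurableEquiv.measurableEmbedding _) k
  rw [← h1]
  have hm : Measurable fun z : F × (Fin n → F) =>
      k ((MeasurableEquiv.piFinSuccAbove (fun _ : Fin (n+1) => F) 0).symm z) :=
    hk.comp (MeasurableEquiv.measurable _)
  rw [integral_prod_symm]
  · simp [MeasurableEquiv.piFinSuccAbove, Fin.insertNthEquiv]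
  · exact integrable_of_bdd hm C (fun _ => hC _)

lemma var_le_aux {F : Type*} [MeasurableSpace F] (ν : Measure F) [IsProbabilityMeasure ν]
    (f : F → ℝ) (hf : Measurable f) (C : ℝ) (hC : ∀ x, |f x| ≤ C) (c : ℝ) :
    ∫ a, (f a - c) ^ 2 ∂ν = ∫ a, (f a - ∫ b, f b ∂ν) ^ 2 ∂ν + ((∫ b, f b ∂ν) - c) ^ 2 := by
  have i1 : Integrable f ν := integrable_of_bdd hf C hC
  have i2 : Integrable (fun a => f a ^ 2) ν := by
    refine integrable_of_bdd (hf.pow_const 2) (C ^ 2) fun x => ?_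
    rw [abs_pow]; exact pow_le_pow_left₀ (abs_nonneg _) (hC x) 2
  have key : ∀ t : ℝ, ∫ a, (f a - t) ^ 2 ∂ν = ∫ a, f a ^ 2 ∂ν - 2 * t * ∫ a, f a ∂ν + t ^ 2 := by
    intro t
    have : (fun a => (f a - t) ^ 2) = fun a => f a ^ 2 - 2 * t * f a + t ^ 2 := by
      ext a; ring
    rw [this, integral_add (by fun_prop) (by fun_prop), integral_sub i2 (by fun_prop),
      integral_const_mul]
    simp
  rw [key, key]; ring

theorem efron_stein {F : Type*} [MeasurableSpace F] (ν : Measure F) [IsProbabilityMeasure ν]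
    (n : ℕ) : ∀ (f : (Fin n → F) → ℝ) (g : Fin n → (Fin n → F) → ℝ) (C : ℝ) (_ : Measurable f)
    (_ : ∀ x, |f x| ≤ C) (_ : ∀ i, Measurable (g i)) (_ : ∀ i x, |g i x| ≤ C)
    (_ : ∀ i x y, g i (Function.update x i y) = g i x),
    ∫ x, (f x - ∫ y, f y ∂(Measure.pi fun _ : Fin n => ν)) ^ 2 ∂(Measure.pi fun _ : Fin n => ν)
      ≤ ∑ i, ∫ x, (f x - g i x) ^ 2 ∂(Measure.pi fun _ : Fin n => ν) := by
  induction n with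
  | zero =>
    intro f g C hf hfC hg hgC hgi
    have h0 : ∀ x, f x = f default := fun x => by rw [Subsingleton.elim x default]
    simp [h0]
  | succ n ih =>
    intro f g C hf hfC hg hgC hgi
    set P := Measure.pi fun _ : Fin n => ν with hP
    have hcons : Measurable fun z : (Fin n → F) × F => (Fin.cons z.2 z.1 : Fin (n+1) → F) := by
      refine measurable_pi_iff.2 fun i => ?_
      refine Fin.cases ?_ (fun j => ?_) i
      · simpa using measurable_snd
      · simp only [Fin.cons_succ]
        exact (measurable_pi_apply j).comp measurable_fst
    have hFn : Nonempty F := by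
      by_contra hh
      rw [not_nonempty_iff] at hh
      have := measure_univ (μ := ν)
      rw [Set.univ_eq_empty_iff.2 hh] at this
      simp at this
    have hC0 : 0 ≤ C := (abs_nonneg _).trans (hfC fun _ => hFn.some)
    -- marginals
    have avg : ∀ (u : (Fin (n+1) → F) → ℝ), Measurable u →
        Measurable fun y : Fin n → F => ∫ a, u (Fin.cons a y) ∂ν := by
      intro u hu
      exact ((hu.comp hcons).stronglyMeasurable.integral_prod_right').measurable
    have avgC : ∀ (u : (Fin (n+1) → F) → ℝ), (∀ x, |u x| ≤ C) →
        ∀ y : Fin n → F, |∫ a, u (Fin.cons a y) ∂ν| ≤ C := by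
      intro u hu y
      have := norm_integral_le_of_norm_le_const (μ := ν) (f := fun a => u (Fin.cons a y))
        (C := C) (Eventually.of_forall fun a => hu _)
      simpa using this
    set m : (Fin n → F) → ℝ := fun y => ∫ a, f (Fin.cons a y) ∂ν with hm
    have hmean : ∫ x, f x ∂(Measure.pi fun _ : Fin (n+1) => ν) = ∫ y, m y ∂P :=
      pi_succ_integral ν n f hf C hfC
    have sec : ∀ (u : (Fin (n+1) → F) → ℝ), Measurable u → ∀ y : Fin n → F,
        Measurable fun a => u (Fin.cons a y) := by
      intro u hu y
      exact hu.comp (hcons.comp (measurable_const.prodMk measurable_id))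
    have sqC : ∀ a b : ℝ, |a| ≤ C → |b| ≤ C → |(a - b) ^ 2| ≤ 4 * C ^ 2 := by
      intro a b ha hb
      rw [abs_of_nonneg (sq_nonneg _)]
      rw [abs_le] at ha hb
      nlinarith
    have hmC : ∀ y, |m y| ≤ C := avgC f hfC
    have hmm : Measurable m := avg f hf
    have hMC : |∫ y, m y ∂P| ≤ C := by
      have := norm_integral_le_of_norm_le_const (μ := P) (f := m)
        (C := C) (Eventually.of_forall fun a => hmC _)
      simpa using this
    have lhs : ∫ x, (f x - ∫ y, f y ∂(Measure.pi fun _ : Fin (n+1) => ν)) ^ 2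
          ∂(Measure.pi fun _ : Fin (n+1) => ν)
        = ∫ y, ∫ a, (f (Fin.cons a y) - m y) ^ 2 ∂ν ∂P + ∫ y, (m y - ∫ z, m z ∂P) ^ 2 ∂P := by
      rw [hmean, pi_succ_integral ν n _ ((hf.sub_const _).pow_const 2) (4 * C ^ 2)
        (fun x => sqC _ _ (hfC x) hMC)]
      rw [← integral_add]
      · refine integral_congr_ae (Eventually.of_forall fun y => ?_)
        exact var_le_aux ν _ (sec f hf y) C (fun a => hfC _) _
      · refine integrable_of_bdd ?_ (4 * C ^ 2) fun y => ?_
        · have : Measurable fun z : (Fin n → F) × F => (f (Fin.cons z.2 z.1) - m z.1) ^ 2 :=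
            ((hf.comp hcons).sub (hmm.comp measurable_fst)).pow_const 2
          exact (this.stronglyMeasurable.integral_prod_right').measurable
        · have := norm_integral_le_of_norm_le_const (μ := ν)
            (f := fun a => (f (Fin.cons a y) - m y) ^ 2)
            (C := 4 * C ^ 2) (Eventually.of_forall fun a => sqC _ _ (hfC _) (hmC y))
          simpa using this
      · exact integrable_of_bdd ((hmm.sub_const _).pow_const 2) (4 * C ^ 2)
          fun y => sqC _ _ (hmC y) hMC
    have rhs : ∀ i, ∫ x, (f x - g i x) ^ 2 ∂(Measure.pi fun _ : Fin (n+1) => ν)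
        = ∫ y, ∫ a, (f (Fin.cons a y) - g i (Fin.cons a y)) ^ 2 ∂ν ∂P := fun i =>
      pi_succ_integral ν n _ ((hf.sub (hg i)).pow_const 2) (4 * C ^ 2)
        (fun x => sqC _ _ (hfC x) (hgC i x))
    have intR : ∀ i, Integrable
        (fun y => ∫ a, (f (Fin.cons a y) - g i (Fin.cons a y)) ^ 2 ∂ν) P := by
      intro i
      refine integrable_of_bdd (avg _ ((hf.sub (hg i)).pow_const 2)) (4 * C ^ 2) fun y => ?_
      have := norm_integral_le_of_norm_le_const (μ := ν)
        (f := fun a => (f (Fin.cons a y) - g i (Fin.cons a y)) ^ 2)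
        (C := 4 * C ^ 2) (Eventually.of_forall fun a => sqC _ _ (hfC _) (hgC i _))
      simpa using this
    rw [lhs, Fin.sum_univ_succ]
    refine add_le_add ?_ ?_
    · rw [rhs 0]
      refine integral_mono_of_nonneg
        (Eventually.of_forall fun y => integral_nonneg fun a => sq_nonneg _) (intR 0)
        (Eventually.of_forall fun y => ?_)
      have hconst : ∀ a, g 0 (Fin.cons a y) = g 0 (Fin.cons hFn.some y) := by
        intro a
        rw [← hgi 0 (Fin.cons hFn.some y) a, Fin.update_cons_zero]
      simp only [hconst]
      rw [var_le_aux ν (fun a => f (Fin.cons a y)) (sec f hf y) C (fun a => hfC _)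
        (g 0 (Fin.cons hFn.some y))]
      exact le_add_of_nonneg_right (sq_nonneg _)
    · refine (ih m (fun i y => ∫ a, g i.succ (Fin.cons a y) ∂ν) C hmm hmC
        (fun i => avg _ (hg _)) (fun i => avgC _ (hgC _)) ?_).trans ?_
      · intro i y b
        simp only [Fin.cons_update, hgi]
      · refine Finset.sum_le_sum fun i _ => ?_
        rw [rhs]
        refine integral_mono_of_nonneg
          (Eventually.of_forall fun y => sq_nonneg _) (intR _)
          (Eventually.of_forall fun y => ?_)
        have i1 := integrable_of_bdd (μ := ν) (sec f hf y) C (fun a => hfC _)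
        have i2 := integrable_of_bdd (μ := ν) (sec _ (hg i.succ) y) C (fun a => hgC _ _)
        have := var_le_aux ν (fun a => f (Fin.cons a y) - g i.succ (Fin.cons a y))
          ((sec f hf y).sub (sec _ (hg _) y)) (2 * C)
          (fun a => by
            have h1 := hfC (Fin.cons a y); have h2 := hgC i.succ (Fin.cons a y)
            rw [abs_le] at *; constructor <;> linarith) 0
        simp only [sub_zero] at this
        simp only
        rw [this, integral_sub i1 i2]
        exact le_add_of_nonneg_left (integral_nonneg fun a => sq_nonneg _)


section comb
variable {E : Type*} [PseudoMetricSpace E] {ι : Type*} [DecidableEq ι]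

/-- number of indices in `A` strictly closer to `x l` than `x j`. -/
def rk (A : Finset ι) (x : ι → E) (l j : ι) : ℕ :=
  (A.filter fun i => i ≠ l ∧ dist (x i) (x l) < dist (x j) (x l)).card

def qq (A : Finset ι) (x : ι → E) (r : ℕ) (l j : ι) : ℝ :=
  if j ≠ l ∧ rk A x l j = r then 1 else 0

def aa (A : Finset ι) (x : ι → E) (r : ℕ) (l j : ι) : ℝ :=
  if j ≠ l ∧ rk A x l j ≤ r then 1 else 0

def NoTies (x : ι → E) : Prop :=
  ∀ l i j, i ≠ l → j ≠ l → i ≠ j → dist (x i) (x l) ≠ dist (x j) (x l)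

def ss (A : Finset ι) (x : ι → E) (φ : ι → ι → ℝ) (r : ℕ) (l : ι) : ℝ :=
  ∑ j ∈ A, qq A x r l j * φ l j

lemma qq_nonneg (A : Finset ι) (x : ι → E) (r : ℕ) (l j : ι) : 0 ≤ qq A x r l j := by
  unfold qq; split_ifs <;> norm_num

lemma qq_le_one (A : Finset ι) (x : ι → E) (r : ℕ) (l j : ι) : qq A x r l j ≤ 1 := by
  unfold qq; split_ifs <;> norm_num

lemma aa_nonneg (A : Finset ι) (x : ι → E) (r : ℕ) (l j : ι) : 0 ≤ aa A x r l j := by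
  unfold aa; split_ifs <;> norm_num

lemma aa_le_one (A : Finset ι) (x : ι → E) (r : ℕ) (l j : ι) : aa A x r l j ≤ 1 := by
  unfold aa; split_ifs <;> norm_num

lemma aa_eq (A : Finset ι) (x : ι → E) (r : ℕ) (l j : ι) :
    aa A x r l j = ∑ s ∈ Finset.range (r+1), qq A x s l j := by
  unfold aa qq
  by_cases h : j = l
  · simp [h]
  · simp [h]

lemma rk_lt {A : Finset ι} {x : ι → E} {l i j : ι} (hi : i ∈ A) (hil : i ≠ l)
    (h : dist (x i) (x l) < dist (x j) (x l)) : rk A x l i < rk A x l j := by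
  unfold rk
  apply Finset.card_lt_card
  rw [Finset.ssubset_iff_of_subset]
  · exact ⟨i, by simp [hi, hil, h], by simp⟩
  · intro k hk
    simp only [Finset.mem_filter] at hk ⊢
    exact ⟨hk.1, hk.2.1, hk.2.2.trans h⟩

lemma rk_inj {A : Finset ι} {x : ι → E} (hx : NoTies x) {l i j : ι} (hi : i ∈ A) (hj : j ∈ A)
    (hil : i ≠ l) (hjl : j ≠ l) (h : rk A x l i = rk A x l j) : i = j := by
  by_contra hij
  rcases lt_or_gt_of_ne (hx l i j hil hjl hij) with h1 | h1
  · exact absurd (rk_lt hi hil h1) (by omega)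
  · exact absurd (rk_lt hj hjl h1) (by omega)

lemma sum_qq_le (A : Finset ι) {x : ι → E} (hx : NoTies x) (r : ℕ) (l : ι) :
    ∑ j ∈ A, qq A x r l j ≤ 1 := by
  unfold qq
  rw [Finset.sum_ite]
  simp only [Finset.sum_const, nsmul_eq_mul, mul_one, mul_zero, add_zero]
  have : (A.filter fun j => j ≠ l ∧ rk A x l j = r).card ≤ 1 := by
    rw [Finset.card_le_one]
    intro i hi j hj
    simp only [Finset.mem_filter] at hi hj
    exact rk_inj hx hi.1 hj.1 hi.2.1 hj.2.1 (hi.2.2.trans hj.2.2.symm)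
  exact_mod_cast this

lemma sum_aa_le (A : Finset ι) {x : ι → E} (hx : NoTies x) (r : ℕ) (l : ι) :
    ∑ j ∈ A, aa A x r l j ≤ r + 1 := by
  simp only [aa_eq]
  rw [Finset.sum_comm]
  calc _ ≤ ∑ s ∈ Finset.range (r+1), (1:ℝ) := Finset.sum_le_sum fun s _ => sum_qq_le A hx s l
    _ = _ := by simp

lemma ss_nonneg (A : Finset ι) (x : ι → E) {φ : ι → ι → ℝ} (h0 : ∀ i j, 0 ≤ φ i j) (r : ℕ)
    (l : ι) : 0 ≤ ss A x φ r l :=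
  Finset.sum_nonneg fun j _ => mul_nonneg (qq_nonneg _ _ _ _ _) (h0 _ _)

lemma ss_le_card (A : Finset ι) (x : ι → E) {φ : ι → ι → ℝ} {T : ℝ} (h0 : ∀ i j, 0 ≤ φ i j)
    (hT : ∀ i j, φ i j ≤ T) (r : ℕ) (l : ι) : ss A x φ r l ≤ A.card * T := by
  unfold ss
  calc _ ≤ ∑ j ∈ A, T := Finset.sum_le_sum fun j _ => by
        have := qq_le_one A x r l j
        have h2 := qq_nonneg A x r l j
        calc _ ≤ 1 * φ l j := mul_le_mul_of_nonneg_right this (h0 _ _)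
          _ ≤ T := by simpa using hT l j
    _ = _ := by simp

lemma ss_le (A : Finset ι) {x : ι → E} (hx : NoTies x) {φ : ι → ι → ℝ} {T : ℝ} (hT0 : 0 ≤ T)
    (hT : ∀ i j, φ i j ≤ T) (r : ℕ) (l : ι) : ss A x φ r l ≤ T := by
  unfold ss
  calc _ ≤ ∑ j ∈ A, qq A x r l j * T := Finset.sum_le_sum fun j _ =>
        mul_le_mul_of_nonneg_left (hT _ _) (qq_nonneg _ _ _ _ _)
    _ = (∑ j ∈ A, qq A x r l j) * T := by rw [Finset.sum_mul]
    _ ≤ 1 * T := mul_le_mul_of_nonneg_right (sum_qq_le A hx r l) hT0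
    _ = T := one_mul T

lemma rk_erase {A : Finset ι} {x : ι → E} {l i j : ι} (hi : i ∈ A) (hil : i ≠ l) :
    rk A x l j = rk (A.erase i) x l j +
      (if dist (x i) (x l) < dist (x j) (x l) then 1 else 0) := by
  unfold rk
  conv_lhs => rw [← Finset.insert_erase hi]
  rw [Finset.filter_insert]
  by_cases h : dist (x i) (x l) < dist (x j) (x l)
  · simp [h, hil]
  · simp [h]

lemma rk_loo {A : Finset ι} {x : ι → E} {l i j : ι} {r : ℕ} (hi : i ∈ A) (hil : i ≠ l)
    (hr : r < rk A x l i) : (rk A x l j = r ↔ rk (A.erase i) x l j = r) := by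
  have h1 := rk_erase (j := j) (x := x) hi hil
  split_ifs at h1 with h
  · have h2 := rk_lt hi hil h
    omega
  · simp at h1; rw [h1]

lemma ss_loo {A : Finset ι} {x : ι → E} (hx : NoTies x) {φ : ι → ι → ℝ} {T : ℝ}
    (h0 : ∀ i j, 0 ≤ φ i j) (hT : ∀ i j, φ i j ≤ T) {r : ℕ} {l i : ι} (hi : i ∈ A)
    (hil : i ≠ l) :
    |ss A x φ r l - ss (A.erase i) x φ r l| ≤ T * aa A x r l i := by
  have hT0 : 0 ≤ T := (h0 i i).trans (hT i i)
  by_cases hr : rk A x l i ≤ r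
  · have e1 : aa A x r l i = 1 := by simp [aa, hil, hr]
    rw [e1, mul_one]
    exact abs_sub_le_of_nonneg_of_le (ss_nonneg _ _ h0 _ _) (ss_le _ hx hT0 hT _ _)
      (ss_nonneg _ _ h0 _ _) (ss_le _ hx hT0 hT _ _)
  · push Not at hr
    have e1 : aa A x r l i = 0 := by simp [aa, hr]
    rw [e1, mul_zero]
    have : ss A x φ r l = ss (A.erase i) x φ r l := by
      unfold ss
      rw [← Finset.add_sum_erase _ _ hi]
      have e2 : qq A x r l i = 0 := by simp [qq, hr.ne']
      rw [e2, zero_mul, zero_add]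
      refine Finset.sum_congr rfl fun j hj => ?_
      unfold qq
      simp only [rk_loo (j := j) hi hil hr]
    simp [this]

lemma pair_bound (A : Finset ι) {x : ι → E} (hx : NoTies x) (r : ℕ) {ε : ℝ} (hε : 0 < ε)
    (l l' : ι) :
    ∑ i ∈ A, aa A x r l i * aa A x r l' i ≤
      (r + 1) * (if dist (x l) (x l') ≤ 2 * ε then 1 else 0)
      + (∑ i ∈ A, aa A x r l i * dist (x i) (x l) ^ 2) / ε ^ 2
      + (∑ i ∈ A, aa A x r l' i * dist (x i) (x l') ^ 2) / ε ^ 2 := by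
  have key : ∀ i, aa A x r l i * aa A x r l' i ≤
      aa A x r l i * (if dist (x l) (x l') ≤ 2 * ε then 1 else 0)
      + aa A x r l i * dist (x i) (x l) ^ 2 / ε ^ 2
      + aa A x r l' i * dist (x i) (x l') ^ 2 / ε ^ 2 := by
    intro i
    have a0 := aa_nonneg A x r l i
    have b0 := aa_nonneg A x r l' i
    have a1 := aa_le_one A x r l i
    have b1 := aa_le_one A x r l' i
    have p1 : 0 ≤ aa A x r l i * dist (x i) (x l) ^ 2 / ε ^ 2 := by positivity
    have p2 : 0 ≤ aa A x r l' i * dist (x i) (x l') ^ 2 / ε ^ 2 := by positivity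
    have ab : aa A x r l i * aa A x r l' i ≤ aa A x r l i := by nlinarith
    have ab' : aa A x r l i * aa A x r l' i ≤ aa A x r l' i := by nlinarith
    have big : ∀ t : ℝ, ε < t → 1 ≤ t ^ 2 / ε ^ 2 := by
      intro t ht
      rw [le_div_iff₀ (by positivity)]; nlinarith
    split_ifs with h
    · linarith
    · rcases lt_or_ge ε (dist (x i) (x l)) with h1 | h1
      · have := mul_le_mul_of_nonneg_left (big _ h1) a0
        simp only [mul_div_assoc] at p1 p2 ⊢
        linarith
      · have h2 : ε < dist (x i) (x l') := by
          have := dist_triangle_left (x l) (x l') (x i)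
          linarith
        have := mul_le_mul_of_nonneg_left (big _ h2) b0
        simp only [mul_div_assoc] at p1 p2 ⊢
        linarith
  refine (Finset.sum_le_sum fun i _ => key i).trans ?_
  rw [Finset.sum_add_distrib, Finset.sum_add_distrib, Finset.sum_div, Finset.sum_div,
    ← Finset.sum_mul]
  have := sum_aa_le A hx r l
  gcongr

end comb


section lln
variable {E : Type*} [PseudoMetricSpace E] [SecondCountableTopology E] [MeasurableSpace E]
  [OpensMeasurableSpace E]

lemma measurable_rk {Ω' : Type*} [MeasurableSpace Ω'] {ι : Type*} [DecidableEq ι] (A : Finset ι)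
    {X : ι → Ω' → E} (hX : ∀ i, Measurable (X i)) (l j : ι) :
    Measurable fun ω => rk A (fun i => X i ω) l j := by
  unfold rk
  simp only [Finset.card_filter]
  refine Finset.measurable_sum _ fun i _ => ?_
  by_cases hil : i = l
  · simp [hil]
  · simp only [ne_eq, hil, not_false_eq_true, true_and]
    refine Measurable.ite ?_ measurable_const measurable_const
    exact measurableSet_lt ((hX i).dist (hX l)) ((hX j).dist (hX l))

lemma measurable_qq {Ω' : Type*} [MeasurableSpace Ω'] {ι : Type*} [DecidableEq ι] (A : Finset ι)
    {X : ι → Ω' → E} (hX : ∀ i, Measurable (X i)) (r : ℕ) (l j : ι) :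
    Measurable fun ω => qq A (fun i => X i ω) r l j := by
  unfold qq
  refine Measurable.ite ?_ measurable_const measurable_const
  by_cases hjl : j = l
  · simp [hjl]
  · simp only [ne_eq, hjl, not_false_eq_true, true_and]
    exact measurable_rk A hX l j (measurableSet_singleton r)

lemma measurable_aa {Ω' : Type*} [MeasurableSpace Ω'] {ι : Type*} [DecidableEq ι] (A : Finset ι)
    {X : ι → Ω' → E} (hX : ∀ i, Measurable (X i)) (r : ℕ) (l j : ι) :
    Measurable fun ω => aa A (fun i => X i ω) r l j := by
  simp only [aa_eq]
  exact Finset.measurable_sum _ fun s _ => measurable_qq A hX s l j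

variable {F : Type*} [MeasurableSpace F]

/-- The general local statistic. -/
def SS {n : ℕ} (pos : F → E) (φ : F → F → ℝ) (r : ℕ) (m : Fin n → F) : ℝ :=
  (n : ℝ)⁻¹ * ∑ l, ss Finset.univ (fun i => pos (m i)) (fun i j => φ (m i) (m j)) r l

lemma measurable_ss {n : ℕ} {pos : F → E} (hpos : Measurable pos) {φ : F → F → ℝ}
    (hφ : Measurable (Function.uncurry φ)) (A : Finset (Fin n)) (r : ℕ) (l : Fin n) :
    Measurable fun m : Fin n → F =>
      ss A (fun i => pos (m i)) (fun i j => φ (m i) (m j)) r l := by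
  unfold ss
  refine Finset.measurable_sum _ fun j _ => Measurable.mul ?_ ?_
  · exact measurable_qq A (X := fun i (m : Fin n → F) => pos (m i))
      (fun i => hpos.comp (measurable_pi_apply i)) r l j
  · have h2 : Measurable fun m : Fin n → F => (m l, m j) :=
      (measurable_pi_apply l).prodMk (measurable_pi_apply j)
    exact hφ.comp h2

lemma measurable_SS {n : ℕ} {pos : F → E} (hpos : Measurable pos) {φ : F → F → ℝ}
    (hφ : Measurable (Function.uncurry φ)) (r : ℕ) :
    Measurable (SS (n := n) pos φ r) :=
  measurable_const.mul (Finset.measurable_sum _ fun l _ => measurable_ss hpos hφ _ r l)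

lemma dev_bound {n : ℕ} (hn : 0 < n) {x : Fin n → E} (hx : NoTies x) {φ : Fin n → Fin n → ℝ}
    {T : ℝ} (h0 : ∀ i j, 0 ≤ φ i j) (hT : ∀ i j, φ i j ≤ T) (r : ℕ) {ε : ℝ} (hε : 0 < ε) :
    ∑ i, ((n : ℝ)⁻¹ * ∑ l, ss Finset.univ x φ r l
      - (n : ℝ)⁻¹ * ∑ l ∈ Finset.univ.erase i, ss (Finset.univ.erase i) x φ r l) ^ 2
    ≤ 2 * T ^ 2 / n ^ 2 * (n * (r + 2) + ∑ l, ∑ l' ∈ Finset.univ.erase l,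
      ((r + 1) * (if dist (x l) (x l') ≤ 2 * ε then 1 else 0)
      + (∑ i, aa Finset.univ x r l i * dist (x i) (x l) ^ 2) / ε ^ 2
      + (∑ i, aa Finset.univ x r l' i * dist (x i) (x l') ^ 2) / ε ^ 2)) := by
  have hn' : (0:ℝ) < n := by exact_mod_cast hn
  have : Nonempty (Fin n) := ⟨⟨0, hn⟩⟩
  have hT0 : 0 ≤ T := (h0 Classical.ofNonempty Classical.ofNonempty).trans (hT _ _)
  have step1 : ∀ i : Fin n, ((n : ℝ)⁻¹ * ∑ l, ss Finset.univ x φ r l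
      - (n : ℝ)⁻¹ * ∑ l ∈ Finset.univ.erase i, ss (Finset.univ.erase i) x φ r l) ^ 2
      ≤ 2 * T ^ 2 / n ^ 2 * (1 + (∑ l, aa Finset.univ x r l i) ^ 2) := by
    intro i
    have e1 : |∑ l, ss Finset.univ x φ r l
        - ∑ l ∈ Finset.univ.erase i, ss (Finset.univ.erase i) x φ r l|
        ≤ T * (1 + ∑ l, aa Finset.univ x r l i) := by
      rw [← Finset.add_sum_erase _ _ (Finset.mem_univ i), add_sub_assoc, ← Finset.sum_sub_distrib]
      refine (abs_add_le _ _).trans ?_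
      rw [mul_add, mul_one]
      refine add_le_add ?_ ?_
      · rw [abs_of_nonneg (ss_nonneg _ _ h0 _ _)]
        exact ss_le _ hx hT0 hT _ _
      · refine (Finset.abs_sum_le_sum_abs _ _).trans ?_
        rw [Finset.mul_sum]
        calc _ ≤ ∑ l ∈ Finset.univ.erase i, T * aa Finset.univ x r l i :=
              Finset.sum_le_sum fun l hl =>
                ss_loo hx h0 hT (Finset.mem_univ i) (Finset.ne_of_mem_erase hl).symm
          _ ≤ _ := Finset.sum_le_sum_of_subset_of_nonneg (Finset.erase_subset _ _)
                fun l _ _ => mul_nonneg hT0 (aa_nonneg _ _ _ _ _)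
    rw [← mul_sub, mul_pow]
    have e2 := sq_le_sq' (abs_le.1 e1).1 (abs_le.1 e1).2
    set B := ∑ l, aa Finset.univ x r l i
    have e3 : (T * (1 + B)) ^ 2 ≤ 2 * T ^ 2 * (1 + B ^ 2) := by
      have : 0 ≤ T ^ 2 * (1 - B) ^ 2 := by positivity
      nlinarith
    calc _ ≤ ((n:ℝ)⁻¹) ^ 2 * (2 * T ^ 2 * (1 + B ^ 2)) :=
          mul_le_mul_of_nonneg_left (e2.trans e3) (by positivity)
      _ = _ := by field_simp
  refine (Finset.sum_le_sum fun i _ => step1 i).trans ?_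
  rw [← Finset.mul_sum]
  refine mul_le_mul_of_nonneg_left ?_ (by positivity)
  rw [Finset.sum_add_distrib]
  have e4 : ∑ i, (∑ l, aa Finset.univ x r l i) ^ 2
      = ∑ l, ∑ l', ∑ i, aa Finset.univ x r l i * aa Finset.univ x r l' i := by
    simp only [sq, Finset.sum_mul_sum]
    rw [Finset.sum_comm]
    refine Finset.sum_congr rfl fun l _ => ?_
    rw [Finset.sum_comm]
  rw [e4]
  have e5 : ∀ l : Fin n, ∑ l', ∑ i, aa Finset.univ x r l i * aa Finset.univ x r l' i ≤
      (r + 1) + ∑ l' ∈ Finset.univ.erase l,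
      ((r + 1) * (if dist (x l) (x l') ≤ 2 * ε then 1 else 0)
      + (∑ i, aa Finset.univ x r l i * dist (x i) (x l) ^ 2) / ε ^ 2
      + (∑ i, aa Finset.univ x r l' i * dist (x i) (x l') ^ 2) / ε ^ 2) := by
    intro l
    rw [← Finset.add_sum_erase _ _ (Finset.mem_univ l)]
    refine add_le_add ?_ (Finset.sum_le_sum fun l' _ => pair_bound _ hx r hε l l')
    refine le_trans (Finset.sum_le_sum fun i _ => ?_) (sum_aa_le Finset.univ hx r l)
    have a0 := aa_nonneg Finset.univ x r l i
    have a1 := aa_le_one Finset.univ x r l i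
    nlinarith
  calc _ ≤ (n:ℝ) + ∑ l : Fin n, (((r:ℝ) + 1) + ∑ l' ∈ Finset.univ.erase l,
      ((r + 1) * (if dist (x l) (x l') ≤ 2 * ε then 1 else 0)
      + (∑ i, aa Finset.univ x r l i * dist (x i) (x l) ^ 2) / ε ^ 2
      + (∑ i, aa Finset.univ x r l' i * dist (x i) (x l') ^ 2) / ε ^ 2)) := by
        refine add_le_add (by simp) (Finset.sum_le_sum fun l _ => e5 l)
    _ = _ := by
        rw [Finset.sum_add_distrib]
        simp only [Finset.sum_const, Finset.card_univ, Fintype.card_fin, nsmul_eq_mul]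
        ring

theorem lln_var {n : ℕ} (hn : 0 < n) (ν : Measure F) [IsProbabilityMeasure ν] {pos : F → E}
    (hpos : Measurable pos) {φ : F → F → ℝ} (hφ : Measurable (Function.uncurry φ)) {T : ℝ}
    (h0 : ∀ a b, 0 ≤ φ a b) (hT : ∀ a b, φ a b ≤ T) (r : ℕ) {ε : ℝ} (hε : 0 < ε)
    {η R : ℝ}
    (hnt : ∀ᵐ m ∂(Measure.pi fun _ : Fin n => ν), NoTies fun i => pos (m i))
    (hη : ∀ l l' : Fin n, l ≠ l' → (Measure.pi fun _ : Fin n => ν).real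
      {m | dist (pos (m l)) (pos (m l')) ≤ 2 * ε} ≤ η)
    (hRi : ∀ l : Fin n, Integrable (fun m : Fin n → F => ∑ i, aa Finset.univ (fun i => pos (m i)) r l i *
      dist (pos (m i)) (pos (m l)) ^ 2) (Measure.pi fun _ : Fin n => ν))
    (hR : ∀ l : Fin n, ∫ m, ∑ i, aa Finset.univ (fun i => pos (m i)) r l i *
      dist (pos (m i)) (pos (m l)) ^ 2 ∂(Measure.pi fun _ : Fin n => ν) ≤ R)
    (hR0 : 0 ≤ R) (hη0 : 0 ≤ η) :
    ∫ m, (SS pos φ r m - ∫ m', SS pos φ r m' ∂(Measure.pi fun _ : Fin n => ν)) ^ 2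
      ∂(Measure.pi fun _ : Fin n => ν)
    ≤ 2 * T ^ 2 * ((r + 2) / n + (r + 1) * η + 2 * R / ε ^ 2) := by
  have hn' : (0:ℝ) < n := by exact_mod_cast hn
  set P := Measure.pi fun _ : Fin n => ν with hP
  have hFn : Nonempty F := by
    by_contra hh
    rw [not_nonempty_iff] at hh
    have := measure_univ (μ := ν)
    rw [Set.univ_eq_empty_iff.2 hh] at this
    simp at this
  have hT0 : 0 ≤ T := (h0 hFn.some hFn.some).trans (hT _ _)
  set G : Fin n → (Fin n → F) → ℝ := fun i m => (n : ℝ)⁻¹ * ∑ l ∈ Finset.univ.erase i,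
    ss (Finset.univ.erase i) (fun i => pos (m i)) (fun i j => φ (m i) (m j)) r l with hG
  have hGm : ∀ i, Measurable (G i) := fun i =>
    measurable_const.mul (Finset.measurable_sum _ fun l _ => measurable_ss hpos hφ _ r l)
  have bnd : ∀ (A : Finset (Fin n)) (m : Fin n → F), |(n:ℝ)⁻¹ * ∑ l ∈ A,
      ss A (fun i => pos (m i)) (fun i j => φ (m i) (m j)) r l| ≤ (n:ℝ) * T := by
    intro A m
    have hA : (A.card : ℝ) ≤ n := by
      have := Finset.card_le_univ A
      simp only [Fintype.card_fin] at this
      exact_mod_cast this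
    rw [abs_of_nonneg (mul_nonneg (by positivity) (Finset.sum_nonneg fun l _ =>
      ss_nonneg _ _ (fun _ _ => h0 _ _) _ _))]
    have : ∑ l ∈ A, ss A (fun i => pos (m i)) (fun i j => φ (m i) (m j)) r l ≤ n * (n * T) := by
      calc _ ≤ ∑ l ∈ A, (n * T) := Finset.sum_le_sum fun l _ =>
            (ss_le_card A _ (fun _ _ => h0 _ _) (fun _ _ => hT _ _) r l).trans (by gcongr)
        _ = A.card * (n * T) := by simp
        _ ≤ _ := by gcongr
    calc _ ≤ (n:ℝ)⁻¹ * (n * (n * T)) := by gcongr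
      _ = _ := by field_simp
  have ES := efron_stein ν n (SS pos φ r) G (n * T) (measurable_SS hpos hφ r)
    (fun m => bnd Finset.univ m) hGm (fun i m => bnd _ m) ?_
  swap
  · intro i m y
    simp only [hG]
    congr 1
    refine Finset.sum_congr rfl fun l hl => ?_
    have hli := Finset.ne_of_mem_erase hl
    unfold ss
    refine Finset.sum_congr rfl fun j hj => ?_
    have hji := Finset.ne_of_mem_erase hj
    congr 1
    · unfold qq rk
      simp only [Function.update_of_ne hji, Function.update_of_ne hli]
      have : (Finset.univ.erase i).filter (fun k => k ≠ l ∧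
          dist (pos (Function.update m i y k)) (pos (m l)) < dist (pos (m j)) (pos (m l)))
          = (Finset.univ.erase i).filter (fun k => k ≠ l ∧
          dist (pos (m k)) (pos (m l)) < dist (pos (m j)) (pos (m l))) := by
        refine Finset.filter_congr fun k hk => ?_
        rw [Function.update_of_ne (Finset.ne_of_mem_erase hk)]
      rw [this]
    · simp only [Function.update_of_ne hji, Function.update_of_ne hli]
  refine ES.trans ?_
  have hmd : ∀ l l' : Fin n, MeasurableSet {m : Fin n → F | dist (pos (m l)) (pos (m l')) ≤ 2 * ε} :=
    fun l l' => measurableSet_le ((hpos.comp (measurable_pi_apply l)).dist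
      (hpos.comp (measurable_pi_apply l'))) measurable_const
  have hind : ∀ l l' : Fin n, (fun m : Fin n → F =>
      (if dist (pos (m l)) (pos (m l')) ≤ 2 * ε then (1:ℝ) else 0)) =
      Set.indicator {m : Fin n → F | dist (pos (m l)) (pos (m l')) ≤ 2 * ε} 1 := by
    intro l l'; ext m; simp [Set.indicator_apply]
  have hint : ∀ l l' : Fin n, Integrable (fun m : Fin n → F =>
      (if dist (pos (m l)) (pos (m l')) ≤ 2 * ε then (1:ℝ) else 0)) P := by
    intro l l'
    rw [hind]
    exact (integrable_const (1:ℝ)).indicator (hmd l l')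
  have hiv : ∀ l l' : Fin n, ∫ m, (if dist (pos (m l)) (pos (m l')) ≤ 2 * ε then (1:ℝ) else 0) ∂P
      = P.real {m | dist (pos (m l)) (pos (m l')) ≤ 2 * ε} := by
    intro l l'
    rw [hind, integral_indicator_one (hmd l l')]
  rw [← integral_finsetSum]
  swap
  · intro i _
    refine integrable_of_bdd (((measurable_SS hpos hφ r).sub (hGm i)).pow_const 2)
      (4 * (n * T) ^ 2) fun m => ?_
    have a := abs_le.1 (bnd Finset.univ m)
    have b := abs_le.1 (bnd (Finset.univ.erase i) m)
    rw [abs_of_nonneg (sq_nonneg _)]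
    have : |SS pos φ r m - G i m| ≤ 2 * (n * T) := by
      rw [abs_le]; unfold SS; simp only [hG]; constructor <;> linarith
    calc _ = |SS pos φ r m - G i m| ^ 2 := (sq_abs _).symm
      _ ≤ (2 * (n * T)) ^ 2 := pow_le_pow_left₀ (abs_nonneg _) this 2
      _ = _ := by ring
  have inner_int : ∀ l l' : Fin n, Integrable (fun m : Fin n → F =>
      ((r:ℝ) + 1) * (if dist (pos (m l)) (pos (m l')) ≤ 2 * ε then 1 else 0)
      + (∑ i, aa Finset.univ (fun i => pos (m i)) r l i * dist (pos (m i)) (pos (m l)) ^ 2) / ε ^ 2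
      + (∑ i, aa Finset.univ (fun i => pos (m i)) r l' i *
          dist (pos (m i)) (pos (m l')) ^ 2) / ε ^ 2) P := fun l l' =>
    (((hint l l').const_mul _).add ((hRi l).div_const _)).add ((hRi l').div_const _)
  have inner_val : ∀ l l' : Fin n, l ≠ l' → ∫ m, (
      ((r:ℝ) + 1) * (if dist (pos (m l)) (pos (m l')) ≤ 2 * ε then 1 else 0)
      + (∑ i, aa Finset.univ (fun i => pos (m i)) r l i * dist (pos (m i)) (pos (m l)) ^ 2) / ε ^ 2
      + (∑ i, aa Finset.univ (fun i => pos (m i)) r l' i *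
          dist (pos (m i)) (pos (m l')) ^ 2) / ε ^ 2) ∂P ≤ (r + 1) * η + 2 * R / ε ^ 2 := by
    intro l l' hll
    have i12 : Integrable (fun m : Fin n → F =>
      ((r:ℝ) + 1) * (if dist (pos (m l)) (pos (m l')) ≤ 2 * ε then 1 else 0)
      + (∑ i, aa Finset.univ (fun i => pos (m i)) r l i *
        dist (pos (m i)) (pos (m l)) ^ 2) / ε ^ 2) P :=
      ((hint l l').const_mul _).add ((hRi l).div_const _)
    rw [integral_add i12 ((hRi l').div_const _),
      integral_add ((hint l l').const_mul _) ((hRi l).div_const _), integral_const_mul,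
      integral_div, integral_div, hiv]
    have := hη l l' hll
    have h1 := hR l
    have h2 := hR l'
    have : ((r:ℝ) + 1) * P.real {m | dist (pos (m l)) (pos (m l')) ≤ 2 * ε} ≤ (r + 1) * η := by
      gcongr
    have h1' := div_le_div_of_nonneg_right h1 (sq_nonneg ε)
    have h2' := div_le_div_of_nonneg_right h2 (sq_nonneg ε)
    have : 2 * R / ε ^ 2 = R / ε ^ 2 + R / ε ^ 2 := by ring
    linarith
  have tot_int : Integrable (fun m : Fin n → F => ∑ l, ∑ l' ∈ Finset.univ.erase l,
      (((r:ℝ) + 1) * (if dist (pos (m l)) (pos (m l')) ≤ 2 * ε then 1 else 0)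
      + (∑ i, aa Finset.univ (fun i => pos (m i)) r l i * dist (pos (m i)) (pos (m l)) ^ 2) / ε ^ 2
      + (∑ i, aa Finset.univ (fun i => pos (m i)) r l' i *
          dist (pos (m i)) (pos (m l')) ^ 2) / ε ^ 2)) P :=
    integrable_finsetSum _ fun l _ => integrable_finsetSum _ fun l' _ => inner_int l l'
  refine (integral_mono_of_nonneg (Eventually.of_forall fun m =>
    Finset.sum_nonneg fun i _ => sq_nonneg _)
    (((integrable_const ((n:ℝ) * (r + 2))).add tot_int).const_mul (2 * T ^ 2 / n ^ 2))
    (hnt.mono fun m hm => dev_bound hn hm (φ := fun i j => φ (m i) (m j))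
      (fun _ _ => h0 _ _) (fun _ _ => hT _ _) r hε)).trans ?_
  rw [integral_const_mul]
  simp only [Pi.add_apply]
  rw [integral_add (integrable_const _) tot_int, integral_finsetSum _ (fun l _ =>
    integrable_finsetSum _ fun l' _ => inner_int l l')]
  have hlast : ∑ l : Fin n, ∫ m, ∑ l' ∈ Finset.univ.erase l,
      (((r:ℝ) + 1) * (if dist (pos (m l)) (pos (m l')) ≤ 2 * ε then 1 else 0)
      + (∑ i, aa Finset.univ (fun i => pos (m i)) r l i * dist (pos (m i)) (pos (m l)) ^ 2) / ε ^ 2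
      + (∑ i, aa Finset.univ (fun i => pos (m i)) r l' i *
          dist (pos (m i)) (pos (m l')) ^ 2) / ε ^ 2) ∂P
      ≤ n * (n * ((r + 1) * η + 2 * R / ε ^ 2)) := by
    calc _ ≤ ∑ l : Fin n, (n * (((r:ℝ) + 1) * η + 2 * R / ε ^ 2)) := by
          refine Finset.sum_le_sum fun l _ => ?_
          rw [integral_finsetSum _ fun l' _ => inner_int l l']
          calc _ ≤ ∑ l' ∈ Finset.univ.erase l, (((r:ℝ) + 1) * η + 2 * R / ε ^ 2) :=
                Finset.sum_le_sum fun l' hl' => inner_val l l' (Finset.ne_of_mem_erase hl').symm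
            _ ≤ ∑ l' : Fin n, (((r:ℝ) + 1) * η + 2 * R / ε ^ 2) :=
                Finset.sum_le_sum_of_subset_of_nonneg (Finset.erase_subset _ _)
                  fun _ _ _ => by positivity
            _ = _ := by rw [Finset.sum_const, Finset.card_univ, Fintype.card_fin, nsmul_eq_mul]
      _ = _ := by simp
  simp only [integral_const, probReal_univ, one_smul]
  calc _ ≤ 2 * T ^ 2 / n ^ 2 * (n * (r + 2) + n * (n * ((r + 1) * η + 2 * R / ε ^ 2))) := by
        gcongr
    _ = _ := by field_simp; ring

end lln


lemma pi_count {E : Type*} [MeasurableSpace E] (μ : Measure E) [IsProbabilityMeasure μ]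
    {R : Type*} [Fintype R] [DecidableEq R] (B : Set E) [DecidablePred (· ∈ B)]
    (hB : MeasurableSet B) (r : ℕ) :
    (Measure.pi fun _ : R => μ).real {y | (Finset.univ.filter fun i => y i ∈ B).card = r}
      = (Fintype.card R).choose r * (μ.real B) ^ r * (1 - μ.real B) ^ (Fintype.card R - r) := by
  have hset : {y : R → E | (Finset.univ.filter fun i => y i ∈ B).card = r}
      = ⋃ s ∈ Finset.powersetCard r (Finset.univ : Finset R),
        Set.pi Set.univ (fun i => if i ∈ s then B else Bᶜ) := by
    ext y
    simp only [Set.mem_setOf_eq, Set.mem_iUnion, Set.mem_pi, Set.mem_univ, true_imp_iff,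
      Finset.mem_powersetCard, Finset.subset_univ, true_and, exists_prop]
    constructor
    · intro h
      refine ⟨_, h, fun i => ?_⟩
      by_cases hi : y i ∈ B <;> simp [hi]
    · rintro ⟨s, hs, h⟩
      have : (Finset.univ.filter fun i => y i ∈ B) = s := by
        ext i
        have := h i
        by_cases hi : i ∈ s <;> simp_all
      rw [this, hs]
  have hm : ∀ s : Finset R, MeasurableSet
      (Set.pi Set.univ (fun i => if i ∈ s then B else Bᶜ) : Set (R → E)) := by
    intro s
    refine MeasurableSet.univ_pi fun i => ?_
    split_ifs
    exacts [hB, hB.compl]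
  rw [hset, measureReal_biUnion_finset]
  · have : ∀ s ∈ Finset.powersetCard r (Finset.univ : Finset R),
        (Measure.pi fun _ : R => μ).real (Set.pi Set.univ (fun i => if i ∈ s then B else Bᶜ))
        = (μ.real B) ^ r * (1 - μ.real B) ^ (Fintype.card R - r) := by
      intro s hs
      rw [measureReal_def, Measure.pi_pi, ENNReal.toReal_prod]
      have h2 : ∀ i, (μ (if i ∈ s then B else Bᶜ)).toReal
          = if i ∈ s then μ.real B else (1 - μ.real B) := by
        intro i
        split_ifs
        · rfl
        · exact probReal_compl_eq_one_sub hB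
      simp only [h2]
      rw [Finset.prod_ite, Finset.prod_const, Finset.prod_const]
      rw [Finset.mem_powersetCard] at hs
      have h3 : (Finset.univ.filter fun i => i ∈ s) = s := by ext; simp
      have h4 : (Finset.univ.filter fun i => i ∉ s) = sᶜ := by ext; simp
      rw [h3, h4, Finset.card_compl, hs.2]
    rw [Finset.sum_congr rfl this, Finset.sum_const, Finset.card_powersetCard, Finset.card_univ,
      nsmul_eq_mul, mul_assoc]
  · intro s _ t _ hst
    rw [Function.onFun, Set.disjoint_left]
    intro y hy hy'
    apply hst
    ext i
    have h1 := hy i (Set.mem_univ _)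
    have h2 := hy' i (Set.mem_univ _)
    by_cases a : i ∈ s <;> by_cases b : i ∈ t <;> simp_all
  · intro s _
    exact hm s

section rank
variable {E : Type*} [PseudoMetricSpace E] [SecondCountableTopology E] [MeasurableSpace E]
  [BorelSpace E]

/-- mass of the open ball centred at `x` with `z` on its boundary -/
def pp (μ : Measure E) (x z : E) : ℝ := μ.real (Metric.ball x (dist z x))

def bb (N r : ℕ) (p : ℝ) : ℝ := N.choose r * p ^ r * (1 - p) ^ (N - r)

lemma joint_law {Ω' : Type*} [MeasurableSpace Ω'] {P : Measure Ω'} [IsProbabilityMeasure P]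
    {ι : Type*} [Fintype ι] [DecidableEq ι] {X : ι → Ω' → E} (hX : ∀ i, Measurable (X i))
    (hind : iIndepFun X P) (μ : Measure E) [IsProbabilityMeasure μ] (hl : ∀ i, P.map (X i) = μ)
    {l j : ι} (hlj : l ≠ j) :
    P.map (fun ω => ((X l ω, X j ω), fun i : {i // i ∈ (({l, j} : Finset ι)ᶜ)} => X i ω))
      = (μ.prod μ).prod (Measure.pi fun _ => μ) := by
  have h1 := hind.indepFun_finset ({l, j} : Finset ι) (({l, j} : Finset ι)ᶜ) disjoint_compl_right hX
  have h2 : IndepFun (fun ω => (X l ω, X j ω))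
      (fun ω => fun i : {i // i ∈ (({l, j} : Finset ι)ᶜ)} => X i ω) P := by
    have hφm : Measurable (fun v : (({l, j} : Finset ι) → E) =>
        (v ⟨l, by simp⟩, v ⟨j, by simp⟩)) :=
      (measurable_pi_apply _).prodMk (measurable_pi_apply _)
    exact h1.comp hφm measurable_id
  have hrest : Measurable (fun ω => fun i : {i // i ∈ (({l, j} : Finset ι)ᶜ)} => X i ω) :=
    measurable_pi_iff.2 fun i => hX i
  have h3 := (hind.indepFun hlj)
  rw [indepFun_iff_map_prod_eq_prod_map_map ((hX l).prodMk (hX j)).aemeasurable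
    hrest.aemeasurable] at h2
  rw [indepFun_iff_map_prod_eq_prod_map_map (hX l).aemeasurable (hX j).aemeasurable] at h3
  rw [h2, h3, hl, hl]
  have h4 := hind.precomp (g := fun i : {i // i ∈ (({l, j} : Finset ι)ᶜ)} => (i : ι))
    Subtype.val_injective
  have h5 := (iIndepFun_iff_map_fun_eq_pi_map
    (f := fun i : {i // i ∈ (({l, j} : Finset ι)ᶜ)} => X i)
    (fun i => (hX i).aemeasurable)).1 h4
  rw [h5]
  simp only [hl]

lemma rank_formula {Ω' : Type*} [MeasurableSpace Ω'] {P : Measure Ω'} [IsProbabilityMeasure P]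
    {n : ℕ} {X : Fin n → Ω' → E} (hX : ∀ i, Measurable (X i))
    (hind : iIndepFun X P) (μ : Measure E) [IsProbabilityMeasure μ] (hl : ∀ i, P.map (X i) = μ)
    {l j : Fin n} (hlj : l ≠ j) (r : ℕ) {g : E × E → ℝ} (hg : Integrable g (μ.prod μ)) :
    Integrable (fun ω => qq Finset.univ (fun i => X i ω) r l j * g (X l ω, X j ω)) P ∧
    ∫ ω, qq Finset.univ (fun i => X i ω) r l j * g (X l ω, X j ω) ∂P
      = ∫ w, g w * bb (n - 2) r (pp μ w.1 w.2) ∂(μ.prod μ) := by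
  classical
  set T := (({l, j} : Finset (Fin n))ᶜ) with hT
  set H : (E × E) × (T → E) → ℝ := fun w =>
    (if (Finset.univ.filter fun i => w.2 i ∈ Metric.ball w.1.1 (dist w.1.2 w.1.1)).card = r
      then 1 else 0) * g w.1 with hH
  have hJ := joint_law hX hind μ hl hlj
  have hcnt : Measurable fun w : (E × E) × (T → E) =>
      (Finset.univ.filter fun i => w.2 i ∈ Metric.ball w.1.1 (dist w.1.2 w.1.1)).card := by
    simp only [Finset.card_filter, Metric.mem_ball]
    refine Finset.measurable_sum _ fun i _ => ?_
    refine Measurable.ite ?_ measurable_const measurable_const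
    refine measurableSet_lt ?_ ?_
    · exact ((measurable_pi_apply i).comp measurable_snd).dist
        (measurable_fst.comp measurable_fst)
    · exact (measurable_snd.comp measurable_fst).dist (measurable_fst.comp measurable_fst)
  have hite : Measurable fun w : (E × E) × (T → E) =>
      (if (Finset.univ.filter fun i => w.2 i ∈ Metric.ball w.1.1 (dist w.1.2 w.1.1)).card = r
      then (1:ℝ) else 0) :=
    Measurable.ite (hcnt (measurableSet_singleton r)) measurable_const measurable_const
  have hHi : Integrable H ((μ.prod μ).prod (Measure.pi fun _ : T => μ)) := by
    refine Integrable.bdd_mul (c := 1) (hg.comp_fst _) hite.aestronglyMeasurable ?_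
    refine Eventually.of_forall fun w => ?_
    split_ifs <;> simp
  have hmm : Measurable (fun ω => ((X l ω, X j ω), fun i : T => X i ω)) :=
    ((hX l).prodMk (hX j)).prodMk (measurable_pi_iff.2 fun i => hX i)
  have hcomp : ∀ ω, qq Finset.univ (fun i => X i ω) r l j * g (X l ω, X j ω)
      = H ((X l ω, X j ω), fun i : T => X i ω) := by
    intro ω
    simp only [hH]
    congr 1
    unfold qq rk
    have hc : (Finset.univ.filter fun i : Fin n =>
        i ≠ l ∧ dist (X i ω) (X l ω) < dist (X j ω) (X l ω)).card
        = (Finset.univ.filter fun i : T => X i ω ∈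
          Metric.ball (X l ω) (dist (X j ω) (X l ω))).card := by
      symm
      refine Finset.card_bij (fun i _ => (i : Fin n)) ?_ ?_ ?_
      · rintro ⟨i, hi⟩ h
        simp only [hT, Finset.mem_compl, Finset.mem_insert, Finset.mem_singleton, not_or] at hi
        simpa [hi.1] using h
      · intro a _ b _ h
        exact Subtype.ext h
      · intro i hi
        simp only [Finset.mem_filter, Finset.mem_univ, true_and] at hi
        refine ⟨⟨i, ?_⟩, ?_, rfl⟩
        · simp only [hT, Finset.mem_compl, Finset.mem_insert, Finset.mem_singleton, not_or]
          refine ⟨hi.1, ?_⟩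
          rintro rfl
          exact lt_irrefl _ hi.2
        · simpa using hi.2
    simp only [hc, ne_eq, hlj.symm, not_false_eq_true, true_and]
  simp only [hcomp]
  constructor
  · rw [← hJ] at hHi
    exact hHi.comp_measurable hmm
  rw [← integral_map hmm.aemeasurable (f := H) (by rw [hJ]; exact hHi.aestronglyMeasurable), hJ,
    integral_prod _ hHi]
  refine integral_congr_ae (Eventually.of_forall fun w => ?_)
  simp only [hH]
  rw [integral_mul_const, mul_comm]
  congr 1
  have hs : MeasurableSet {y : T → E | (Finset.univ.filter fun i => y i ∈
      Metric.ball w.1 (dist w.2 w.1)).card = r} := by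
    have := hcnt.comp (measurable_prodMk_left (x := w))
    exact this (measurableSet_singleton r)
  have : (fun y : T → E => (if (Finset.univ.filter fun i => y i ∈
      Metric.ball w.1 (dist w.2 w.1)).card = r then (1:ℝ) else 0))
      = Set.indicator {y : T → E | (Finset.univ.filter fun i => y i ∈
      Metric.ball w.1 (dist w.2 w.1)).card = r} 1 := by
    ext y; simp [Set.indicator_apply]
  rw [this, integral_indicator_one hs, pi_count μ _ Metric.isOpen_ball.measurableSet]
  have hcard : Fintype.card T = n - 2 := by
    rw [Fintype.card_coe, hT, Finset.card_compl, Fintype.card_fin, Finset.card_pair hlj]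
  rw [hcard]
  rfl

end rank


def GG (β : ℝ) : ℝ := Real.Gamma (2 + β) + Real.Gamma (3 + β)

lemma GG_pos {β : ℝ} (hβ : 0 ≤ β) : 0 < GG β :=
  add_pos (Real.Gamma_pos_of_pos (by linarith)) (Real.Gamma_pos_of_pos (by linarith))

lemma kern_int {M β : ℝ} (hM : 0 < M) (hβ : 0 ≤ β) :
    IntegrableOn (fun s : ℝ => M ^ 2 * (1 + M * s) * Real.exp (-(M * s)) * s ^ (1 + β)) (Set.Ioi 0) ∧
    ∫ s in Set.Ioi (0:ℝ), M ^ 2 * (1 + M * s) * Real.exp (-(M * s)) * s ^ (1 + β)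
      = GG β * M ^ (-β) := by
  have h1 : IntegrableOn (fun s : ℝ => s ^ (1 + β) * Real.exp (-M * s)) (Set.Ioi 0) :=
    integrableOn_rpow_mul_exp_neg_mul_rpow (s := 1 + β) (p := 1) (by linarith) one_pos hM |>.congr_fun
      (fun s _ => by simp) measurableSet_Ioi
  have h2 : IntegrableOn (fun s : ℝ => s ^ (2 + β) * Real.exp (-M * s)) (Set.Ioi 0) :=
    integrableOn_rpow_mul_exp_neg_mul_rpow (s := 2 + β) (p := 1) (by linarith) one_pos hM |>.congr_fun
      (fun s _ => by simp) measurableSet_Ioi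
  have e1 := Real.integral_rpow_mul_exp_neg_mul_Ioi (a := 2 + β) (r := M) (by linarith) hM
  have e2 := Real.integral_rpow_mul_exp_neg_mul_Ioi (a := 3 + β) (r := M) (by linarith) hM
  have heq : ∀ s ∈ Set.Ioi (0:ℝ), M ^ 2 * (s ^ (1 + β) * Real.exp (-M * s)) +
      M ^ 3 * (s ^ (2 + β) * Real.exp (-M * s))
      = M ^ 2 * (1 + M * s) * Real.exp (-(M * s)) * s ^ (1 + β) := by
    intro s hs
    have : s ^ (2 + β) = s * s ^ (1 + β) := by
      rw [show 2 + β = 1 + (1 + β) by ring, Real.rpow_add hs, Real.rpow_one]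
    rw [this, neg_mul]
    ring
  have h3 : IntegrableOn (fun s : ℝ => M ^ 2 * (s ^ (1 + β) * Real.exp (-M * s)) +
      M ^ 3 * (s ^ (2 + β) * Real.exp (-M * s))) (Set.Ioi 0) :=
    (h1.const_mul _).add (h2.const_mul _)
  refine ⟨h3.congr_fun heq measurableSet_Ioi, ?_⟩
  rw [← setIntegral_congr_fun measurableSet_Ioi heq, integral_add (h1.const_mul _) (h2.const_mul _),
    integral_const_mul, integral_const_mul]
  have a1 : ∫ s in Set.Ioi (0:ℝ), s ^ (1 + β) * Real.exp (-M * s)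
      = (1 / M) ^ (2 + β) * Real.Gamma (2 + β) := by
    rw [← e1]
    refine setIntegral_congr_fun measurableSet_Ioi fun s _ => ?_
    rw [show 2 + β - 1 = 1 + β by ring, neg_mul]
  have a2 : ∫ s in Set.Ioi (0:ℝ), s ^ (2 + β) * Real.exp (-M * s)
      = (1 / M) ^ (3 + β) * Real.Gamma (3 + β) := by
    rw [← e2]
    refine setIntegral_congr_fun measurableSet_Ioi fun s _ => ?_
    rw [show 3 + β - 1 = 2 + β by ring, neg_mul]
  rw [a1, a2, GG]
  have b1 : M ^ 2 * (1 / M) ^ (2 + β) = M ^ (-β) := by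
    rw [one_div, Real.inv_rpow hM.le, ← Real.rpow_neg hM.le, ← Real.rpow_natCast, ← Real.rpow_add hM]
    congr 1; push_cast; ring
  have b2 : M ^ 3 * (1 / M) ^ (3 + β) = M ^ (-β) := by
    rw [one_div, Real.inv_rpow hM.le, ← Real.rpow_neg hM.le, ← Real.rpow_natCast, ← Real.rpow_add hM]
    congr 1; push_cast; ring
  rw [← mul_assoc, ← mul_assoc, b1, b2]
  ring

lemma kern_bound {u V : ℝ → ℝ} {K C₁ C₂ β M : ℝ} (hM : 0 < M) (hβ : 0 ≤ β) (hK : 0 ≤ K)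
    (h1 : 0 ≤ C₁) (h2 : 0 ≤ C₂)
    (hu : ∀ s ∈ Set.Ioc (0:ℝ) 1, |u s| ≤ K * (M ^ 2 * (1 + M * s) * Real.exp (-(M * s))))
    (hV : ∀ s ∈ Set.Ioo (0:ℝ) 1, |V s| ≤ C₁ * s ^ (1 + β) + C₂ * s ^ (2 + β)) :
    |∫ s in Set.Ioc (0:ℝ) 1, u s * V s| ≤
      K * (C₁ * (GG β * M ^ (-β)) + C₂ * (GG (β + 1) * M ^ (-(β + 1)))) := by
  obtain ⟨i1, j1⟩ := kern_int hM hβ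
  obtain ⟨i2, j2⟩ := kern_int hM (show 0 ≤ β + 1 by linarith)
  set k : ℝ → ℝ := fun s => M ^ 2 * (1 + M * s) * Real.exp (-(M * s)) with hk
  have hk0 : ∀ s, 0 < s → 0 ≤ k s := fun s hs => by positivity
  have i3 : IntegrableOn (fun s => K * (C₁ * (k s * s ^ (1 + β)) + C₂ * (k s * s ^ (1 + (β + 1)))))
    (Set.Ioi 0) := ((i1.const_mul _).add (i2.const_mul _)).const_mul _
  have hne : ∀ᵐ s ∂(volume.restrict (Set.Ioc (0:ℝ) 1)), s ≠ 1 :=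
    ae_restrict_of_ae (by simp [ae_iff])
  calc |∫ s in Set.Ioc (0:ℝ) 1, u s * V s|
      ≤ ∫ s in Set.Ioc (0:ℝ) 1, K * (C₁ * (k s * s ^ (1 + β)) + C₂ * (k s * s ^ (1 + (β + 1)))) := by
        rw [← Real.norm_eq_abs]
        refine norm_integral_le_of_norm_le (i3.mono_set Set.Ioc_subset_Ioi_self) ?_
        filter_upwards [ae_restrict_mem measurableSet_Ioc, hne] with s hs hs1
        rw [Real.norm_eq_abs, abs_mul]
        have hb := hV s ⟨hs.1, lt_of_le_of_ne hs.2 hs1⟩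
        have := mul_le_mul (hu s hs) hb (abs_nonneg _) (mul_nonneg hK (hk0 s hs.1))
        refine this.trans (le_of_eq ?_)
        rw [show 1 + (β + 1) = 2 + β by ring]
        simp only [hk]
        ring
    _ ≤ ∫ s in Set.Ioi (0:ℝ), K * (C₁ * (k s * s ^ (1 + β)) + C₂ * (k s * s ^ (1 + (β + 1)))) := by
        refine setIntegral_mono_set i3 ?_ (Set.Ioc_subset_Ioi_self.eventuallyLE)
        filter_upwards [ae_restrict_mem measurableSet_Ioi] with s hs
        have hs' : 0 < s := hs
        have := hk0 s hs'
        simp only [Pi.zero_apply]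
        positivity
    _ = _ := by
        rw [integral_const_mul, integral_add (i1.const_mul _) (i2.const_mul _), integral_const_mul,
          integral_const_mul, j1, j2]

/-- kernels, `r = 0` or `1` -/
def ww (r m : ℕ) (s : ℝ) : ℝ := (m + 3) * bb (m + 2) r s

def uu (r m : ℕ) (s : ℝ) : ℝ :=
  if r = 0 then (m + 3) * (m + 2) * (1 - s) ^ (m + 1)
  else -((m + 3) * (m + 2) * ((1 - s) ^ (m + 1) - (m + 1) * s * (1 - s) ^ m))

lemma uu_cont (r m : ℕ) : Continuous (uu r m) := by
  unfold uu
  split_ifs <;> fun_prop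

lemma ww_deriv {r : ℕ} (hr : r < 2) (m : ℕ) (s : ℝ) : HasDerivAt (ww r m) (-uu r m s) s := by
  have h1 : HasDerivAt (fun s : ℝ => 1 - s) (-1) s := by
    simpa using (hasDerivAt_id s).const_sub 1
  interval_cases r
  · have h2 := (h1.pow (m + 2)).const_mul ((m:ℝ) + 3)
    have e : ww 0 m = fun s => ((m:ℝ) + 3) * (1 - s) ^ (m + 2) := by
      ext s; simp [ww, bb]
    rw [e]
    refine HasDerivAt.congr_deriv h2 ?_
    simp [uu]; ring
  · have h2 := ((hasDerivAt_id s).mul (h1.pow (m + 1))).const_mul (((m:ℝ) + 3) * (m + 2))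
    have e : ww 1 m = fun s => ((m:ℝ) + 3) * (m + 2) * (s * (1 - s) ^ (m + 1)) := by
      ext s; simp [ww, bb]; ring
    rw [e]
    refine HasDerivAt.congr_deriv h2 ?_
    simp only [uu, one_ne_zero, if_false, Pi.pow_apply, id, Nat.add_sub_cancel]
    push_cast
    ring

lemma ww_one {r : ℕ} (hr : r < 2) (m : ℕ) : ww r m 1 = 0 := by
  interval_cases r <;> simp [ww, bb]

lemma ww_eq {r : ℕ} (hr : r < 2) (m : ℕ) (p : ℝ) : ww r m p = ∫ s in p..1, uu r m s := by
  have := intervalIntegral.integral_eq_sub_of_hasDerivAt (a := p) (b := 1)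
    (fun s _ => (ww_deriv hr m s).neg) (by simpa using (uu_cont r m).intervalIntegrable _ _)
  simp only [neg_neg] at this
  rw [this]
  simp [ww_one hr]

lemma uu_bound (r m : ℕ) {s : ℝ} (hs : s ∈ Set.Ioc (0:ℝ) 1) :
    |uu r m s| ≤ (6 * Real.exp 1) * (((m:ℝ) + 1) ^ 2 * (1 + ((m:ℝ) + 1) * s) *
      Real.exp (-(((m:ℝ) + 1) * s))) := by
  obtain ⟨h0, h1⟩ := hs
  have e0 : (1 - s) ^ m ≤ Real.exp 1 * Real.exp (-(((m:ℝ) + 1) * s)) := by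
    have : (1 - s) ^ m ≤ Real.exp (-s) ^ m :=
      pow_le_pow_left₀ (by linarith) (by linarith [Real.add_one_le_exp (-s)]) m
    refine this.trans ?_
    rw [← Real.exp_nat_mul, ← Real.exp_add]
    apply Real.exp_le_exp.2
    nlinarith
  have e00 : 0 ≤ (1 - s) ^ m := pow_nonneg (by linarith) _
  have e1 : (1 - s) ^ (m + 1) ≤ (1 - s) ^ m := by
    rw [pow_succ]; nlinarith
  have e10 : 0 ≤ (1 - s) ^ (m + 1) := pow_nonneg (by linarith) _
  have hm : (0:ℝ) ≤ m := Nat.cast_nonneg m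
  have hA : ((m:ℝ) + 3) * (m + 2) ≤ 6 * ((m:ℝ) + 1) ^ 2 := by nlinarith
  have hB : |uu r m s| ≤ ((m:ℝ) + 3) * (m + 2) * ((1 + (m + 1) * s) * (1 - s) ^ m) := by
    have hms : 0 ≤ ((m:ℝ) + 1) * s * (1 - s) ^ m := by positivity
    have h6 : (0:ℝ) ≤ ((m:ℝ) + 3) * (m + 2) := by positivity
    unfold uu
    split_ifs
    · rw [abs_of_nonneg (by positivity)]
      refine mul_le_mul_of_nonneg_left ?_ h6
      nlinarith
    · rw [abs_neg, abs_mul, abs_of_nonneg h6]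
      refine mul_le_mul_of_nonneg_left ?_ h6
      rw [abs_le]
      constructor <;> nlinarith
  refine hB.trans ?_
  have : ((m:ℝ) + 3) * (m + 2) * ((1 + (m + 1) * s) * (1 - s) ^ m) ≤
    6 * ((m:ℝ) + 1) ^ 2 * ((1 + (m + 1) * s) * (Real.exp 1 * Real.exp (-(((m:ℝ) + 1) * s)))) := by
    gcongr
  refine this.trans (le_of_eq (by ring))

lemma uu_cancel (m : ℕ) {α : ℝ} (hα : 0 ≤ α) :
    ∫ s in (0:ℝ)..1, (uu 1 m s - (1 + α) * uu 0 m s) * s ^ (1 + α) = 0 := by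
  have hd : ∀ s : ℝ, HasDerivAt (fun s => -(ww 1 m s * s ^ (1 + α)))
      (-((-uu 1 m s) * s ^ (1 + α) + ww 1 m s * ((1 + α) * s ^ (1 + α - 1)))) s := fun s =>
    ((ww_deriv (by norm_num) m s).mul (Real.hasDerivAt_rpow_const (Or.inr (by linarith)))).neg
  have hc : Continuous fun s : ℝ => (uu 1 m s - (1 + α) * uu 0 m s) * s ^ (1 + α) :=
    ((uu_cont 1 m).sub (continuous_const.mul (uu_cont 0 m))).mul
      (Real.continuous_rpow_const (by linarith))
  have hd2 : ∀ s ∈ Set.uIcc (0:ℝ) 1, HasDerivAt (fun s => -(ww 1 m s * s ^ (1 + α)))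
      ((uu 1 m s - (1 + α) * uu 0 m s) * s ^ (1 + α)) s := by
    intro s hs
    rw [Set.uIcc_of_le zero_le_one] at hs
    convert hd s using 1
    have e : ww 1 m s = s * uu 0 m s := by simp [ww, bb, uu]; ring
    have e2 : s * s ^ (1 + α - 1) = s ^ (1 + α) := by
      rcases hs.1.eq_or_lt with h | h
      · rw [← h, Real.zero_rpow (by linarith : 1 + α ≠ 0)]; simp
      · rw [show 1 + α = 1 + (1 + α - 1) by ring, Real.rpow_add h, Real.rpow_one]; ring_nf
    rw [e, sub_mul, ← e2]
    ring
  rw [intervalIntegral.integral_eq_sub_of_hasDerivAt hd2 (hc.intervalIntegrable _ _), ww_one (by norm_num)]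
  simp [ww, bb]



section radial
variable {E : Type*} [PseudoMetricSpace E] [SecondCountableTopology E] [MeasurableSpace E]
  [BorelSpace E] (μ : Measure E) [IsProbabilityMeasure μ]

lemma pp_nonneg (x z : E) : 0 ≤ pp μ x z := measureReal_nonneg
lemma pp_le_one (x z : E) : pp μ x z ≤ 1 := measureReal_le_one

lemma measurable_pp2 : Measurable fun w : E × E => pp μ w.1 w.2 := by
  have hs : MeasurableSet {q : (E × E) × E | dist q.2 q.1.1 < dist q.1.2 q.1.1} := by
    refine measurableSet_lt ?_ ?_
    · exact measurable_snd.dist (measurable_fst.comp measurable_fst)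
    · exact (measurable_snd.comp measurable_fst).dist (measurable_fst.comp measurable_fst)
  exact (measurable_measure_prodMk_left (ν := μ) hs).ennreal_toReal

lemma measurable_pp (x : E) : Measurable fun z : E => pp μ x z :=
  (measurable_pp2 μ).comp measurable_prodMk_left

lemma layer_cake {r : ℕ} (hr : r < 2) (m : ℕ) (x : E) {g : E → ℝ} (hg : Integrable g μ) :
    ∫ z, g z * ww r m (pp μ x z) ∂μ
      = ∫ s in Set.Ioc (0:ℝ) 1, uu r m s * ∫ z in {z | pp μ x z < s}, g z ∂μ := by
  have hS : MeasurableSet {q : E × ℝ | pp μ x q.1 < q.2} :=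
    measurableSet_lt ((measurable_pp μ x).comp measurable_fst) measurable_snd
  have hui : Integrable (uu r m) (volume.restrict (Set.Ioc (0:ℝ) 1)) :=
    ((uu_cont r m).integrableOn_Icc (a := 0) (b := 1)).mono_set Set.Ioc_subset_Icc_self
  have hi : Integrable (Set.indicator {q : E × ℝ | pp μ x q.1 < q.2}
      (fun q : E × ℝ => g q.1 * uu r m q.2)) (μ.prod (volume.restrict (Set.Ioc (0:ℝ) 1))) :=
    (hg.mul_prod hui).indicator hS
  have h1 : ∀ z, g z * ww r m (pp μ x z) = ∫ s in Set.Ioc (0:ℝ) 1,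
      Set.indicator {q : E × ℝ | pp μ x q.1 < q.2} (fun q : E × ℝ => g q.1 * uu r m q.2) (z, s) := by
    intro z
    have : ∀ s, Set.indicator {q : E × ℝ | pp μ x q.1 < q.2}
        (fun q : E × ℝ => g q.1 * uu r m q.2) (z, s)
        = Set.indicator (Set.Ioi (pp μ x z)) (fun s => g z * uu r m s) s := by
      intro s
      simp [Set.indicator_apply]
    simp only [this]
    rw [setIntegral_indicator measurableSet_Ioi]
    have hset : Set.Ioc (0:ℝ) 1 ∩ Set.Ioi (pp μ x z) = Set.Ioc (pp μ x z) 1 := by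
      ext s
      have := pp_nonneg μ x z
      simp only [Set.mem_inter_iff, Set.mem_Ioc, Set.mem_Ioi]
      constructor
      · rintro ⟨⟨a, b⟩, c⟩; exact ⟨c, b⟩
      · rintro ⟨a, b⟩; exact ⟨⟨by linarith, b⟩, a⟩
    rw [hset, integral_const_mul, ww_eq hr, intervalIntegral.integral_of_le (pp_le_one μ x z)]
  simp only [h1]
  rw [integral_integral_swap (f := fun z s => Set.indicator {q : E × ℝ | pp μ x q.1 < q.2}
      (fun q : E × ℝ => g q.1 * uu r m q.2) (z, s)) hi]
  refine integral_congr_ae (Eventually.of_forall fun s => ?_)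
  dsimp only
  have hms : MeasurableSet {z | pp μ x z < s} := measurable_pp μ x measurableSet_Iio
  rw [← integral_const_mul, ← integral_indicator hms]
  refine integral_congr_ae (Eventually.of_forall fun z => ?_)
  simp [Set.indicator_apply, mul_comm]

variable {μ}

lemma ball_cont (hsph : ∀ (x : E) (r : ℝ), μ (Metric.sphere x r) = 0) (x : E) :
    Continuous fun r => μ.real (Metric.ball x r) := by
  have e : ∀ r, μ.real (Metric.ball x r) = ∫ y, Set.indicator (Metric.ball x r) (1 : E → ℝ) y ∂μ :=
    fun r => (integral_indicator_one Metric.isOpen_ball.measurableSet).symm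
  simp only [e]
  refine continuous_iff_continuousAt.2 fun r => ?_
  refine continuousAt_of_dominated (bound := fun _ => 1) ?_ ?_ (integrable_const _) ?_
  · exact Eventually.of_forall fun r => (measurable_one.indicator
      Metric.isOpen_ball.measurableSet).aestronglyMeasurable
  · refine Eventually.of_forall fun r => Eventually.of_forall fun y => ?_
    by_cases h : y ∈ Metric.ball x r <;> simp [Set.indicator_apply, h]
  · have : ∀ᵐ y ∂μ, y ∉ Metric.sphere x r := measure_eq_zero_iff_ae_notMem.1 (hsph x r)
    filter_upwards [this] with y hy
    have hy' : dist y x ≠ r := hy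
    rcases lt_or_gt_of_ne hy' with h | h
    · refine (continuousAt_const (y := (1:ℝ))).congr ?_
      filter_upwards [lt_mem_nhds h] with t ht
      simp [Set.indicator_apply, ht]
    · refine (continuousAt_const (y := (0:ℝ))).congr ?_
      filter_upwards [gt_mem_nhds h] with t ht
      simp [Set.indicator_apply, ht.le]

lemma exists_radius (hsph : ∀ (x : E) (r : ℝ), μ (Metric.sphere x r) = 0) (x : E) {s : ℝ}
    (h0 : 0 < s) (h1 : s < 1) :
    ∃ r > 0, {z | pp μ x z < s} = Metric.ball x r ∧ μ.real (Metric.ball x r) = s := by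
  have hc := ball_cont hsph x
  have hmono : ∀ {a b : ℝ}, a ≤ b → μ.real (Metric.ball x a) ≤ μ.real (Metric.ball x b) :=
    fun h => measureReal_mono (Metric.ball_subset_ball h)
  obtain ⟨R, hR0, hR⟩ : ∃ R > 0, s < μ.real (Metric.ball x R) := by
    have ht : Tendsto (fun n : ℕ => μ (Metric.ball x n)) atTop (𝓝 (μ (⋃ n : ℕ, Metric.ball x n))) :=
      tendsto_measure_iUnion_atTop fun a b h => Metric.ball_subset_ball (by exact_mod_cast h)
    rw [Metric.iUnion_ball_nat, measure_univ] at ht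
    have ht2 := (ENNReal.tendsto_toReal ENNReal.one_ne_top).comp ht
    have := (ht2.eventually (lt_mem_nhds (show s < (1 : ENNReal).toReal by simpa using h1))).and
      (eventually_gt_atTop 0)
    obtain ⟨n, hn, hn0⟩ := this.exists
    exact ⟨n, by exact_mod_cast hn0, hn⟩
  have hK : IsCompact (Set.Icc 0 R ∩ {r | μ.real (Metric.ball x r) = s}) :=
    isCompact_Icc.inter_right (isClosed_eq hc continuous_const)
  have hne : (Set.Icc 0 R ∩ {r | μ.real (Metric.ball x r) = s}).Nonempty := by
    obtain ⟨r, hr, hrs⟩ := intermediate_value_Icc hR0.le hc.continuousOn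
      (show s ∈ Set.Icc (μ.real (Metric.ball x 0)) (μ.real (Metric.ball x R)) from
        ⟨by simp [h0.le], hR.le⟩)
    exact ⟨r, hr, hrs⟩
  obtain ⟨r, ⟨hr, hrs⟩, hmin⟩ := hK.exists_isLeast hne
  have hrs : μ.real (Metric.ball x r) = s := hrs
  refine ⟨r, ?_, ?_, hrs⟩
  · rcases hr.1.eq_or_lt with h | h
    · rw [← h] at hrs; simp at hrs; linarith
    · exact h
  · ext z
    simp only [Set.mem_setOf_eq, Metric.mem_ball]
    constructor
    · intro h
      by_contra hcon
      have := hmono (not_lt.1 hcon)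
      have : pp μ x z ≥ s := hrs ▸ this
      linarith
    · intro h
      have h2 : pp μ x z ≤ s := hrs ▸ hmono h.le
      refine lt_of_le_of_ne h2 fun h3 => ?_
      have := hmin ⟨⟨dist_nonneg, h.le.trans hr.2⟩, h3⟩
      linarith

lemma meas_pp_lt (hsph : ∀ (x : E) (r : ℝ), μ (Metric.sphere x r) = 0) (x : E) {s : ℝ}
    (h : s ∈ Set.Ioo (0:ℝ) 1) : μ.real {z | pp μ x z < s} = s := by
  obtain ⟨r, _, h1, h2⟩ := exists_radius hsph x h.1 h.2
  rw [h1, h2]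

/-- moment bound -/
lemma mom_bound (hsph : ∀ (x : E) (r : ℝ), μ (Metric.sphere x r) = 0) {r : ℕ} (hr : r < 2) (m : ℕ)
    (x : E) {g : E → ℝ} (hg : Measurable g) {C β : ℝ} (hβ : 0 ≤ β) (hC : 0 ≤ C)
    (hgb : ∀ᵐ z ∂μ, |g z| ≤ C * pp μ x z ^ β) :
    |∫ z, g z * ww r m (pp μ x z) ∂μ| ≤ 6 * Real.exp 1 * (C * (GG β * ((m:ℝ) + 1) ^ (-β))) := by
  have hgi : Integrable g μ := by
    refine Integrable.mono' (integrable_const C) hg.aestronglyMeasurable ?_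
    filter_upwards [hgb] with z hz
    refine hz.trans ?_
    have := Real.rpow_le_one (pp_nonneg μ x z) (pp_le_one μ x z) hβ
    nlinarith
  rw [layer_cake μ hr m x hgi]
  have := kern_bound (u := uu r m) (V := fun s => ∫ z in {z | pp μ x z < s}, g z ∂μ)
    (K := 6 * Real.exp 1) (C₁ := C) (C₂ := 0) (β := β) (M := (m:ℝ) + 1) (by positivity) hβ
    (by positivity) hC le_rfl (fun s hs => uu_bound r m hs) ?_
  · simpa using this
  · intro s hs
    have h1 : ‖∫ z in {z | pp μ x z < s}, g z ∂μ‖ ≤ (C * s ^ β) * μ.real {z | pp μ x z < s} := by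
      refine norm_setIntegral_le_of_norm_le_const_ae' (measure_lt_top _ _) ?_
      filter_upwards [hgb] with z hz hzs
      refine hz.trans ?_
      exact mul_le_mul_of_nonneg_left
        (Real.rpow_le_rpow (pp_nonneg μ x z) (le_of_lt hzs) hβ) hC
    rw [meas_pp_lt hsph x hs] at h1
    rw [Real.norm_eq_abs] at h1
    refine h1.trans (le_of_eq ?_)
    rw [Real.rpow_add hs.1, Real.rpow_one]
    ring

/-- limit with the cancelling kernel -/
lemma cancel_lim {x : E} {g : E → ℝ} (hg : Integrable g μ) {C α L : ℝ} (hα : 0 ≤ α)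
    (hC : 0 ≤ C)
    (hV : ∀ s ∈ Set.Ioo (0:ℝ) 1, |∫ z in {z | pp μ x z < s}, g z ∂μ| ≤ C * s ^ (1 + α))
    (hlim : ∀ ε > 0, ∃ δ > 0, ∀ s ∈ Set.Ioo (0:ℝ) 1, s < δ →
      |(∫ z in {z | pp μ x z < s}, g z ∂μ) - L * s ^ (1 + α)| ≤ ε * s ^ (1 + α)) :
    Tendsto (fun m : ℕ => ((m:ℝ) + 1) ^ α * (∫ z, g z * ww 1 m (pp μ x z) ∂μ
      - (1 + α) * ∫ z, g z * ww 0 m (pp μ x z) ∂μ)) atTop (𝓝 0) := by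
  set V : ℝ → ℝ := fun s => ∫ z in {z | pp μ x z < s}, g z ∂μ with hVdef
  set K : ℝ := (6 * Real.exp 1) * (2 + α) with hK
  have hK0 : 0 < K := by positivity
  have hS : MeasurableSet {q : ℝ × E | pp μ x q.2 < q.1} :=
    measurableSet_lt ((measurable_pp μ x).comp measurable_snd) measurable_fst
  have hVi : ∀ r m, Integrable (fun s => uu r m s * V s) (volume.restrict (Set.Ioc (0:ℝ) 1)) := by
    intro r m
    have hui : Integrable (uu r m) (volume.restrict (Set.Ioc (0:ℝ) 1)) :=
      ((uu_cont r m).integrableOn_Icc (a := 0) (b := 1)).mono_set Set.Ioc_subset_Icc_self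
    have := ((hui.mul_prod hg).indicator hS).integral_prod_left
    refine this.congr (Eventually.of_forall fun s => ?_)
    simp only [hVdef]
    have hms : MeasurableSet {z | pp μ x z < s} := measurable_pp μ x measurableSet_Iio
    rw [← integral_const_mul, ← integral_indicator hms]
    refine integral_congr_ae (Eventually.of_forall fun z => ?_)
    simp [Set.indicator_apply]
  have hpc : ∀ m, Integrable (fun s => (uu 1 m s - (1 + α) * uu 0 m s) * (L * s ^ (1 + α)))
      (volume.restrict (Set.Ioc (0:ℝ) 1)) := by
    intro m
    have hc : Continuous fun s : ℝ => (uu 1 m s - (1 + α) * uu 0 m s) * (L * s ^ (1 + α)) :=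
      ((uu_cont 1 m).sub (continuous_const.mul (uu_cont 0 m))).mul
        (continuous_const.mul (Real.continuous_rpow_const (by linarith)))
    exact (hc.integrableOn_Icc (a := 0) (b := 1)).mono_set Set.Ioc_subset_Icc_self
  have hform : ∀ m, ∫ z, g z * ww 1 m (pp μ x z) ∂μ - (1 + α) * ∫ z, g z * ww 0 m (pp μ x z) ∂μ
      = ∫ s in Set.Ioc (0:ℝ) 1, (uu 1 m s - (1 + α) * uu 0 m s) * (V s - L * s ^ (1 + α)) := by
    intro m
    rw [layer_cake μ (by norm_num) m x hg, layer_cake μ (by norm_num) m x hg]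
    have hz := uu_cancel m hα
    rw [intervalIntegral.integral_of_le zero_le_one] at hz
    have hz2 : ∫ s in Set.Ioc (0:ℝ) 1, (uu 1 m s - (1 + α) * uu 0 m s) * (L * s ^ (1 + α)) = 0 := by
      have : ∀ s : ℝ, (uu 1 m s - (1 + α) * uu 0 m s) * (L * s ^ (1 + α))
        = L * ((uu 1 m s - (1 + α) * uu 0 m s) * s ^ (1 + α)) := fun s => by ring
      simp only [this]
      rw [integral_const_mul, hz, mul_zero]
    have e : ∀ s : ℝ, (uu 1 m s - (1 + α) * uu 0 m s) * (V s - L * s ^ (1 + α))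
        = (uu 1 m s * V s - (1 + α) * (uu 0 m s * V s))
          - (uu 1 m s - (1 + α) * uu 0 m s) * (L * s ^ (1 + α)) := fun s => by ring
    simp only [e]
    have hi1 : Integrable (fun s => uu 1 m s * V s - (1 + α) * (uu 0 m s * V s))
        (volume.restrict (Set.Ioc (0:ℝ) 1)) := (hVi 1 m).sub ((hVi 0 m).const_mul _)
    rw [integral_sub hi1 (hpc m), hz2, sub_zero, integral_sub (hVi 1 m) ((hVi 0 m).const_mul _),
      integral_const_mul]
  rw [Metric.tendsto_atTop]
  intro ε hε
  have hG := GG_pos hα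
  have hG1 := GG_pos (show 0 ≤ α + 1 by linarith)
  obtain ⟨δ, hδ, hb⟩ := hlim (ε / (2 * (K * GG α))) (by positivity)
  set D := (C + |L|) / δ with hD
  have hD0 : 0 ≤ D := by positivity
  have hbd : ∀ m : ℕ, |((m:ℝ) + 1) ^ α * (∫ z, g z * ww 1 m (pp μ x z) ∂μ
      - (1 + α) * ∫ z, g z * ww 0 m (pp μ x z) ∂μ)|
      ≤ ε / 2 + K * D * GG (α + 1) * ((m:ℝ) + 1)⁻¹ := by
    intro m
    have hM : (0:ℝ) < (m:ℝ) + 1 := by positivity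
    rw [hform, abs_mul, abs_of_pos (Real.rpow_pos_of_pos hM _)]
    have hk := kern_bound (u := fun s => uu 1 m s - (1 + α) * uu 0 m s)
      (V := fun s => V s - L * s ^ (1 + α))
      (K := K) (C₁ := ε / (2 * (K * GG α))) (C₂ := D) (β := α) hM hα hK0.le (by positivity) hD0 ?_ ?_
    · refine (mul_le_mul_of_nonneg_left hk (Real.rpow_pos_of_pos hM _).le).trans (le_of_eq ?_)
      have e1 : ((m:ℝ) + 1) ^ α * ((m:ℝ) + 1) ^ (-α) = 1 := by
        rw [← Real.rpow_add hM]; simp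
      have e2 : ((m:ℝ) + 1) ^ (-(α + 1)) = ((m:ℝ) + 1) ^ (-α) * ((m:ℝ) + 1)⁻¹ := by
        rw [neg_add, Real.rpow_add hM, Real.rpow_neg_one]
      rw [e2]
      have e3 : ((m:ℝ) + 1) ^ α * (K * (ε / (2 * (K * GG α)) * (GG α * ((m:ℝ) + 1) ^ (-α)) +
          D * (GG (α + 1) * (((m:ℝ) + 1) ^ (-α) * ((m:ℝ) + 1)⁻¹))))
        = (((m:ℝ) + 1) ^ α * ((m:ℝ) + 1) ^ (-α)) * (K * (ε / (2 * (K * GG α)) * (GG α) +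
          D * (GG (α + 1) * (((m:ℝ) + 1)⁻¹)))) := by ring
      rw [e3, e1]
      field_simp
    · intro s hs
      have h1 := uu_bound 1 m hs
      have h0 := uu_bound 0 m hs
      set B := (((m:ℝ) + 1) ^ 2 * (1 + ((m:ℝ) + 1) * s) * Real.exp (-(((m:ℝ) + 1) * s)))
      calc |uu 1 m s - (1 + α) * uu 0 m s| ≤ |uu 1 m s| + (1 + α) * |uu 0 m s| := by
            have := abs_sub (uu 1 m s) ((1 + α) * uu 0 m s)
            rwa [abs_mul, abs_of_nonneg (show 0 ≤ 1 + α by linarith)] at this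
        _ ≤ (6 * Real.exp 1) * B + (1 + α) * ((6 * Real.exp 1) * B) := by gcongr
        _ = K * B := by rw [hK]; ring
    · intro s hs
      have hsp : 0 ≤ s ^ (1 + α) := Real.rpow_nonneg hs.1.le _
      have hsp2 : 0 ≤ s ^ (2 + α) := Real.rpow_nonneg hs.1.le _
      rcases lt_or_ge s δ with h | h
      · refine (hb s hs h).trans ?_
        have := mul_nonneg hD0 hsp2
        linarith
      · have h1 : |V s - L * s ^ (1 + α)| ≤ (C + |L|) * s ^ (1 + α) := by
          have := abs_sub (V s) (L * s ^ (1 + α))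
          rw [abs_mul, abs_of_nonneg hsp] at this
          linarith [hV s hs]
        have h2 : (C + |L|) * s ^ (1 + α) ≤ D * s ^ (2 + α) := by
          have e5 : s ^ (2 + α) = s * s ^ (1 + α) := by
            rw [show 2 + α = 1 + (1 + α) by ring, Real.rpow_add hs.1 1, Real.rpow_one]
          rw [e5, ← mul_assoc]
          refine mul_le_mul_of_nonneg_right ?_ hsp
          rw [hD, div_mul_eq_mul_div, le_div_iff₀ hδ]
          exact mul_le_mul_of_nonneg_left h (by positivity)
        have : 0 ≤ ε / (2 * (K * GG α)) * s ^ (1 + α) := by positivity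
        linarith
  have hz : Tendsto (fun m : ℕ => K * D * GG (α + 1) * ((m:ℝ) + 1)⁻¹) atTop (𝓝 0) := by
    have := (tendsto_one_div_add_atTop_nhds_zero_nat (𝕜 := ℝ)).const_mul (K * D * GG (α + 1))
    simpa [one_div] using this
  obtain ⟨N, hN⟩ := (Metric.tendsto_atTop.1 hz) (ε / 2) (by positivity)
  refine ⟨N, fun m hm => ?_⟩
  have h1 := hN m hm
  rw [Real.dist_eq, sub_zero] at h1 ⊢
  have h2 := hbd m
  linarith [le_abs_self (K * D * GG (α + 1) * ((m:ℝ) + 1)⁻¹)]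

end radial


section leb
variable {d : ℕ}

lemma scal_int (A : EucSp d →L[ℝ] ℝ) (x : EucSp d) {r : ℝ} (hr : 0 < r) :
    ∫ z in Metric.closedBall x r, (A (z - x)) ^ 2
      = r ^ d * (r ^ 2 * ∫ z in Metric.closedBall (0 : EucSp d) 1, (A z) ^ 2) := by
  have h1 := (measurePreserving_sub_right (volume : Measure (EucSp d)) x).setIntegral_preimage_emb
    (MeasurableEquiv.subRight x).measurableEmbedding (fun z => (A z) ^ 2) (Metric.closedBall 0 r)
  have hpre : (fun z : EucSp d => z - x) ⁻¹' (Metric.closedBall 0 r) = Metric.closedBall x r := by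
    ext z; simp [dist_eq_norm]
  rw [hpre] at h1
  rw [h1]
  have h2 := Measure.setIntegral_comp_smul_of_pos (volume : Measure (EucSp d))
    (fun z => (A z) ^ 2) (Metric.closedBall 0 1) hr
  rw [smul_closedBall _ _ zero_le_one] at h2
  simp only [smul_zero, Real.norm_eq_abs, abs_of_pos hr, mul_one, map_smul, smul_eq_mul, mul_pow,
    finrank_euclideanSpace, Fintype.card_fin] at h2
  rw [integral_const_mul] at h2
  rw [h2]
  field_simp

variable {κ : EucSp d → ℝ}

lemma leb_lim (hκ : Integrable κ) (hκ0 : ∀ x, 0 ≤ κ x) {h : EucSp d → ℝ} (hh : Continuous h)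
    {x : EucSp d} (hx : DifferentiableAt ℝ h x)
    (hL : Tendsto (fun r => ⨍ y in Metric.closedBall x r, ‖κ y - κ x‖) (𝓝[>] (0:ℝ)) (𝓝 0)) :
    Tendsto (fun r : ℝ => (∫ z in Metric.closedBall x r, κ z) / r ^ d) (𝓝[>] (0:ℝ))
      (𝓝 (κ x * volume.real (Metric.closedBall (0 : EucSp d) 1))) ∧
    Tendsto (fun r : ℝ => (∫ z in Metric.closedBall x r, κ z * (h z - h x) ^ 2) / (r ^ d * r ^ 2))
      (𝓝[>] (0:ℝ))
      (𝓝 (κ x * ∫ z in Metric.closedBall (0 : EucSp d) 1, (fderiv ℝ h x z) ^ 2)) := by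
  set ω := volume.real (Metric.closedBall (0 : EucSp d) 1) with hω
  have hω0 : 0 < ω := by
    rw [hω, measureReal_def]
    exact ENNReal.toReal_pos (Metric.measure_closedBall_pos _ _ one_pos).ne'
      measure_closedBall_lt_top.ne
  set A := fderiv ℝ h x with hA
  have hvol : ∀ r > 0, volume.real (Metric.closedBall x r) = r ^ d * ω := by
    intro r hr
    rw [Measure.addHaar_real_closedBall' _ _ hr.le]; simp [hω]
  have hκi : ∀ r, IntegrableOn κ (Metric.closedBall x r) := fun r => hκ.integrableOn
  have hci : ∀ r (c : ℝ), IntegrableOn (fun _ : EucSp d => c) (Metric.closedBall x r) := fun r c =>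
    integrableOn_const measure_closedBall_lt_top.ne
  set D : ℝ → ℝ := fun r => (∫ y in Metric.closedBall x r, |κ y - κ x|) / r ^ d with hD
  have hDlim : Tendsto D (𝓝[>] (0:ℝ)) (𝓝 0) := by
    have := hL.const_mul ω
    rw [mul_zero] at this
    refine this.congr' ?_
    filter_upwards [self_mem_nhdsWithin] with r hr
    rw [setAverage_eq, hvol r hr, smul_eq_mul, hD]
    simp only [Real.norm_eq_abs]
    have hr' : 0 < r := hr
    field_simp
  have hdi : ∀ r, IntegrableOn (fun y => |κ y - κ x|) (Metric.closedBall x r) := fun r =>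
    ((hκi r).sub (hci r (κ x))).abs
  have hp : Tendsto (fun r : ℝ => (∫ z in Metric.closedBall x r, κ z) / r ^ d) (𝓝[>] (0:ℝ))
      (𝓝 (κ x * ω)) := by
    rw [tendsto_iff_norm_sub_tendsto_zero]
    refine squeeze_zero' (Eventually.of_forall fun _ => norm_nonneg _) ?_ hDlim
    filter_upwards [self_mem_nhdsWithin] with r hr
    have hr' : 0 < r := hr
    have e : (∫ z in Metric.closedBall x r, κ z) / r ^ d - κ x * ω
        = (∫ z in Metric.closedBall x r, (κ z - κ x)) / r ^ d := by
      rw [integral_sub (hκi r) (hci r _), setIntegral_const, hvol r hr, smul_eq_mul]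
      field_simp
    rw [e, norm_div, Real.norm_of_nonneg (pow_pos hr' d).le, hD]
    exact div_le_div_of_nonneg_right (norm_integral_le_integral_norm _) (pow_pos hr' d).le
  refine ⟨hp, ?_⟩
  set B := ∫ z in Metric.closedBall (0 : EucSp d) 1, (A z) ^ 2 with hB
  rw [Metric.tendsto_nhdsWithin_nhds] at *
  -- integrability
  have hi1 : ∀ r, IntegrableOn (fun z => κ z * (h z - h x) ^ 2) (Metric.closedBall x r) := by
    intro r
    exact (hκi r).mul_continuousOn (by fun_prop) (isCompact_closedBall _ _)
  have hi2 : ∀ r, IntegrableOn (fun z => κ z * (A (z - x)) ^ 2) (Metric.closedBall x r) := by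
    intro r
    exact (hκi r).mul_continuousOn (by fun_prop) (isCompact_closedBall _ _)
  have hi3 : ∀ r, IntegrableOn (fun z => κ x * (A (z - x)) ^ 2) (Metric.closedBall x r) := by
    intro r
    exact (hci r (κ x)).mul_continuousOn (by fun_prop) (isCompact_closedBall _ _)
  have hmain : ∀ ε > 0, ε ≤ 1 → ∀ᶠ r in 𝓝[>] (0:ℝ),
      |(∫ z in Metric.closedBall x r, κ z * (h z - h x) ^ 2) / (r ^ d * r ^ 2) - κ x * B|
      ≤ ε * (2 * ‖A‖ + 1) * ((∫ z in Metric.closedBall x r, κ z) / r ^ d) + ‖A‖ ^ 2 * D r := by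
    intro ε hε hε1
    have hlo := (hx.hasFDerivAt.isLittleO.def hε)
    obtain ⟨ρ, hρ, hball⟩ := Metric.eventually_nhds_iff.1 hlo
    filter_upwards [Ioo_mem_nhdsGT hρ] with r hr
    have hr' : 0 < r := hr.1
    have hrd : 0 < r ^ d := pow_pos hr' d
    have e1 : (∫ z in Metric.closedBall x r, κ z * (h z - h x) ^ 2) / (r ^ d * r ^ 2) - κ x * B
        = ((∫ z in Metric.closedBall x r, (κ z * (h z - h x) ^ 2 - κ z * (A (z - x)) ^ 2))
          + ∫ z in Metric.closedBall x r, (κ z * (A (z - x)) ^ 2 - κ x * (A (z - x)) ^ 2))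
          / (r ^ d * r ^ 2) := by
      rw [integral_sub (hi1 r) (hi2 r), integral_sub (hi2 r) (hi3 r), integral_const_mul,
        scal_int A x hr']
      field_simp
      ring
    rw [e1, abs_div, abs_of_pos (show 0 < r ^ d * r ^ 2 by positivity), div_le_iff₀ (by positivity)]
    have b1 : ‖∫ z in Metric.closedBall x r, (κ z * (h z - h x) ^ 2 - κ z * (A (z - x)) ^ 2)‖
        ≤ ∫ z in Metric.closedBall x r, (ε * (2 * ‖A‖ + 1) * r ^ 2) * κ z := by
      refine norm_integral_le_of_norm_le ((hκi r).const_mul _) ?_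
      filter_upwards [ae_restrict_mem measurableSet_closedBall] with z hz
      have hz' : ‖z - x‖ ≤ r := by simpa [dist_eq_norm] using hz
      have hzz := hball (y := z) (lt_of_le_of_lt hz hr.2)
      have hAz := A.le_opNorm (z - x)
      rw [Real.norm_eq_abs] at hzz hAz
      rw [← mul_sub, norm_mul, Real.norm_of_nonneg (hκ0 z), mul_comm]
      refine mul_le_mul_of_nonneg_right ?_ (hκ0 z)
      have e2 : (h z - h x) ^ 2 - (A (z - x)) ^ 2
          = (h z - h x - A (z - x)) * ((h z - h x - A (z - x)) + 2 * A (z - x)) := by ring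
      rw [e2, norm_mul, Real.norm_eq_abs, Real.norm_eq_abs]
      have e3 : |(h z - h x - A (z - x)) + 2 * A (z - x)| ≤ (2 * ‖A‖ + 1) * r := by
        refine (abs_add_le _ _).trans ?_
        rw [abs_mul, abs_two]
        have : ε * ‖z - x‖ ≤ 1 * r := mul_le_mul hε1 hz' (norm_nonneg _) zero_le_one
        have : ‖A‖ * ‖z - x‖ ≤ ‖A‖ * r := mul_le_mul_of_nonneg_left hz' (norm_nonneg _)
        linarith
      have e4 : |h z - h x - A (z - x)| ≤ ε * r :=
        hzz.trans (mul_le_mul_of_nonneg_left hz' hε.le)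
      refine (mul_le_mul e4 e3 (abs_nonneg _) (by positivity)).trans (le_of_eq (by ring))
    have b2 : ‖∫ z in Metric.closedBall x r, (κ z * (A (z - x)) ^ 2 - κ x * (A (z - x)) ^ 2)‖
        ≤ ∫ z in Metric.closedBall x r, (‖A‖ ^ 2 * r ^ 2) * |κ z - κ x| := by
      refine norm_integral_le_of_norm_le ((hdi r).const_mul _) ?_
      filter_upwards [ae_restrict_mem measurableSet_closedBall] with z hz
      have hz' : ‖z - x‖ ≤ r := by simpa [dist_eq_norm] using hz
      have hAz := A.le_opNorm (z - x)
      rw [← sub_mul, norm_mul, mul_comm, Real.norm_eq_abs, Real.norm_eq_abs]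
      refine mul_le_mul_of_nonneg_right ?_ (abs_nonneg _)
      rw [abs_pow, ← mul_pow]
      refine pow_le_pow_left₀ (abs_nonneg _) (hAz.trans ?_) 2
      exact mul_le_mul_of_nonneg_left hz' (norm_nonneg _)
    rw [integral_const_mul, Real.norm_eq_abs] at b1 b2
    refine (abs_add_le _ _).trans ((add_le_add b1 b2).trans (le_of_eq ?_))
    simp only [hD]
    field_simp
  have hp' := hp
  intro ε hε
  set P := κ x * ω with hP
  have hP0 : 0 ≤ P := mul_nonneg (hκ0 x) hω0.le
  -- choose small epsilon
  set ε' := min 1 (ε / (4 * ((2 * ‖A‖ + 1) * (P + 1)))) with hε'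
  have hpos : 0 < (2 * ‖A‖ + 1) * (P + 1) := by positivity
  have hε'0 : 0 < ε' := lt_min one_pos (by positivity)
  have ev := hmain ε' hε'0 (min_le_left _ _)
  have ev2 : ∀ᶠ r in 𝓝[>] (0:ℝ), (∫ z in Metric.closedBall x r, κ z) / r ^ d < P + 1 := by
    have : Tendsto (fun r : ℝ => (∫ z in Metric.closedBall x r, κ z) / r ^ d) (𝓝[>] (0:ℝ)) (𝓝 P) :=
      Metric.tendsto_nhdsWithin_nhds.2 hp
    exact this.eventually (gt_mem_nhds (by linarith))
  have ev3 : ∀ᶠ r in 𝓝[>] (0:ℝ), D r < ε / (4 * (‖A‖ ^ 2 + 1)) := by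
    have : Tendsto D (𝓝[>] (0:ℝ)) (𝓝 0) := Metric.tendsto_nhdsWithin_nhds.2 hDlim
    exact this.eventually (gt_mem_nhds (by positivity))
  have ev4 := (ev.and (ev2.and ev3))
  obtain ⟨δ, hδ, hfin⟩ := Metric.mem_nhdsWithin_iff.1 ev4
  refine ⟨δ, hδ, fun {r} hr hrδ => ?_⟩
  obtain ⟨a1, a2, a3⟩ := hfin ⟨hrδ, hr⟩
  rw [Real.dist_eq]
  refine lt_of_le_of_lt a1 ?_
  have c1 : ε' * (2 * ‖A‖ + 1) * ((∫ z in Metric.closedBall x r, κ z) / r ^ d) ≤ ε / 4 := by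
    calc _ ≤ ε' * (2 * ‖A‖ + 1) * (P + 1) := by gcongr
      _ ≤ (ε / (4 * ((2 * ‖A‖ + 1) * (P + 1)))) * (2 * ‖A‖ + 1) * (P + 1) := by
        gcongr; exact min_le_right _ _
      _ = ε / 4 := by field_simp
  have c2 : ‖A‖ ^ 2 * D r ≤ ε / 4 := by
    calc ‖A‖ ^ 2 * D r ≤ ‖A‖ ^ 2 * (ε / (4 * (‖A‖ ^ 2 + 1))) := by gcongr
      _ ≤ (‖A‖ ^ 2 + 1) * (ε / (4 * (‖A‖ ^ 2 + 1))) := by gcongr; linarith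
      _ = ε / 4 := by field_simp
  linarith

end leb


section setup
variable {d : ℕ} {κ : EucSp d → ℝ}

/-- the law with density `κ` -/
def muK (κ : EucSp d → ℝ) : Measure (EucSp d) := volume.withDensity fun x => ENNReal.ofReal (κ x)

lemma muK_sphere (hd : 1 ≤ d) (κ : EucSp d → ℝ) (x : EucSp d) (r : ℝ) :
    muK κ (Metric.sphere x r) = 0 := by
  haveI : Nonempty (Fin d) := ⟨⟨0, hd⟩⟩
  exact withDensity_absolutelyContinuous _ _ (Measure.addHaar_sphere volume x r)

lemma kappa_int (hm : Measurable κ) (h0 : ∀ x, 0 ≤ κ x) [IsProbabilityMeasure (muK κ)] :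
    Integrable κ := by
  refine ⟨hm.aestronglyMeasurable, ?_⟩
  rw [hasFiniteIntegral_iff_ofReal (Eventually.of_forall h0)]
  have : muK κ Set.univ = 1 := measure_univ
  rw [muK, withDensity_apply _ MeasurableSet.univ, Measure.restrict_univ] at this
  rw [this]; exact ENNReal.one_lt_top

lemma muK_real (hm : Measurable κ) (h0 : ∀ x, 0 ≤ κ x) {S : Set (EucSp d)} (hS : MeasurableSet S) :
    (muK κ).real S = ∫ y in S, κ y := by
  rw [measureReal_def, muK, withDensity_apply _ hS,
    integral_eq_lintegral_of_nonneg_ae (Eventually.of_forall h0) hm.aestronglyMeasurable]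

lemma muK_integral (hm : Measurable κ) (h0 : ∀ x, 0 ≤ κ x) {S : Set (EucSp d)}
    (hS : MeasurableSet S) (g : EucSp d → ℝ) :
    ∫ z in S, g z ∂(muK κ) = ∫ z in S, κ z * g z := by
  rw [muK, setIntegral_withDensity_eq_setIntegral_toReal_smul hm.ennreal_ofReal
    (Eventually.of_forall fun _ => ENNReal.ofReal_lt_top) g hS]
  simp [ENNReal.toReal_ofReal (h0 _)]

lemma muK_ball (hd : 1 ≤ d) (κ : EucSp d → ℝ) (x : EucSp d) (r : ℝ) :
    Metric.ball x r =ᵐ[muK κ] Metric.closedBall x r := by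
  rw [← Metric.ball_union_sphere]
  have := muK_sphere hd κ x r
  refine (union_ae_eq_left_of_ae_eq_empty (ae_eq_empty.2 this)).symm

lemma muK_mem {Ωs : Set (EucSp d)} (hΩo : IsOpen Ωs) (hm : Measurable κ) (h0 : ∀ x, 0 ≤ κ x)
    [IsProbabilityMeasure (muK κ)] (h1 : ∫ x in Ωs, κ x = 1) : ∀ᵐ x ∂(muK κ), x ∈ Ωs := by
  rw [← muK_real hm h0 hΩo.measurableSet] at h1
  have : muK κ Ωs = 1 := by
    rw [measureReal_def] at h1
    exact (ENNReal.toReal_eq_one_iff _).1 h1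
  exact (prob_compl_eq_zero_iff hΩo.measurableSet).2 this

lemma muK_low (hd : 1 ≤ d) {Ωs : Set (EucSp d)} (hΩb : Bornology.IsBounded Ωs)
    (hm : Measurable κ) (h0 : ∀ x, 0 ≤ κ x) [IsProbabilityMeasure (muK κ)]
    (hκball : ∃ c > 0, ∀ x ∈ Ωs, ∀ r : ℝ, 0 < r → r ≤ 1 →
      c * r ^ d ≤ ∫ y in Metric.closedBall x r, κ y) :
    ∃ c > 0, (∀ x ∈ Ωs, ∀ z ∈ Ωs, c * dist z x ^ d ≤ pp (muK κ) x z) ∧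
      ∀ x ∈ Ωs, ∀ r : ℝ, 0 < r → r ≤ 1 → c * r ^ d ≤ (muK κ).real (Metric.ball x r) := by
  obtain ⟨c, hc, hb⟩ := hκball
  obtain ⟨R₀, hR₀⟩ := Metric.isBounded_iff.1 hΩb
  set R := max R₀ 1 with hR
  have hR1 : 1 ≤ R := le_max_right _ _
  have hRd : 1 ≤ R ^ d := one_le_pow₀ hR1
  have hcR : c / R ^ d ≤ c := div_le_self hc.le hRd
  have key : ∀ x ∈ Ωs, ∀ r : ℝ, 0 < r → r ≤ 1 → c * r ^ d ≤ (muK κ).real (Metric.ball x r) := by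
    intro x hx r h1 h2
    rw [measureReal_congr (muK_ball hd κ x r), muK_real hm h0 measurableSet_closedBall]
    exact hb x hx r h1 h2
  refine ⟨c / R ^ d, by positivity, ?_, ?_⟩
  · intro x hx z hz
    have hzR : dist z x ≤ R := (hR₀ hz hx).trans (le_max_left _ _)
    rcases (dist_nonneg (x := z) (y := x)).eq_or_lt with h | h
    · rw [← h, zero_pow (by omega), mul_zero]; exact pp_nonneg _ _ _
    rcases le_total (dist z x) 1 with h1 | h1
    · exact (mul_le_mul_of_nonneg_right hcR (by positivity)).trans (key x hx _ h h1)
    · calc c / R ^ d * dist z x ^ d ≤ c / R ^ d * R ^ d := by gcongr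
        _ = c * 1 ^ d := by field_simp; simp
        _ ≤ (muK κ).real (Metric.ball x 1) := key x hx 1 one_pos le_rfl
        _ ≤ pp (muK κ) x z := measureReal_mono (Metric.ball_subset_ball h1)
  · intro x hx r h1 h2
    exact (mul_le_mul_of_nonneg_right hcR (by positivity)).trans (key x hx _ h1 h2)

lemma h_lip {Ωs : Set (EucSp d)} (hΩb : Bornology.IsBounded Ωs) {h : EucSp d → ℝ}
    (hh : ContDiff ℝ 2 h) : ∃ Lh > 0, ∀ x ∈ Ωs, ∀ z ∈ Ωs, |h z - h x| ≤ Lh * dist z x := by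
  obtain ⟨R, hR⟩ := hΩb.subset_closedBall 0
  have hc : Continuous (fderiv ℝ h) := hh.continuous_fderiv (by norm_num)
  obtain ⟨C, hC⟩ := (isCompact_closedBall (0 : EucSp d) R).exists_bound_of_continuousOn hc.continuousOn
  refine ⟨max C 1, lt_of_lt_of_le one_pos (le_max_right _ _), fun x hx z hz => ?_⟩
  have := (convex_closedBall (0 : EucSp d) R).norm_image_sub_le_of_norm_fderiv_le (𝕜 := ℝ)
    (f := h) (C := max C 1) (fun y _ => (hh.differentiable (by norm_num)).differentiableAt)
    (fun y hy => (hC y hy).trans (le_max_left _ _)) (hR hx) (hR hz)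
  rwa [← dist_eq_norm z x] at this

lemma V_lim (hd : 1 ≤ d) (hm : Measurable κ) (h0 : ∀ x, 0 ≤ κ x) [IsProbabilityMeasure (muK κ)]
    {h : EucSp d → ℝ} (hh : ContDiff ℝ 2 h) {x : EucSp d} {c : ℝ} (hc : 0 < c)
    (hlow : ∀ r : ℝ, 0 < r → r ≤ 1 → c * r ^ d ≤ (muK κ).real (Metric.ball x r))
    (hL : Tendsto (fun r => ⨍ y in Metric.closedBall x r, ‖κ y - κ x‖) (𝓝[>] (0:ℝ)) (𝓝 0)) :
    ∃ L, ∀ ε > 0, ∃ δ > 0, ∀ s ∈ Set.Ioo (0:ℝ) 1, s < δ →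
      |(∫ z in {z | pp (muK κ) x z < s}, (h z - h x) ^ 2 ∂(muK κ)) - L * s ^ (1 + 2 / (d:ℝ))|
        ≤ ε * s ^ (1 + 2 / (d:ℝ)) := by
  have hd0 : (0:ℝ) < d := by exact_mod_cast hd
  set α : ℝ := 2 / (d:ℝ) with hα
  obtain ⟨h1, h2⟩ := leb_lim (kappa_int hm h0) h0 hh.continuous
    (hh.differentiable (by norm_num)).differentiableAt (x := x) hL
  have hb : ∀ r, (muK κ).real (Metric.ball x r) = ∫ y in Metric.closedBall x r, κ y := fun r => by
    rw [measureReal_congr (muK_ball hd κ x r), muK_real hm h0 measurableSet_closedBall]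
  set P := κ x * volume.real (Metric.closedBall (0 : EucSp d) 1) with hP
  have hPc : c ≤ P := by
    refine ge_of_tendsto h1 ?_
    filter_upwards [Ioc_mem_nhdsGT one_pos] with r hr
    rw [le_div_iff₀ (pow_pos hr.1 d), ← hb]
    exact hlow r hr.1 hr.2
  have hP0 : 0 < P := hc.trans_le hPc
  have h3 := h2.div (h1.rpow_const (p := 1 + α) (Or.inl hP0.ne')) (Real.rpow_pos_of_pos hP0 _).ne'
  set L := (κ x * ∫ z in Metric.closedBall (0 : EucSp d) 1, (fderiv ℝ h x z) ^ 2) / P ^ (1 + α)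
    with hLdef
  refine ⟨L, fun ε hε => ?_⟩
  obtain ⟨ρ, hρ, hF⟩ := Metric.tendsto_nhdsWithin_nhds.1 h3 ε hε
  set ρ₁ := min ρ 1 with hρ₁
  have hρ₁0 : 0 < ρ₁ := lt_min hρ one_pos
  refine ⟨c * ρ₁ ^ d, by positivity, fun s hs hsδ => ?_⟩
  obtain ⟨r, hr, hset, hmass⟩ := exists_radius (muK_sphere hd κ) x hs.1 hs.2
  have hrρ : r < ρ₁ := by
    by_contra hcon
    have a := hlow ρ₁ hρ₁0 (min_le_right _ _)
    have b : (muK κ).real (Metric.ball x ρ₁) ≤ (muK κ).real (Metric.ball x r) :=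
      measureReal_mono (Metric.ball_subset_ball (not_lt.1 hcon))
    linarith
  have hF1 := hF (x := r) hr (by
    rw [Real.dist_eq, sub_zero, abs_of_pos hr]; exact hrρ.trans_le (min_le_left _ _))
  rw [Real.dist_eq] at hF1
  have hsr : ∫ y in Metric.closedBall x r, κ y = s := by rw [← hb, hmass]
  have hV : ∫ z in {z | pp (muK κ) x z < s}, (h z - h x) ^ 2 ∂(muK κ)
      = ∫ z in Metric.closedBall x r, κ z * (h z - h x) ^ 2 := by
    rw [hset, setIntegral_congr_set (muK_ball hd κ x r),
      muK_integral hm h0 measurableSet_closedBall]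
  rw [hV]
  simp only [Pi.div_apply, hsr] at hF1
  have hs1 : 0 < s ^ (1 + α) := Real.rpow_pos_of_pos hs.1 _
  have hrr : (s / r ^ d) ^ (1 + α) = s ^ (1 + α) / (r ^ d * r ^ 2) := by
    rw [Real.div_rpow hs.1.le (by positivity)]
    congr 1
    rw [Real.rpow_add (by positivity), Real.rpow_one, ← Real.rpow_natCast r d, ← Real.rpow_mul hr.le]
    congr 1
    rw [hα, mul_div_cancel₀ _ hd0.ne', ← Real.rpow_natCast]
    norm_num
  rw [hrr] at hF1
  set W := ∫ z in Metric.closedBall x r, κ z * (h z - h x) ^ 2 with hW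
  have e : W / (r ^ d * r ^ 2) / (s ^ (1 + α) / (r ^ d * r ^ 2)) = W / s ^ (1 + α) := by
    have : 0 < r ^ d * r ^ 2 := by positivity
    field_simp
  rw [e] at hF1
  have e2 : W - L * s ^ (1 + α) = (W / s ^ (1 + α) - L) * s ^ (1 + α) := by
    field_simp
  rw [e2, abs_mul, abs_of_pos hs1]
  exact mul_le_mul_of_nonneg_right hF1.le hs1.le

end setup


lemma bb_bd (N r : ℕ) {p : ℝ} (h0 : 0 ≤ p) (h1 : p ≤ 1) : |bb N r p| ≤ N.choose r := by
  unfold bb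
  have a : p ^ r ≤ 1 := pow_le_one₀ h0 h1
  have b : (1 - p) ^ (N - r) ≤ 1 := pow_le_one₀ (by linarith) (by linarith)
  have a0 : 0 ≤ p ^ r := pow_nonneg h0 _
  have b0 : 0 ≤ (1 - p) ^ (N - r) := pow_nonneg (by linarith) _
  have c0 : (0:ℝ) ≤ N.choose r := Nat.cast_nonneg _
  rw [abs_of_nonneg (by positivity), mul_assoc]
  have : p ^ r * (1 - p) ^ (N - r) ≤ 1 := mul_le_one₀ a b0 b
  nlinarith

lemma bb_meas (N r : ℕ) : Measurable (bb N r) := by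
  unfold bb; fun_prop

lemma ww_meas (r m : ℕ) : Measurable (ww r m) := (bb_meas _ _).const_mul _

section prodmom
variable {E : Type*} [PseudoMetricSpace E] [SecondCountableTopology E] [MeasurableSpace E]
  [BorelSpace E] {μ : Measure E} [IsProbabilityMeasure μ]

lemma prod_ae_mem {S : Set E} (hS : ∀ᵐ x ∂μ, x ∈ S) :
    ∀ᵐ w ∂(μ.prod μ), w.1 ∈ S ∧ w.2 ∈ S :=
  (Measure.quasiMeasurePreserving_fst.ae hS).and (Measure.quasiMeasurePreserving_snd.ae hS)

lemma int_mul_ww {f : E × E → ℝ} (hf : Integrable f (μ.prod μ)) (r m : ℕ) :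
    Integrable (fun w => f w * ww r m (pp μ w.1 w.2)) (μ.prod μ) := by
  refine hf.mul_bdd (c := ((m:ℝ) + 3) * (m + 2).choose r)
    ((ww_meas r m).comp (measurable_pp2 μ)).aestronglyMeasurable ?_
  refine Eventually.of_forall fun w => ?_
  rw [Real.norm_eq_abs, ww, abs_mul, abs_of_nonneg (by positivity)]
  exact mul_le_mul_of_nonneg_left (bb_bd _ _ (pp_nonneg _ _ _) (pp_le_one _ _ _)) (by positivity)

lemma prod_mom (hsph : ∀ (x : E) (r : ℝ), μ (Metric.sphere x r) = 0) {S : Set E}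
    (hS : ∀ᵐ x ∂μ, x ∈ S) {f : E × E → ℝ} (hf : Measurable f) {C β : ℝ} (hβ : 0 ≤ β)
    (hC : 0 ≤ C) (hb : ∀ x ∈ S, ∀ z ∈ S, |f (x, z)| ≤ C * pp μ x z ^ β) :
    Integrable f (μ.prod μ) ∧ ∀ r < 2, ∀ m : ℕ,
      |∫ w, f w * ww r m (pp μ w.1 w.2) ∂(μ.prod μ)| ≤
        6 * Real.exp 1 * (C * (GG β * ((m:ℝ) + 1) ^ (-β))) := by
  have hfi : Integrable f (μ.prod μ) := by
    refine Integrable.mono' (integrable_const C) hf.aestronglyMeasurable ?_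
    filter_upwards [prod_ae_mem hS] with w hw
    refine (hb w.1 hw.1 w.2 hw.2).trans ?_
    have := Real.rpow_le_one (pp_nonneg μ w.1 w.2) (pp_le_one μ w.1 w.2) hβ
    nlinarith
  refine ⟨hfi, fun r hr m => ?_⟩
  rw [integral_prod _ (int_mul_ww hfi r m), ← Real.norm_eq_abs]
  have := norm_integral_le_of_norm_le_const (μ := μ)
    (f := fun x => ∫ z, f (x, z) * ww r m (pp μ x z) ∂μ)
    (C := 6 * Real.exp 1 * (C * (GG β * ((m:ℝ) + 1) ^ (-β)))) ?_
  · simpa using this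
  · filter_upwards [hS] with x hx
    rw [Real.norm_eq_abs]
    refine mom_bound hsph hr m x (hf.comp measurable_prodMk_left) hβ hC ?_
    filter_upwards [hS] with z hz
    exact hb x hx z hz

end prodmom

lemma dist_pow_le {d : ℕ} (hd : 1 ≤ d) {c D p : ℝ} (hc : 0 < c) (hD : 0 ≤ D)
    (h : c * D ^ d ≤ p) : D ^ 2 ≤ c⁻¹ ^ (2 / (d:ℝ)) * p ^ (2 / (d:ℝ)) := by
  have hd0 : (0:ℝ) < d := by exact_mod_cast hd
  have hp : 0 ≤ p := le_trans (by positivity) h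
  have e : D ^ 2 = (D ^ d) ^ (2 / (d:ℝ)) := by
    rw [← Real.rpow_natCast D d, ← Real.rpow_mul hD, mul_div_cancel₀ _ hd0.ne', ← Real.rpow_natCast]
    norm_num
  rw [e, ← Real.mul_rpow (by positivity) hp]
  refine Real.rpow_le_rpow (by positivity) ?_ (by positivity)
  rw [inv_mul_eq_div, le_div_iff₀ hc]
  linarith

section setup
variable {d : ℕ} {κ : EucSp d → ℝ}

theorem analysis (hd : 1 ≤ d) (Ωs : Set (EucSp d)) (hΩo : IsOpen Ωs)
    (hΩb : Bornology.IsBounded Ωs) (hm : Measurable κ) (h0 : ∀ x, 0 ≤ κ x)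
    [IsProbabilityMeasure (muK κ)] (hκ1 : ∫ x in Ωs, κ x = 1)
    (hκball : ∃ c > 0, ∀ x ∈ Ωs, ∀ r : ℝ, 0 < r → r ≤ 1 →
      c * r ^ d ≤ ∫ y in Metric.closedBall x r, κ y)
    {h : EucSp d → ℝ} (hh : ContDiff ℝ 2 h) :
    (∃ C : ℝ, 0 ≤ C ∧
      Integrable (fun w : EucSp d × EucSp d => dist w.2 w.1 ^ 2) ((muK κ).prod (muK κ)) ∧
      Integrable (fun w : EucSp d × EucSp d => (h w.2 - h w.1) ^ 2) ((muK κ).prod (muK κ)) ∧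
      Integrable (fun w : EucSp d × EucSp d => (h w.2 - h w.1) ^ 4) ((muK κ).prod (muK κ)) ∧
      (∀ r < 2, ∀ m : ℕ, ∫ w, dist w.2 w.1 ^ 2 * ww r m (pp (muK κ) w.1 w.2) ∂((muK κ).prod (muK κ))
        ≤ C * ((m:ℝ) + 1) ^ (-(2 / (d:ℝ)))) ∧
      (∀ r < 2, ∀ m : ℕ, ∫ w, (h w.2 - h w.1) ^ 4 * ww r m (pp (muK κ) w.1 w.2) ∂((muK κ).prod (muK κ))
        ≤ C * ((m:ℝ) + 1) ^ (-(2 * (2 / (d:ℝ)))))) ∧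
    Tendsto (fun m : ℕ => ((m:ℝ) + 1) ^ (2 / (d:ℝ)) *
      (∫ w, (h w.2 - h w.1) ^ 2 * ww 1 m (pp (muK κ) w.1 w.2) ∂((muK κ).prod (muK κ))
        - (1 + 2 / (d:ℝ)) *
        ∫ w, (h w.2 - h w.1) ^ 2 * ww 0 m (pp (muK κ) w.1 w.2) ∂((muK κ).prod (muK κ))))
      atTop (𝓝 0) := by
  obtain ⟨c, hc, hlow, hlow2⟩ := muK_low hd hΩb hm h0 hκball
  obtain ⟨Lh, hLh, hlip⟩ := h_lip hΩb hh
  have hmem := muK_mem hΩo hm h0 hκ1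
  have hsph := muK_sphere hd κ
  set μ := muK κ with hμ
  set α : ℝ := 2 / (d:ℝ) with hα
  have hα0 : 0 ≤ α := by positivity
  have hhm : Measurable h := hh.continuous.measurable
  set q := c⁻¹ ^ α with hq
  have hq0 : 0 ≤ q := by positivity
  have hdist : ∀ x ∈ Ωs, ∀ z ∈ Ωs, dist z x ^ 2 ≤ q * pp μ x z ^ α := fun x hx z hz =>
    dist_pow_le hd hc dist_nonneg (hlow x hx z hz)
  have hh2 : ∀ x ∈ Ωs, ∀ z ∈ Ωs, (h z - h x) ^ 2 ≤ (Lh ^ 2 * q) * pp μ x z ^ α := by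
    intro x hx z hz
    have h1 : (h z - h x) ^ 2 ≤ (Lh * dist z x) ^ 2 := by
      rw [← sq_abs]; exact pow_le_pow_left₀ (abs_nonneg _) (hlip x hx z hz) 2
    rw [mul_pow] at h1
    refine h1.trans ?_
    rw [mul_assoc]
    exact mul_le_mul_of_nonneg_left (hdist x hx z hz) (by positivity)
  have m1 : Measurable fun w : EucSp d × EucSp d => dist w.2 w.1 ^ 2 :=
    (measurable_snd.dist measurable_fst).pow_const 2
  have m2 : Measurable fun w : EucSp d × EucSp d => (h w.2 - h w.1) ^ 2 :=
    ((hhm.comp measurable_snd).sub (hhm.comp measurable_fst)).pow_const 2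
  have m4 : Measurable fun w : EucSp d × EucSp d => (h w.2 - h w.1) ^ 4 :=
    ((hhm.comp measurable_snd).sub (hhm.comp measurable_fst)).pow_const 4
  obtain ⟨i1, b1⟩ := prod_mom hsph hmem m1 hα0 hq0 (fun x hx z hz => by
    rw [abs_of_nonneg (by positivity)]; exact hdist x hx z hz)
  obtain ⟨i2, b2⟩ := prod_mom hsph hmem m2 hα0 (C := Lh ^ 2 * q) (by positivity)
    (fun x hx z hz => by
      rw [abs_of_nonneg (by positivity)]; exact hh2 x hx z hz)
  obtain ⟨i4, b4⟩ := prod_mom hsph hmem m4 (show 0 ≤ 2 * α by positivity)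
    (C := (Lh ^ 2 * q) ^ 2) (by positivity)
    (fun x hx z hz => by
      have e : (h z - h x) ^ 4 = ((h z - h x) ^ 2) ^ 2 := by ring
      dsimp only
      rw [e, abs_of_nonneg (by positivity)]
      refine (pow_le_pow_left₀ (by positivity) (hh2 x hx z hz) 2).trans (le_of_eq ?_)
      rw [mul_pow]
      congr 1
      rw [← Real.rpow_natCast, ← Real.rpow_mul (pp_nonneg _ _ _)]
      congr 1; push_cast; ring)
  refine ⟨?_, ?_⟩
  · have hg1 := GG_pos hα0
    have hg2 := GG_pos (show 0 ≤ 2 * α by positivity)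
    refine ⟨max (6 * Real.exp 1 * (q * GG α)) (6 * Real.exp 1 * ((Lh ^ 2 * q) ^ 2 * GG (2 * α))),
      le_max_of_le_left (by positivity), i1, i2, i4, fun r hr m => ?_, fun r hr m => ?_⟩
    · refine ((le_abs_self _).trans (b1 r hr m)).trans ?_
      have : (0:ℝ) ≤ ((m:ℝ) + 1) ^ (-α) := by positivity
      refine le_trans (le_of_eq (by ring)) (mul_le_mul_of_nonneg_right (le_max_left _ _) this)
    · refine ((le_abs_self _).trans (b4 r hr m)).trans ?_
      have : (0:ℝ) ≤ ((m:ℝ) + 1) ^ (-(2 * α)) := by positivity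
      refine le_trans (le_of_eq (by ring)) (mul_le_mul_of_nonneg_right (le_max_right _ _) this)
  -- the limit
  set Z : ℕ → EucSp d → ℝ := fun m x => ((m:ℝ) + 1) ^ α *
    (∫ z, (h z - h x) ^ 2 * ww 1 m (pp μ x z) ∂μ
      - (1 + α) * ∫ z, (h z - h x) ^ 2 * ww 0 m (pp μ x z) ∂μ) with hZ
  have hint : ∀ r m, Integrable (fun x => ∫ z, (h z - h x) ^ 2 * ww r m (pp μ x z) ∂μ) μ :=
    fun r m => (int_mul_ww i2 r m).integral_prod_left
  have hform : ∀ m : ℕ, ((m:ℝ) + 1) ^ α *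
      (∫ w, (h w.2 - h w.1) ^ 2 * ww 1 m (pp μ w.1 w.2) ∂(μ.prod μ)
        - (1 + α) * ∫ w, (h w.2 - h w.1) ^ 2 * ww 0 m (pp μ w.1 w.2) ∂(μ.prod μ))
      = ∫ x, Z m x ∂μ := by
    intro m
    rw [integral_prod _ (int_mul_ww i2 1 m), integral_prod _ (int_mul_ww i2 0 m)]
    simp only [hZ]
    rw [integral_const_mul, integral_sub (hint 1 m) ((hint 0 m).const_mul _), integral_const_mul]
  simp only [hform]
  set K := 6 * Real.exp 1 * ((Lh ^ 2 * q) * GG α) with hK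
  have hmb : ∀ x ∈ Ωs, ∀ r < 2, ∀ m : ℕ, ((m:ℝ) + 1) ^ α *
      |∫ z, (h z - h x) ^ 2 * ww r m (pp μ x z) ∂μ| ≤ K := by
    intro x hx r hr m
    have hM : (0:ℝ) < (m:ℝ) + 1 := by positivity
    have := mom_bound hsph hr m x (g := fun z => (h z - h x) ^ 2)
      ((hhm.sub_const _).pow_const 2) hα0 (C := Lh ^ 2 * q) (by positivity) (by
        filter_upwards [hmem] with z hz
        rw [abs_of_nonneg (by positivity)]; exact hh2 x hx z hz)
    refine (mul_le_mul_of_nonneg_left this (by positivity)).trans (le_of_eq ?_)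
    have e1 : ((m:ℝ) + 1) ^ α * ((m:ℝ) + 1) ^ (-α) = 1 := by
      rw [← Real.rpow_add hM]; simp
    calc _ = (((m:ℝ) + 1) ^ α * ((m:ℝ) + 1) ^ (-α)) * K := by rw [hK]; ring
      _ = K := by rw [e1, one_mul]
  have hlim : ∀ᵐ x ∂μ, Tendsto (fun m => Z m x) atTop (𝓝 0) := by
    have hleb : ∀ᵐ x ∂μ, Tendsto (fun r => ⨍ y in Metric.closedBall x r, ‖κ y - κ x‖)
        (𝓝[>] (0:ℝ)) (𝓝 0) := by
      have := IsUnifLocDoublingMeasure.ae_tendsto_average_norm_sub (volume : Measure (EucSp d))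
        (f := κ) (kappa_int hm h0).locallyIntegrable 1
      refine (withDensity_absolutelyContinuous volume _).ae_le ?_
      filter_upwards [this] with x hx
      refine hx (fun _ => x) id tendsto_id ?_
      filter_upwards [self_mem_nhdsWithin] with r hr
      have : (0:ℝ) < r := hr
      simp [this.le]
    filter_upwards [hmem, hleb] with x hx hxl
    obtain ⟨L, hL⟩ := V_lim hd hm h0 hh hc (hlow2 x hx) hxl
    have hgi : Integrable (fun z => (h z - h x) ^ 2) μ := by
      refine Integrable.mono' (integrable_const (Lh ^ 2 * q))
        ((hhm.sub_const _).pow_const 2).aestronglyMeasurable ?_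
      filter_upwards [hmem] with z hz
      rw [Real.norm_eq_abs, abs_of_nonneg (by positivity)]
      refine (hh2 x hx z hz).trans ?_
      have := Real.rpow_le_one (pp_nonneg μ x z) (pp_le_one μ x z) hα0
      have : 0 ≤ Lh ^ 2 * q := by positivity
      nlinarith
    refine cancel_lim hgi hα0 (C := Lh ^ 2 * q) (by positivity) ?_ hL
    intro s hs
    have h1 : ‖∫ z in {z | pp μ x z < s}, (h z - h x) ^ 2 ∂μ‖
        ≤ (Lh ^ 2 * q * s ^ α) * μ.real {z | pp μ x z < s} := by
      refine norm_setIntegral_le_of_norm_le_const_ae' (measure_lt_top _ _) ?_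
      filter_upwards [hmem] with z hz hzs
      rw [Real.norm_eq_abs, abs_of_nonneg (by positivity)]
      refine (hh2 x hx z hz).trans ?_
      exact mul_le_mul_of_nonneg_left
        (Real.rpow_le_rpow (pp_nonneg μ x z) (le_of_lt hzs) hα0) (by positivity)
    rw [meas_pp_lt hsph x hs, Real.norm_eq_abs] at h1
    refine h1.trans (le_of_eq ?_)
    rw [Real.rpow_add hs.1, Real.rpow_one]
    ring
  have := tendsto_integral_of_dominated_convergence (μ := μ) (F := Z) (f := fun _ => 0)
    (fun _ => K + (1 + α) * K) (fun m => (((hint 1 m).sub ((hint 0 m).const_mul _)).const_mul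
      _).aestronglyMeasurable) (integrable_const _) ?_ hlim
  · simpa using this
  · intro m
    filter_upwards [hmem] with x hx
    have h1 := hmb x hx 1 (by norm_num) m
    have h2 := hmb x hx 0 (by norm_num) m
    simp only [hZ]
    rw [Real.norm_eq_abs, mul_sub]
    refine (abs_sub _ _).trans ?_
    have hM : (0:ℝ) ≤ ((m:ℝ) + 1) ^ α := by positivity
    rw [abs_mul, abs_mul, abs_mul, abs_of_nonneg hM, abs_of_nonneg (show 0 ≤ 1 + α by linarith)]
    have : ((m:ℝ) + 1) ^ α * ((1 + α) * |∫ z, (h z - h x) ^ 2 * ww 0 m (pp μ x z) ∂μ|)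
        = (1 + α) * (((m:ℝ) + 1) ^ α * |∫ z, (h z - h x) ^ 2 * ww 0 m (pp μ x z) ∂μ|) := by ring
    rw [this]
    exact add_le_add h1 (mul_le_mul_of_nonneg_left h2 (by linarith))

end setup


section assem
variable {E : Type*} [PseudoMetricSpace E] [SecondCountableTopology E] [MeasurableSpace E]
  [BorelSpace E]

lemma pair_law {G : Type*} [MeasurableSpace G] {Ω' : Type*} [MeasurableSpace Ω'] {P : Measure Ω'}
    [IsProbabilityMeasure P]
    {ι : Type*} {e : ι → Ω' → G} (he : ∀ i, Measurable (e i))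
    (hind : iIndepFun e P) (lam : Measure G) [IsProbabilityMeasure lam]
    (hl : ∀ i, P.map (e i) = lam)
    {l j : ι} (hlj : l ≠ j) : P.map (fun ω => (e l ω, e j ω)) = lam.prod lam := by
  have h := hind.indepFun hlj
  rw [indepFun_iff_map_prod_eq_prod_map_map (he l).aemeasurable (he j).aemeasurable] at h
  rw [h, hl, hl]

lemma mom_formula {Ω' : Type*} [MeasurableSpace Ω'] {P : Measure Ω'} [IsProbabilityMeasure P]
    {n : ℕ} {X : Fin n → Ω' → E} (hX : ∀ i, Measurable (X i))
    (hind : iIndepFun X P) (μ : Measure E) [IsProbabilityMeasure μ] (hl : ∀ i, P.map (X i) = μ)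
    {e : Fin n → Ω' → ℝ} (he : ∀ i, Measurable (e i))
    (hinde : iIndepFun e P) (lam : Measure ℝ) [IsProbabilityMeasure lam]
    (hle : ∀ i, P.map (e i) = lam) (hXe : IndepFun (fun ω i => X i ω) (fun ω i => e i ω) P)
    {l j : Fin n} (hlj : l ≠ j) (r : ℕ) {f : E × E → ℝ} (hfm : Measurable f)
    (hf : Integrable f (μ.prod μ)) {ψ : ℝ × ℝ → ℝ} (hψm : Measurable ψ)
    (hψ : Integrable ψ (lam.prod lam)) :
    Integrable (fun ω => qq Finset.univ (fun i => X i ω) r l j *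
      (f (X l ω, X j ω) * ψ (e l ω, e j ω))) P ∧
    ∫ ω, qq Finset.univ (fun i => X i ω) r l j * (f (X l ω, X j ω) * ψ (e l ω, e j ω)) ∂P
      = (∫ w, f w * bb (n - 2) r (pp μ w.1 w.2) ∂(μ.prod μ)) * ∫ w, ψ w ∂(lam.prod lam) := by
  obtain ⟨hU, hUe⟩ := rank_formula hX hind μ hl hlj r hf
  have hpl := pair_law he hinde lam hle hlj
  have hem : Measurable fun ω => (e l ω, e j ω) := (he l).prodMk (he j)
  have hV : Integrable (fun ω => ψ (e l ω, e j ω)) P := by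
    rw [← hpl] at hψ
    exact hψ.comp_measurable hem
  have hVe : ∫ ω, ψ (e l ω, e j ω) ∂P = ∫ w, ψ w ∂(lam.prod lam) := by
    rw [← hpl, integral_map hem.aemeasurable hψm.aestronglyMeasurable]
  have m1 : Measurable fun x : Fin n → E => qq Finset.univ x r l j * f (x l, x j) := by
    have a1 : Measurable fun x : Fin n → E => qq Finset.univ x r l j :=
      measurable_qq Finset.univ (X := fun i (x : Fin n → E) => x i)
        (fun i => measurable_pi_apply i) r l j
    have a2 : Measurable fun x : Fin n → E => (x l, x j) :=
      (measurable_pi_apply l).prodMk (measurable_pi_apply j)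
    exact a1.mul (hfm.comp a2)
  have m2 : Measurable fun x : Fin n → ℝ => ψ (x l, x j) := by
    have a2 : Measurable fun x : Fin n → ℝ => (x l, x j) :=
      (measurable_pi_apply l).prodMk (measurable_pi_apply j)
    exact hψm.comp a2
  have hI : IndepFun (fun ω => qq Finset.univ (fun i => X i ω) r l j * f (X l ω, X j ω))
      (fun ω => ψ (e l ω, e j ω)) P := hXe.comp m1 m2
  have h1 := hI.integrable_mul hU hV
  have h2 := hI.integral_mul_eq_mul_integral hU.aestronglyMeasurable hV.aestronglyMeasurable
  have hcong : (fun ω => qq Finset.univ (fun i => X i ω) r l j *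
      (f (X l ω, X j ω) * ψ (e l ω, e j ω))) =
      (fun ω => qq Finset.univ (fun i => X i ω) r l j * f (X l ω, X j ω)) *
      (fun ω => ψ (e l ω, e j ω)) := by
    funext ω; simp only [Pi.mul_apply]; ring
  rw [hcong]
  refine ⟨h1, ?_⟩
  rw [h2, hUe, hVe]

lemma law_m {Ω' : Type*} [MeasurableSpace Ω'] {P : Measure Ω'} [IsProbabilityMeasure P]
    {n : ℕ} {X : Fin n → Ω' → E} (hX : ∀ i, Measurable (X i))
    (hind : iIndepFun X P) (μ : Measure E) [IsProbabilityMeasure μ] (hl : ∀ i, P.map (X i) = μ)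
    {e : Fin n → Ω' → ℝ} (he : ∀ i, Measurable (e i))
    (hinde : iIndepFun e P) (lam : Measure ℝ) [IsProbabilityMeasure lam]
    (hle : ∀ i, P.map (e i) = lam) (hXe : IndepFun (fun ω i => X i ω) (fun ω i => e i ω) P) :
    P.map (fun ω i => (X i ω, e i ω)) = Measure.pi (fun _ : Fin n => μ.prod lam) := by
  have hXm : Measurable fun ω i => X i ω := measurable_pi_iff.2 hX
  have hem : Measurable fun ω i => e i ω := measurable_pi_iff.2 he
  have h1 := (indepFun_iff_map_prod_eq_prod_map_map hXm.aemeasurable hem.aemeasurable).1 hXe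
  have h2 := (iIndepFun_iff_map_fun_eq_pi_map (f := X) (fun i => (hX i).aemeasurable)).1 hind
  have h3 := (iIndepFun_iff_map_fun_eq_pi_map (f := e) (fun i => (he i).aemeasurable)).1 hinde
  simp only [hl] at h2
  simp only [hle] at h3
  rw [h2, h3] at h1
  have h4 := (measurePreserving_arrowProdEquivProdArrow E ℝ (Fin n) (fun _ => μ)
    (fun _ => lam)).symm
  rw [← h4.map_eq, ← h1, Measure.map_map h4.measurable (hXm.prodMk hem)]
  rfl

/-- moments of the general local statistic -/
lemma SS_mom {Ω' : Type*} [MeasurableSpace Ω'] {P : Measure Ω'} [IsProbabilityMeasure P]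
    {m : ℕ} {X : Fin (m+4) → Ω' → E} (hX : ∀ i, Measurable (X i))
    (hind : iIndepFun X P) (μ : Measure E) [IsProbabilityMeasure μ] (hl : ∀ i, P.map (X i) = μ)
    {e : Fin (m+4) → Ω' → ℝ} (he : ∀ i, Measurable (e i))
    (hinde : iIndepFun e P) (lam : Measure ℝ) [IsProbabilityMeasure lam]
    (hle : ∀ i, P.map (e i) = lam) (hXe : IndepFun (fun ω i => X i ω) (fun ω i => e i ω) P)
    (r : ℕ) {f : E × E → ℝ} (hfm : Measurable f)
    (hf : Integrable f (μ.prod μ)) {ψ : ℝ × ℝ → ℝ} (hψm : Measurable ψ)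
    (hψ : Integrable ψ (lam.prod lam)) :
    (∀ l, Integrable (fun ω => ∑ j, qq Finset.univ (fun i => X i ω) r l j *
      (f (X l ω, X j ω) * ψ (e l ω, e j ω))) P) ∧
    (∀ l, ∫ ω, ∑ j, qq Finset.univ (fun i => X i ω) r l j *
      (f (X l ω, X j ω) * ψ (e l ω, e j ω)) ∂P
      = (∫ w, f w * ww r m (pp μ w.1 w.2) ∂(μ.prod μ)) * ∫ w, ψ w ∂(lam.prod lam)) := by
  have hint : ∀ l j, Integrable (fun ω => qq Finset.univ (fun i => X i ω) r l j *
      (f (X l ω, X j ω) * ψ (e l ω, e j ω))) P := by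
    intro l j
    by_cases h : l = j
    · subst h
      simp [qq]
    · exact (mom_formula hX hind μ hl he hinde lam hle hXe h r hfm hf hψm hψ).1
  refine ⟨fun l => integrable_finsetSum _ fun j _ => hint l j, fun l => ?_⟩
  rw [integral_finsetSum _ fun j _ => hint l j]
  rw [← Finset.add_sum_erase _ _ (Finset.mem_univ l)]
  have h0 : ∫ ω, qq Finset.univ (fun i => X i ω) r l l *
      (f (X l ω, X l ω) * ψ (e l ω, e l ω)) ∂P = 0 := by simp [qq]
  rw [h0, zero_add, Finset.sum_congr rfl fun j hj =>
    (mom_formula hX hind μ hl he hinde lam hle hXe (Finset.ne_of_mem_erase hj).symm r hfm hf hψm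
      hψ).2]
  rw [Finset.sum_const, Finset.card_erase_of_mem (Finset.mem_univ _), Finset.card_univ,
    Fintype.card_fin, nsmul_eq_mul, ← mul_assoc]
  congr 1
  rw [← integral_const_mul]
  apply integral_congr_ae
  filter_upwards with w
  have : m + 4 - 2 = m + 2 := by omega
  rw [this]
  unfold ww
  push_cast
  ring

lemma noties_ae {Ω' : Type*} [MeasurableSpace Ω'] {P : Measure Ω'} [IsProbabilityMeasure P]
    {n : ℕ} {X : Fin n → Ω' → E} (hX : ∀ i, Measurable (X i))
    (hind : iIndepFun X P) (μ : Measure E) [IsProbabilityMeasure μ] (hl : ∀ i, P.map (X i) = μ)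
    (hs : ∀ x r, μ (Metric.sphere x r) = 0) : ∀ᵐ ω ∂P, NoTies fun i => X i ω := by
  unfold NoTies
  simp only [ae_all_iff]
  intro l i j hil hjl hij
  have hm : MeasurableSet {w : (E × E) × E | dist w.1.2 w.1.1 = dist w.2 w.1.1} :=
    measurableSet_eq_fun ((measurable_snd.comp measurable_fst).dist
      (measurable_fst.comp measurable_fst))
      (measurable_snd.dist (measurable_fst.comp measurable_fst))
  have hI : IndepFun (fun ω => (X l ω, X i ω)) (X j) P :=
    hind.indepFun_prodMk hX l i j hjl.symm hij
  have h1 := (indepFun_iff_map_prod_eq_prod_map_map ((hX l).prodMk (hX i)).aemeasurable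
    (hX j).aemeasurable).1 hI
  rw [pair_law hX hind μ hl hil.symm, hl] at h1
  have hme : Measurable fun ω => ((X l ω, X i ω), X j ω) := ((hX l).prodMk (hX i)).prodMk (hX j)
  have h2 : ((μ.prod μ).prod μ) {w : (E × E) × E | dist w.1.2 w.1.1 = dist w.2 w.1.1} = 0 := by
    rw [Measure.measure_prod_null hm]
    filter_upwards with w
    have : Prod.mk w ⁻¹' {w : (E × E) × E | dist w.1.2 w.1.1 = dist w.2 w.1.1}
        = Metric.sphere w.1 (dist w.2 w.1) := by
      ext z; simp [eq_comm]
    rw [this]; exact hs _ _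
  rw [← h1, Measure.map_apply hme hm] at h2
  rw [ae_iff]
  simpa using h2

end assem


section assem2
variable {E : Type*} [PseudoMetricSpace E] [SecondCountableTopology E] [MeasurableSpace E]
  [BorelSpace E]

/-- the standing assumptions for a sample of size `n` -/
structure Mdl {Ω' : Type*} [MeasurableSpace Ω'] (P : Measure Ω') {n : ℕ} (X : Fin n → Ω' → E)
    (e : Fin n → Ω' → ℝ) (μ : Measure E) (lam : Measure ℝ) : Prop where
  hX : ∀ i, Measurable (X i)
  hind : iIndepFun X P
  hl : ∀ i, P.map (X i) = μ
  he : ∀ i, Measurable (e i)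
  hinde : iIndepFun e P
  hle : ∀ i, P.map (e i) = lam
  hXe : IndepFun (fun ω i => X i ω) (fun ω i => e i ω) P
  hs : ∀ x r, μ (Metric.sphere x r) = 0

/-- the squared increment -/
def phi (h : E → ℝ) (a : ℝ) (u v : E × ℝ) : ℝ := (a * (h v.1 - h u.1) + (v.2 - u.2)) ^ 2

variable {Ω' : Type*} [MeasurableSpace Ω'] {P : Measure Ω'} [IsProbabilityMeasure P] {m : ℕ}
  {X : Fin (m+4) → Ω' → E} {e : Fin (m+4) → Ω' → ℝ} {μ : Measure E} {lam : Measure ℝ}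
  [IsProbabilityMeasure μ] [IsProbabilityMeasure lam]

lemma SS_int (r : ℕ) {φ : E × ℝ → E × ℝ → ℝ} {c : ℝ}
    (hi : ∀ l, Integrable (fun ω => ∑ j, qq Finset.univ (fun i => X i ω) r l j *
      φ (X l ω, e l ω) (X j ω, e j ω)) P)
    (hc : ∀ l, ∫ ω, ∑ j, qq Finset.univ (fun i => X i ω) r l j *
      φ (X l ω, e l ω) (X j ω, e j ω) ∂P = c) :
    Integrable (fun ω => SS Prod.fst φ r fun i => (X i ω, e i ω)) P ∧
    ∫ ω, SS Prod.fst φ r (fun i => (X i ω, e i ω)) ∂P = c := by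
  unfold SS ss
  refine ⟨(integrable_finsetSum _ fun l _ => hi l).const_mul _, ?_⟩
  rw [integral_const_mul, integral_finsetSum _ fun l _ => hi l]
  simp only [hc, Finset.sum_const, Finset.card_univ, Fintype.card_fin, nsmul_eq_mul]
  have : ((m + 4 : ℕ) : ℝ) ≠ 0 := by positivity
  field_simp

lemma SS_mean (M : Mdl P X e μ lam) (r : ℕ) {h : E → ℝ} (hh : Measurable h)
    (h2 : Integrable (fun w : E × E => (h w.2 - h w.1) ^ 2) (μ.prod μ))
    (hq : ∀ᵐ ω ∂P, ∀ l, ∑ j, qq Finset.univ (fun i => X i ω) r l j = 1)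
    (he1 : Integrable (fun x => x) lam) (he2 : Integrable (fun x => x ^ 2) lam)
    (hm : ∫ x, x ∂lam = 0) (a : ℝ) :
    Integrable (fun ω => SS Prod.fst (phi h a) r fun i => (X i ω, e i ω)) P ∧
    ∫ ω, SS Prod.fst (phi h a) r (fun i => (X i ω, e i ω)) ∂P =
      a ^ 2 * ∫ w, (h w.2 - h w.1) ^ 2 * ww r m (pp μ w.1 w.2) ∂(μ.prod μ) +
      2 * ∫ x, x ^ 2 ∂lam := by
  have hDm : Measurable fun w : E × E => h w.2 - h w.1 :=
    (hh.comp measurable_snd).sub (hh.comp measurable_fst)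
  have hD : Integrable (fun w : E × E => h w.2 - h w.1) (μ.prod μ) :=
    ((memLp_two_iff_integrable_sq hDm.aestronglyMeasurable).2 h2).integrable (by norm_num)
  have i1 : Integrable (fun w : ℝ × ℝ => w.2) (lam.prod lam) := he1.comp_snd lam
  have i2 : Integrable (fun w : ℝ × ℝ => w.1) (lam.prod lam) := he1.comp_fst lam
  have i3 : Integrable (fun w : ℝ × ℝ => w.2 ^ 2) (lam.prod lam) := he2.comp_snd lam
  have i4 : Integrable (fun w : ℝ × ℝ => w.1 ^ 2) (lam.prod lam) := he2.comp_fst lam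
  have i5 : Integrable (fun w : ℝ × ℝ => w.1 * w.2) (lam.prod lam) := he1.mul_prod he1
  have i6 : Integrable (fun w : ℝ × ℝ => w.2 - w.1) (lam.prod lam) := i1.sub i2
  have i34 : Integrable (fun w : ℝ × ℝ => w.2 ^ 2 + w.1 ^ 2) (lam.prod lam) := i3.add i4
  have i52 : Integrable (fun w : ℝ × ℝ => 2 * (w.1 * w.2)) (lam.prod lam) := i5.const_mul 2
  have e7 : (fun w : ℝ × ℝ => (w.2 - w.1) ^ 2) =
      fun w : ℝ × ℝ => (w.2 ^ 2 + w.1 ^ 2) - 2 * (w.1 * w.2) := by funext w; ring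
  have i7 : Integrable (fun w : ℝ × ℝ => (w.2 - w.1) ^ 2) (lam.prod lam) := by
    rw [e7]; exact i34.sub i52
  have v6 : ∫ w, (w.2 - w.1) ∂(lam.prod lam) = 0 := by
    rw [integral_sub i1 i2, integral_fun_snd (fun x => x), integral_fun_fst (fun x => x), hm]
    simp
  have v7 : ∫ w, (w.2 - w.1) ^ 2 ∂(lam.prod lam) = 2 * ∫ x, x ^ 2 ∂lam := by
    rw [e7, integral_sub i34 i52, integral_add i3 i4, integral_const_mul,
      integral_prod_mul (fun x => x) (fun x => x), integral_fun_snd (fun x => x ^ 2),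
      integral_fun_fst (fun x => x ^ 2), hm]
    simp
    ring
  have A := SS_mom M.hX M.hind μ M.hl M.he M.hinde lam M.hle M.hXe r (f := fun w =>
    (h w.2 - h w.1) ^ 2) (hDm.pow_const 2) h2 (ψ := fun _ => 1) measurable_const
    (integrable_const _)
  have B := SS_mom M.hX M.hind μ M.hl M.he M.hinde lam M.hle M.hXe r (f := fun w =>
    (h w.2 - h w.1)) hDm hD (ψ := fun w => w.2 - w.1) (measurable_snd.sub measurable_fst) i6
  have C := SS_mom M.hX M.hind μ M.hl M.he M.hinde lam M.hle M.hXe r (f := fun _ => 1)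
    measurable_const (integrable_const _) (ψ := fun w => (w.2 - w.1) ^ 2)
    ((measurable_snd.sub measurable_fst).pow_const 2) i7
  have D := SS_mom M.hX M.hind μ M.hl M.he M.hinde lam M.hle M.hXe r (f := fun _ => 1)
    measurable_const (integrable_const _) (ψ := fun _ => 1) measurable_const
    (integrable_const _)
  simp only [v6, v7, mul_one, integral_const, probReal_univ, smul_eq_mul, mul_zero, one_mul]
    at A B C D
  have hw : ∫ w, ww r m (pp μ w.1 w.2) ∂(μ.prod μ) = 1 := by
    rw [← D.2 0, integral_congr_ae (g := fun _ => (1:ℝ)) (by filter_upwards [hq] with ω h using h 0)]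
    simp
  simp only [hw, one_mul] at C
  have key : ∀ l, (fun ω => ∑ j, qq Finset.univ (fun i => X i ω) r l j *
      phi h a (X l ω, e l ω) (X j ω, e j ω)) = fun ω =>
      (a ^ 2 * (∑ j, qq Finset.univ (fun i => X i ω) r l j * (h (X j ω) - h (X l ω)) ^ 2) +
      2 * a * ∑ j, qq Finset.univ (fun i => X i ω) r l j * ((h (X j ω) - h (X l ω)) *
        (e j ω - e l ω))) + ∑ j, qq Finset.univ (fun i => X i ω) r l j * (e j ω - e l ω) ^ 2 := by
    intro l
    funext ω
    rw [Finset.mul_sum, Finset.mul_sum, ← Finset.sum_add_distrib, ← Finset.sum_add_distrib]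
    refine Finset.sum_congr rfl fun j _ => ?_
    unfold phi
    ring
  have iA := fun l => (A.1 l).const_mul (a ^ 2)
  have iB := fun l => (B.1 l).const_mul (2 * a)
  have iAB := fun l => (iA l).add (iB l)
  refine SS_int r (fun l => ?_) fun l => ?_
  · rw [key]
    exact (iAB l).add (C.1 l)
  · rw [key]
    have h1 := integral_add (iAB l) (C.1 l)
    have h2 := integral_add (iA l) (iB l)
    simp only [Pi.add_apply] at h1 h2
    rw [h1, h2, integral_const_mul, integral_const_mul, A.2, B.2, C.2]
    ring

lemma trunc_ineq (A x y τ : ℝ) (hτ : 0 < τ) :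
    (A + (y - x)) ^ 2 - min ((A + (y - x)) ^ 2) (9 * τ) ≤
      3 * (A ^ 4 / τ + (max (x ^ 2 - τ) 0 + max (y ^ 2 - τ) 0)) := by
  have h1 : A ^ 2 - τ ≤ A ^ 4 / τ := by
    rw [le_div_iff₀ hτ]
    nlinarith [sq_nonneg (A ^ 2 - τ), sq_nonneg (A^2)]
  have h0 : 0 ≤ A ^ 4 / τ := by positivity
  have h2 := le_max_left (x ^ 2 - τ) 0
  have h3 := le_max_left (y ^ 2 - τ) 0
  have h4 := le_max_right (x ^ 2 - τ) 0
  have h5 := le_max_right (y ^ 2 - τ) 0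
  rcases min_cases ((A + (y - x)) ^ 2) (9 * τ) with ⟨h, _⟩ | ⟨h, _⟩
  · rw [h]; nlinarith
  · rw [h]
    nlinarith [sq_nonneg (A - y), sq_nonneg (A + x), sq_nonneg (y + x)]

lemma SS_trunc (M : Mdl P X e μ lam) (r : ℕ) {h : E → ℝ} (hh : Measurable h)
    (h4 : Integrable (fun w : E × E => (h w.2 - h w.1) ^ 4) (μ.prod μ))
    (hq : ∀ᵐ ω ∂P, ∀ l, ∑ j, qq Finset.univ (fun i => X i ω) r l j = 1)
    (he2 : Integrable (fun x => x ^ 2) lam) (a : ℝ) {τ : ℝ} (hτ : 0 < τ) :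
    Integrable (fun ω => SS Prod.fst (fun u v => 3 * ((a * (h v.1 - h u.1)) ^ 4 / τ +
      (max (u.2 ^ 2 - τ) 0 + max (v.2 ^ 2 - τ) 0))) r fun i => (X i ω, e i ω)) P ∧
    ∫ ω, SS Prod.fst (fun u v => 3 * ((a * (h v.1 - h u.1)) ^ 4 / τ +
      (max (u.2 ^ 2 - τ) 0 + max (v.2 ^ 2 - τ) 0))) r (fun i => (X i ω, e i ω)) ∂P =
      3 * (a ^ 4 * (∫ w, (h w.2 - h w.1) ^ 4 * ww r m (pp μ w.1 w.2) ∂(μ.prod μ)) / τ +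
      2 * ∫ x, max (x ^ 2 - τ) 0 ∂lam) := by
  have hDm : Measurable fun w : E × E => h w.2 - h w.1 :=
    (hh.comp measurable_snd).sub (hh.comp measurable_fst)
  have i0 : Integrable (fun x : ℝ => max (x ^ 2 - τ) 0) lam :=
    (he2.sub (integrable_const τ)).pos_part
  have m0 : Measurable (fun x : ℝ => max (x ^ 2 - τ) 0) := by fun_prop
  have i1 : Integrable (fun w : ℝ × ℝ => max (w.2 ^ 2 - τ) 0) (lam.prod lam) := i0.comp_snd lam
  have i2 : Integrable (fun w : ℝ × ℝ => max (w.1 ^ 2 - τ) 0) (lam.prod lam) := i0.comp_fst lam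
  have v7 : ∫ w, (max (w.1 ^ 2 - τ) 0 + max (w.2 ^ 2 - τ) 0) ∂(lam.prod lam)
      = 2 * ∫ x, max (x ^ 2 - τ) 0 ∂lam := by
    rw [integral_add i2 i1, integral_fun_snd (fun x : ℝ => max (x ^ 2 - τ) 0),
      integral_fun_fst (fun x : ℝ => max (x ^ 2 - τ) 0)]
    simp
    ring
  have A := SS_mom M.hX M.hind μ M.hl M.he M.hinde lam M.hle M.hXe r (f := fun w =>
    (h w.2 - h w.1) ^ 4) (hDm.pow_const 4) h4 (ψ := fun _ => 1) measurable_const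
    (integrable_const _)
  have C := SS_mom M.hX M.hind μ M.hl M.he M.hinde lam M.hle M.hXe r (f := fun _ => 1)
    measurable_const (integrable_const _) (ψ := fun w => max (w.1 ^ 2 - τ) 0 + max (w.2 ^ 2 - τ) 0)
    ((m0.comp measurable_fst).add (m0.comp measurable_snd)) (i2.add i1)
  have D := SS_mom M.hX M.hind μ M.hl M.he M.hinde lam M.hle M.hXe r (f := fun _ => 1)
    measurable_const (integrable_const _) (ψ := fun _ => 1) measurable_const
    (integrable_const _)
  simp only [v7, mul_one, integral_const, probReal_univ, smul_eq_mul, mul_zero, one_mul]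
    at A C D
  have hw : ∫ w, ww r m (pp μ w.1 w.2) ∂(μ.prod μ) = 1 := by
    rw [← D.2 0, integral_congr_ae (g := fun _ => (1:ℝ)) (by filter_upwards [hq] with ω h using h 0)]
    simp
  simp only [hw, one_mul] at C
  have key : ∀ l, (fun ω => ∑ j, qq Finset.univ (fun i => X i ω) r l j *
      (3 * ((a * (h (X j ω) - h (X l ω))) ^ 4 / τ +
      (max (e l ω ^ 2 - τ) 0 + max (e j ω ^ 2 - τ) 0)))) = fun ω =>
      (3 * a ^ 4 / τ * (∑ j, qq Finset.univ (fun i => X i ω) r l j * (h (X j ω) - h (X l ω)) ^ 4) +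
      3 * ∑ j, qq Finset.univ (fun i => X i ω) r l j *
        (max (e l ω ^ 2 - τ) 0 + max (e j ω ^ 2 - τ) 0)) := by
    intro l
    funext ω
    rw [Finset.mul_sum, Finset.mul_sum, ← Finset.sum_add_distrib]
    refine Finset.sum_congr rfl fun j _ => ?_
    ring
  have iA := fun l => (A.1 l).const_mul (3 * a ^ 4 / τ)
  have iC := fun l => (C.1 l).const_mul 3
  refine SS_int r (fun l => ?_) fun l => ?_
  · rw [key]
    exact (iA l).add (iC l)
  · rw [key]
    have h1 := integral_add (iA l) (iC l)
    rw [h1, integral_const_mul, integral_const_mul, A.2, C.2]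
    ring

/-- comparison with a truncation -/
lemma L1_compare {S S' : Ω' → ℝ} (hS : Integrable S P) (hS' : MemLp S' 2 P) {δ V : ℝ}
    (hle : ∀ᵐ ω ∂P, S' ω ≤ S ω) (hδ : ∫ ω, (S ω - S' ω) ∂P ≤ δ)
    (hV : ∫ ω, (S' ω - ∫ ω', S' ω' ∂P) ^ 2 ∂P ≤ V) :
    ∫ ω, |S ω - ∫ ω', S ω' ∂P| ∂P ≤ 2 * δ + Real.sqrt V := by
  have hS1 : Integrable S' P := hS'.integrable (by norm_num)
  set c := ∫ ω', S ω' ∂P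
  set c' := ∫ ω', S' ω' ∂P
  have hcc : c - c' ≤ δ := by rw [← integral_sub hS hS1]; exact hδ
  have hcc0 : 0 ≤ c - c' := by
    have := integral_mono_ae hS1 hS hle
    linarith
  have hd2 : MemLp (fun ω => S' ω - c') 2 P := hS'.sub (memLp_const c')
  have hda : Integrable (fun ω => |S' ω - c'|) P := (hS1.sub (integrable_const c')).abs
  have hsq : (∫ ω, |S' ω - c'| ∂P) ^ 2 ≤ ∫ ω, (S' ω - c') ^ 2 ∂P := by
    have i2 : Integrable (fun ω => (S' ω - c') ^ 2) P := hd2.integrable_sq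
    set u := ∫ ω, |S' ω - c'| ∂P
    have i3 : Integrable (fun ω => 2 * u * |S' ω - c'|) P := hda.const_mul _
    have : ∫ ω, (2 * u * |S' ω - c'| - u ^ 2) ∂P ≤ ∫ ω, (S' ω - c') ^ 2 ∂P := by
      refine integral_mono (i3.sub (integrable_const _)) i2 fun ω => ?_
      simp only
      nlinarith [sq_nonneg (|S' ω - c'| - u), sq_abs (S' ω - c')]
    rw [integral_sub i3 (integrable_const _), integral_const_mul] at this
    simp at this
    nlinarith
  have h1 : ∫ ω, |S' ω - c'| ∂P ≤ Real.sqrt V := by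
    apply Real.le_sqrt_of_sq_le
    exact hsq.trans hV
  have i4 : Integrable (fun ω => S ω - S' ω) P := hS.sub hS1
  have i5 : Integrable (fun ω => (S ω - S' ω) + |S' ω - c'|) P := i4.add hda
  calc ∫ ω, |S ω - c| ∂P ≤ ∫ ω, ((S ω - S' ω) + |S' ω - c'|) + (c - c') ∂P := by
        refine integral_mono_ae (hS.sub (integrable_const c)).abs (i5.add (integrable_const _)) ?_
        filter_upwards [hle] with ω hω
        rw [abs_le]
        have := abs_le.1 (le_refl |S' ω - c'|)
        constructor <;> linarith [this.1, this.2]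
    _ = ∫ ω, (S ω - S' ω) ∂P + ∫ ω, |S' ω - c'| ∂P + (c - c') := by
        rw [integral_add i5 (integrable_const _), integral_add i4 hda]
        simp
    _ ≤ _ := by linarith

end assem2


section assem3
variable {E : Type*} [PseudoMetricSpace E] [SecondCountableTopology E] [MeasurableSpace E]
  [BorelSpace E]
variable {Ω' : Type*} [MeasurableSpace Ω'] {P : Measure Ω'} [IsProbabilityMeasure P] {m : ℕ}
  {X : Fin (m+4) → Ω' → E} {e : Fin (m+4) → Ω' → ℝ} {μ : Measure E} {lam : Measure ℝ}
  [IsProbabilityMeasure μ] [IsProbabilityMeasure lam]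

lemma SS_var (M : Mdl P X e μ lam) (r : ℕ) {φ : E × ℝ → E × ℝ → ℝ}
    (hφ : Measurable (Function.uncurry φ)) {T : ℝ}
    (h0 : ∀ a b, 0 ≤ φ a b) (hT : ∀ a b, φ a b ≤ T)
    (hdi : Integrable (fun w : E × E => dist w.2 w.1 ^ 2) (μ.prod μ)) {K : ℝ} (hK : 0 ≤ K)
    (hdK : ∀ s ≤ r, ∫ w, dist w.2 w.1 ^ 2 * ww s m (pp μ w.1 w.2) ∂(μ.prod μ) ≤ K)
    {ε : ℝ} (hε : 0 < ε) :
    ∫ ω, (SS Prod.fst φ r (fun i => (X i ω, e i ω)) -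
      ∫ ω', SS Prod.fst φ r (fun i => (X i ω', e i ω')) ∂P) ^ 2 ∂P
    ≤ 2 * T ^ 2 * ((r + 2) / ((m + 4 : ℕ) : ℝ) +
      (r + 1) * (μ.prod μ).real {w | dist w.1 w.2 ≤ 2 * ε} + 2 * ((r + 1) * K) / ε ^ 2) := by
  have hlaw := law_m M.hX M.hind μ M.hl M.he M.hinde lam M.hle M.hXe
  have hm : Measurable fun ω (i : Fin (m+4)) => (X i ω, e i ω) :=
    measurable_pi_iff.2 fun i => (M.hX i).prodMk (M.he i)
  have hSm := measurable_SS (n := m + 4) (pos := Prod.fst (α := E) (β := ℝ)) measurable_fst hφ r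
  have hdist : Measurable fun w : E × E => dist w.2 w.1 ^ 2 :=
    (measurable_snd.dist measurable_fst).pow_const 2
  have hB := fun s => SS_mom M.hX M.hind μ M.hl M.he M.hinde lam M.hle M.hXe s hdist hdi
    (ψ := fun _ => 1) measurable_const (integrable_const _)
  simp only [mul_one, integral_const, probReal_univ, smul_eq_mul] at hB
  have haa : ∀ l, (fun ω => ∑ i, aa Finset.univ (fun i => X i ω) r l i *
      dist (X i ω) (X l ω) ^ 2) = fun ω => ∑ s ∈ Finset.range (r + 1), ∑ i,
        qq Finset.univ (fun i => X i ω) s l i * dist (X i ω) (X l ω) ^ 2 := by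
    intro l
    funext ω
    rw [Finset.sum_comm]
    refine Finset.sum_congr rfl fun i _ => ?_
    rw [aa_eq, Finset.sum_mul]
  have ham : ∀ l, Measurable fun q : Fin (m+4) → E × ℝ =>
      ∑ i, aa Finset.univ (fun i => (q i).1) r l i * dist (q i).1 (q l).1 ^ 2 := by
    intro l
    have hp : ∀ i, Measurable fun q : Fin (m+4) → E × ℝ => (q i).1 :=
      fun i => measurable_fst.comp (measurable_pi_apply i)
    refine Finset.measurable_sum _ fun i _ => Measurable.mul ?_ (((hp i).dist (hp l)).pow_const 2)
    exact measurable_aa Finset.univ (X := fun i (q : Fin (m+4) → E × ℝ) => (q i).1) hp r l i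
  have hai : ∀ l, Integrable (fun ω => ∑ i, aa Finset.univ (fun i => X i ω) r l i *
      dist (X i ω) (X l ω) ^ 2) P := by
    intro l
    rw [haa]
    exact integrable_finsetSum _ fun s _ => (hB s).1 l
  have := lln_var (n := m + 4) (by omega) (μ.prod lam) (pos := Prod.fst) measurable_fst hφ h0 hT r
    hε (η := (μ.prod μ).real {w | dist w.1 w.2 ≤ 2 * ε}) (R := (r + 1) * K) ?_ ?_ ?_ ?_
    (by positivity) measureReal_nonneg
  · rw [← hlaw] at this
    rw [integral_map hm.aemeasurable hSm.aestronglyMeasurable,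
      integral_map hm.aemeasurable] at this
    · exact this
    · exact ((hSm.sub measurable_const).pow_const 2).aestronglyMeasurable
  · rw [← hlaw]
    have hN := noties_ae M.hX M.hind μ M.hl M.hs
    have hms : MeasurableSet {q : Fin (m+4) → E × ℝ | NoTies fun i => (q i).1} := by
      have hp : ∀ i, Measurable fun q : Fin (m+4) → E × ℝ => (q i).1 :=
        fun i => measurable_fst.comp (measurable_pi_apply i)
      unfold NoTies
      simp only [Set.setOf_forall]
      refine MeasurableSet.iInter fun l => MeasurableSet.iInter fun i => MeasurableSet.iInter fun j =>
        MeasurableSet.iInter fun _ => MeasurableSet.iInter fun _ => MeasurableSet.iInter fun _ => ?_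
      exact (measurableSet_eq_fun ((hp i).dist (hp l)) ((hp j).dist (hp l))).compl
    exact (ae_map_iff hm.aemeasurable hms).2 hN
  · intro l l' hll
    rw [← hlaw, map_measureReal_apply hm]
    · have hp := pair_law M.hX M.hind μ M.hl hll
      rw [← hp, map_measureReal_apply ((M.hX l).prodMk (M.hX l'))]
      · rfl
      · exact measurableSet_le (measurable_fst.dist measurable_snd) measurable_const
    · have hp : ∀ i, Measurable fun q : Fin (m+4) → E × ℝ => (q i).1 :=
        fun i => measurable_fst.comp (measurable_pi_apply i)
      exact measurableSet_le ((hp l).dist (hp l')) measurable_const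
  · intro l
    rw [← hlaw, integrable_map_measure (ham l).aestronglyMeasurable hm.aemeasurable]
    exact hai l
  · intro l
    rw [← hlaw, integral_map hm.aemeasurable (ham l).aestronglyMeasurable]
    simp only
    rw [haa, integral_finsetSum _ fun s _ => (hB s).1 l]
    calc _ ≤ ∑ s ∈ Finset.range (r + 1), K := by
          refine Finset.sum_le_sum fun s hs => ?_
          rw [(hB s).2 l]
          exact hdK s (by simpa [Nat.lt_succ_iff] using hs)
      _ = _ := by simp

lemma SS_conc (M : Mdl P X e μ lam) (r : ℕ) {h : E → ℝ} (hh : Measurable h)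
    (h2 : Integrable (fun w : E × E => (h w.2 - h w.1) ^ 2) (μ.prod μ))
    (h4 : Integrable (fun w : E × E => (h w.2 - h w.1) ^ 4) (μ.prod μ))
    (hq : ∀ᵐ ω ∂P, ∀ l, ∑ j, qq Finset.univ (fun i => X i ω) r l j = 1)
    (he1 : Integrable (fun x => x) lam) (he2 : Integrable (fun x => x ^ 2) lam)
    (hm : ∫ x, x ∂lam = 0) (a : ℝ)
    (hdi : Integrable (fun w : E × E => dist w.2 w.1 ^ 2) (μ.prod μ)) {K : ℝ} (hK : 0 ≤ K)
    (hdK : ∀ s ≤ r, ∫ w, dist w.2 w.1 ^ 2 * ww s m (pp μ w.1 w.2) ∂(μ.prod μ) ≤ K)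
    {ε : ℝ} (hε : 0 < ε) {τ : ℝ} (hτ : 0 < τ) :
    ∫ ω, |SS Prod.fst (phi h a) r (fun i => (X i ω, e i ω)) -
      (a ^ 2 * ∫ w, (h w.2 - h w.1) ^ 2 * ww r m (pp μ w.1 w.2) ∂(μ.prod μ) +
      2 * ∫ x, x ^ 2 ∂lam)| ∂P ≤
      2 * (3 * (a ^ 4 * (∫ w, (h w.2 - h w.1) ^ 4 * ww r m (pp μ w.1 w.2) ∂(μ.prod μ)) / τ +
      2 * ∫ x, max (x ^ 2 - τ) 0 ∂lam)) +
      Real.sqrt (2 * (9 * τ) ^ 2 * ((r + 2) / ((m + 4 : ℕ) : ℝ) +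
      (r + 1) * (μ.prod μ).real {w | dist w.1 w.2 ≤ 2 * ε} + 2 * ((r + 1) * K) / ε ^ 2)) := by
  obtain ⟨hi, hE⟩ := SS_mean M r hh h2 hq he1 he2 hm a
  obtain ⟨hti, htE⟩ := SS_trunc M r hh h4 hq he2 a hτ
  have hphi : Measurable (Function.uncurry (phi h a)) := by
    unfold phi Function.uncurry
    have a1 : Measurable fun p : (E × ℝ) × (E × ℝ) => h p.2.1 :=
      hh.comp (measurable_fst.comp measurable_snd)
    have a2 : Measurable fun p : (E × ℝ) × (E × ℝ) => h p.1.1 :=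
      hh.comp (measurable_fst.comp measurable_fst)
    exact (((a1.sub a2).const_mul a).add ((measurable_snd.comp measurable_snd).sub
      (measurable_snd.comp measurable_fst))).pow_const 2
  set φ : E × ℝ → E × ℝ → ℝ := fun u v => min (phi h a u v) (9 * τ) with hφd
  have hφ : Measurable (Function.uncurry φ) := hphi.min measurable_const
  have hphi0 : ∀ u v, 0 ≤ phi h a u v := fun u v => sq_nonneg _
  have hφ0 : ∀ u v, 0 ≤ φ u v := fun u v => le_min (hphi0 u v) (by positivity)
  have hφT : ∀ u v, φ u v ≤ 9 * τ := fun u v => min_le_right _ _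
  have hmm : Measurable fun ω (i : Fin (m+4)) => (X i ω, e i ω) :=
    measurable_pi_iff.2 fun i => (M.hX i).prodMk (M.he i)
  have hSm := (measurable_SS (n := m + 4) (pos := Prod.fst (α := E) (β := ℝ)) measurable_fst
    hφ r).comp hmm
  have hN := noties_ae M.hX M.hind μ M.hl M.hs
  have hmono : ∀ {f g : E × ℝ → E × ℝ → ℝ} (q : Fin (m+4) → E × ℝ), (∀ u v, f u v ≤ g u v) →
      SS Prod.fst f r q ≤ SS Prod.fst g r q := by
    intro f g q hfg
    unfold SS ss
    refine mul_le_mul_of_nonneg_left ?_ (by positivity)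
    exact Finset.sum_le_sum fun l _ => Finset.sum_le_sum fun j _ =>
      mul_le_mul_of_nonneg_left (hfg _ _) (qq_nonneg _ _ _ _ _)
  have hSL : MemLp (fun ω => SS Prod.fst φ r (fun i => (X i ω, e i ω))) 2 P := by
    refine MemLp.of_bound hSm.aestronglyMeasurable (9 * τ) ?_
    filter_upwards [hN] with ω hω
    have h1 : SS Prod.fst φ r (fun i => (X i ω, e i ω)) ≤ 9 * τ := by
      unfold SS
      rw [inv_mul_le_iff₀ (by positivity)]
      calc _ ≤ ∑ l : Fin (m+4), 9 * τ := Finset.sum_le_sum fun l _ =>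
            ss_le Finset.univ hω (by positivity) (fun i j => hφT _ _) r l
        _ = _ := by simp
    have h0 : 0 ≤ SS Prod.fst φ r (fun i => (X i ω, e i ω)) := by
      unfold SS
      exact mul_nonneg (by positivity) (Finset.sum_nonneg fun l _ =>
        ss_nonneg _ _ (fun i j => hφ0 _ _) r l)
    rw [Real.norm_eq_abs, abs_of_nonneg h0]
    exact h1
  rw [← hE]
  refine L1_compare hi hSL ?_ ?_ (SS_var M r hφ hφ0 hφT hdi hK hdK hε)
  · filter_upwards with ω
    exact hmono _ fun u v => min_le_left _ _
  · rw [← htE]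
    refine integral_mono (hi.sub (hSL.integrable (by norm_num))) hti fun ω => ?_
    have hsub : SS Prod.fst (phi h a) r (fun i => (X i ω, e i ω)) -
        SS Prod.fst φ r (fun i => (X i ω, e i ω)) =
        SS Prod.fst (fun u v => phi h a u v - φ u v) r (fun i => (X i ω, e i ω)) := by
      unfold SS ss
      simp only [← mul_sub, ← Finset.sum_sub_distrib]
    simp only
    rw [hsub]
    exact hmono _ fun u v => trunc_ineq _ _ _ _ hτ

end assem3


lemma lim_abs {L D K : ℕ → ℝ} {t η : ℝ → ℝ} (r : ℕ) {B : ℝ} (hL0 : ∀ m, 0 ≤ L m)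
    (hD : ∀ m, D m ≤ B) (hB0 : 0 ≤ B) (hK : Tendsto K atTop (𝓝 0)) (ht : Tendsto t atTop (𝓝 0))
    (hη : ∀ δ > 0, ∃ ε > 0, η ε < δ)
    (hL : ∀ m : ℕ, ∀ ε > 0, ∀ τ > 0, L m ≤ 2 * (3 * (D m / τ + 2 * t τ)) +
      Real.sqrt (2 * (9 * τ) ^ 2 * ((r + 2) / ((m + 4 : ℕ) : ℝ) + (r + 1) * η ε +
        2 * ((r + 1) * K m) / ε ^ 2))) : Tendsto L atTop (𝓝 0) := by
  rw [Metric.tendsto_atTop]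
  intro δ hδ
  have h1 : Tendsto (fun τ : ℝ => 2 * (3 * (B / τ + 2 * t τ))) atTop (𝓝 (2 * (3 * (0 + 2 * 0)))) :=
    (((tendsto_const_nhds.div_atTop tendsto_id).add (ht.const_mul 2)).const_mul 3).const_mul 2
  simp only [mul_zero, add_zero] at h1
  obtain ⟨τ, hτ, hτ0⟩ := ((h1.eventually (gt_mem_nhds (half_pos hδ))).and
    (eventually_gt_atTop 0)).exists
  have hq : 0 < (δ / 2) ^ 2 / (2 * (9 * τ) ^ 2) / (2 * (r + 1)) := by positivity
  obtain ⟨ε, hε, hηε⟩ := hη _ hq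
  have h2 : Tendsto (fun m : ℕ => (r + 2 : ℝ) / ((m + 4 : ℕ) : ℝ) +
      2 * ((r + 1) * K m) / ε ^ 2) atTop (𝓝 (0 + 2 * ((r + 1) * 0) / ε ^ 2)) := by
    refine Tendsto.add ?_ (((hK.const_mul _).const_mul 2).div_const _)
    exact tendsto_const_nhds.div_atTop
      (tendsto_natCast_atTop_atTop.comp (tendsto_add_atTop_nat 4))
  simp only [mul_zero, zero_div, add_zero] at h2
  have hq2 : 0 < (δ / 2) ^ 2 / (2 * (9 * τ) ^ 2) / 2 := by positivity
  obtain ⟨N, hN⟩ := eventually_atTop.1 (h2.eventually (gt_mem_nhds hq2))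
  refine ⟨N, fun m hm => ?_⟩
  rw [Real.dist_eq, sub_zero, abs_of_nonneg (hL0 m)]
  have h3 := hL m ε hε τ hτ0
  have h4 : D m / τ ≤ B / τ := by gcongr; exact hD m
  have h5 := hN m hm
  have h6 : (r + 1) * η ε ≤ (δ / 2) ^ 2 / (2 * (9 * τ) ^ 2) / 2 := by
    have : (r + 1 : ℝ) * η ε ≤ (r + 1) * ((δ / 2) ^ 2 / (2 * (9 * τ) ^ 2) / (2 * (r + 1))) := by
      gcongr
    refine this.trans (le_of_eq ?_)
    field_simp
  have h7 : Real.sqrt (2 * (9 * τ) ^ 2 * ((r + 2) / ((m + 4 : ℕ) : ℝ) + (r + 1) * η ε +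
        2 * ((r + 1) * K m) / ε ^ 2)) ≤ δ / 2 := by
    apply Real.sqrt_le_iff.2
    refine ⟨by positivity, ?_⟩
    have h8 : ((r + 2) / ((m + 4 : ℕ) : ℝ) + (r + 1) * η ε +
        2 * ((r + 1) * K m) / ε ^ 2) ≤ (δ / 2) ^ 2 / (2 * (9 * τ) ^ 2) := by linarith
    calc _ ≤ 2 * (9 * τ) ^ 2 * ((δ / 2) ^ 2 / (2 * (9 * τ) ^ 2)) := by gcongr
      _ = _ := by field_simp
  linarith

lemma tail_lim {lam : Measure ℝ} (he2 : Integrable (fun x => x ^ 2) lam) :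
    Tendsto (fun τ : ℝ => ∫ x, max (x ^ 2 - τ) 0 ∂lam) atTop (𝓝 0) := by
  have : Tendsto (fun τ : ℝ => ∫ x, max (x ^ 2 - τ) 0 ∂lam) atTop (𝓝 (∫ x, (0:ℝ) ∂lam)) := by
    refine tendsto_integral_filter_of_dominated_convergence (fun x => x ^ 2) ?_ ?_ he2 ?_
    · filter_upwards with τ
      have m0 : Measurable (fun x : ℝ => max (x ^ 2 - τ) 0) := by fun_prop
      exact m0.aestronglyMeasurable
    · filter_upwards [eventually_ge_atTop 0] with τ hτ
      filter_upwards with x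
      rw [Real.norm_eq_abs, abs_of_nonneg (le_max_right _ _)]
      exact max_le (by linarith) (sq_nonneg x)
    · filter_upwards with x
      refine tendsto_const_nhds.congr' ?_
      filter_upwards [eventually_ge_atTop (x ^ 2)] with τ hτ
      rw [max_eq_right (by linarith)]
  simpa using this

lemma eta_lim {E : Type*} [PseudoMetricSpace E] [SecondCountableTopology E] [MeasurableSpace E]
    [BorelSpace E] {μ : Measure E} [IsProbabilityMeasure μ]
    (hs : ∀ x r, μ (Metric.sphere x r) = 0) (δ : ℝ) (hδ : 0 < δ) :
    ∃ ε > 0, (μ.prod μ).real {w | dist w.1 w.2 ≤ 2 * ε} < δ := by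
  have hm : ∀ c : ℝ, MeasurableSet {w : E × E | dist w.1 w.2 ≤ c} := fun c =>
    measurableSet_le (measurable_fst.dist measurable_snd) measurable_const
  have h1 := tendsto_measure_iInter_atTop (μ := μ.prod μ)
    (s := fun k : ℕ => {w : E × E | dist w.1 w.2 ≤ 2 * (1 / ((k:ℝ) + 1))})
    (fun k => (hm _).nullMeasurableSet) (by
      intro k l hkl w hw
      simp only [Set.mem_setOf_eq] at hw ⊢
      refine hw.trans ?_
      gcongr) ⟨0, measure_ne_top _ _⟩
  have h2 : (μ.prod μ) (⋂ k : ℕ, {w : E × E | dist w.1 w.2 ≤ 2 * (1 / ((k:ℝ) + 1))}) = 0 := by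
    have hsub : (⋂ k : ℕ, {w : E × E | dist w.1 w.2 ≤ 2 * (1 / ((k:ℝ) + 1))}) ⊆
        {w : E × E | dist w.1 w.2 ≤ 0} := by
      intro w hw
      simp only [Set.mem_iInter, Set.mem_setOf_eq] at hw ⊢
      have := (tendsto_one_div_add_atTop_nhds_zero_nat (𝕜 := ℝ)).const_mul 2
      rw [mul_zero] at this
      exact ge_of_tendsto' this hw
    refine measure_mono_null hsub ?_
    rw [Measure.measure_prod_null (hm 0)]
    filter_upwards with x
    have : Prod.mk x ⁻¹' {w : E × E | dist w.1 w.2 ≤ 0} ⊆ Metric.sphere x 0 := by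
      intro z hz
      simp only [Set.mem_preimage, Set.mem_setOf_eq] at hz
      rw [Metric.mem_sphere, dist_comm]
      exact le_antisymm hz dist_nonneg
    exact measure_mono_null this (hs _ _)
  rw [h2] at h1
  have h3 := (h1.eventually (gt_mem_nhds (ENNReal.ofReal_pos.2 hδ))).exists
  obtain ⟨k, hk⟩ := h3
  refine ⟨1 / ((k:ℝ) + 1), by positivity, ?_⟩
  rw [measureReal_def]
  exact (ENNReal.lt_ofReal_iff_toReal_lt (measure_ne_top _ _)).1 hk

lemma sum_qq_eq {E : Type*} [PseudoMetricSpace E] {n : ℕ} {x : Fin n → E} (hx : NoTies x)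
    (φ : Fin n → ℝ) (r : ℕ) (l j : Fin n) (hjl : j ≠ l) (hr : rk Finset.univ x l j = r) :
    ∑ i, qq Finset.univ x r l i * φ i = φ j := by
  rw [Finset.sum_eq_single j]
  · simp [qq, hjl, hr]
  · intro i _ hij
    have : ¬ (i ≠ l ∧ rk Finset.univ x l i = r) := by
      rintro ⟨h1, h2⟩
      exact hij (rk_inj hx (Finset.mem_univ _) (Finset.mem_univ _) h1 hjl (h2.trans hr.symm))
    unfold qq
    rw [if_neg this, zero_mul]
  · simp

lemma nn_rk {d : ℕ} (x : ℕ → EucSp d) {n : ℕ} (l j : Fin n) :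
    rk Finset.univ (fun i : Fin n => x i) l j = ((Finset.range n).filter fun ℓ => ℓ ≠ (l:ℕ) ∧
        dist (x ℓ) (x l) < dist (x j) (x l)).card := by
  unfold rk
  rw [Finset.card_filter, Finset.card_filter, Finset.sum_range]
  refine Finset.sum_congr rfl fun i _ => ?_
  simp only [ne_eq, Fin.ext_iff]

lemma gamma_eq {d : ℕ} (hd : 1 ≤ d) {Ωp : Type*} [MeasureSpace Ωp] {h : EucSp d → ℝ}
    {X : ℕ → Ωp → EucSp d} {e : ℕ → Ωp → ℝ}
    {J : ℕ → ℕ → ℕ → Ωp → ℕ} (hJ : IsNNIndex X J) (m r : ℕ) (hr : r < 2)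
    (hN : ∀ᵐ ω ∂(ℙ : Measure Ωp), NoTies fun i : Fin (m+4) => X i ω) :
    (∀ᵐ ω ∂(ℙ : Measure Ωp), ∀ l,
      ∑ j, qq Finset.univ (fun i : Fin (m+4) => X i ω) r l j = 1) ∧
    ∀ᵐ ω ∂(ℙ : Measure Ωp), ((m + 4 : ℕ) : ℝ) ^ (2 / (d:ℝ)) * gammaStat h X e J (m+4) (r+1) ω =
      2⁻¹ * SS Prod.fst (phi h (((m + 4 : ℕ) : ℝ) ^ (1 / (d:ℝ)))) r
        (fun i : Fin (m+4) => (X i ω, e i ω)) := by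
  have hJ' : ∀ᵐ ω ∂(ℙ : Measure Ωp), ∀ l : Fin (m+4), ∃ j : Fin (m+4),
      J l (m+4) (r+1) ω = j ∧ j ≠ l ∧ rk Finset.univ (fun i : Fin (m+4) => X i ω) l j = r := by
    rw [ae_all_iff]
    intro l
    filter_upwards [hJ l (m+4) (r+1) l.2 (by omega) (by omega)] with ω hω
    obtain ⟨h1, h2, h3⟩ := hω
    refine ⟨⟨_, h1⟩, rfl, fun hh => h2 (by simpa [Fin.ext_iff] using hh), ?_⟩
    rw [nn_rk (fun i => X i ω)]
    simpa using h3
  constructor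
  · filter_upwards [hN, hJ'] with ω h1 h2 l
    obtain ⟨j, _, h3, h4⟩ := h2 l
    simpa using sum_qq_eq h1 (fun _ => 1) r l j h3 h4
  · filter_upwards [hN, hJ'] with ω h1 h2
    unfold gammaStat SS ss
    rw [Finset.sum_range, mul_inv]
    have hn : (0:ℝ) < ((m + 4 : ℕ) : ℝ) := by positivity
    set n := ((m + 4 : ℕ) : ℝ)
    have hd0 : (d:ℝ) ≠ 0 := by positivity
    have e1 : n ^ (2 / (d:ℝ)) = (n ^ (1 / (d:ℝ))) ^ 2 := by
      rw [← Real.rpow_natCast, ← Real.rpow_mul hn.le]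
      congr 1
      push_cast
      ring
    have e2 : n ^ (1 / (d:ℝ)) * n ^ (-1 / (d:ℝ)) = 1 := by
      rw [← Real.rpow_add hn]
      have : 1 / (d:ℝ) + -1 / d = 0 := by ring
      rw [this, Real.rpow_zero]
    set a := n ^ (1 / (d:ℝ))
    set b := n ^ (-1 / (d:ℝ))
    rw [e1]
    have e3 : a ^ 2 * (2⁻¹ * n⁻¹ * ∑ i : Fin (m+4), (h (X (J i (m + 4) (r + 1) ω) ω) +
        b * e (J i (m + 4) (r + 1) ω) ω - (h (X i ω) + b * e i ω)) ^ 2) =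
        2⁻¹ * (n⁻¹ * ∑ i : Fin (m+4), a ^ 2 * (h (X (J i (m + 4) (r + 1) ω) ω) +
        b * e (J i (m + 4) (r + 1) ω) ω - (h (X i ω) + b * e i ω)) ^ 2) := by
      rw [← Finset.mul_sum]; ring
    rw [e3]
    congr 2
    refine Finset.sum_congr rfl fun l _ => ?_
    obtain ⟨j, h5, h3, h4⟩ := h2 l
    rw [sum_qq_eq h1 (fun j => phi h a (X l ω, e l ω) (X j ω, e j ω)) r l j h3 h4, h5]
    unfold phi
    rw [← mul_pow]
    congr 1
    linear_combination (e j ω - e l ω) * e2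

lemma nnMoment_two {d : ℕ} (hd : 1 ≤ d) : 0 < nnMoment d 1 ∧
    nnMoment d 2 = (1 + 2 / (d:ℝ)) * nnMoment d 1 := by
  have hd0 : (0:ℝ) < d := by exact_mod_cast hd
  have hv : 0 < (volume (Metric.closedBall (0 : EucSp d) 1)).toReal :=
    ENNReal.toReal_pos (Metric.measure_closedBall_pos _ _ one_pos).ne'
      (isCompact_closedBall _ _).measure_lt_top.ne
  have hα : 0 < 1 + 2 / (d:ℝ) := by positivity
  unfold nnMoment
  constructor
  · have := Real.Gamma_pos_of_pos hα
    simp only [Nat.cast_one, Real.Gamma_one, div_one]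
    positivity
  · have h1 : ((2:ℕ):ℝ) + 2 / (d:ℝ) = (1 + 2 / (d:ℝ)) + 1 := by push_cast; ring
    rw [h1, Real.Gamma_add_one hα.ne']
    simp only [Nat.cast_one, Real.Gamma_one, div_one, Nat.cast_ofNat, Real.Gamma_two]
    ring

/-- **Theorem 5.3.** With `c_k = ω_d^{−2/d} Γ(k + 2/d)/Γ(k)`,
`n^{2/d} (γ_{n,2} c_1 − γ_{n,1} c_2)/(c_1 − c_2) → σ²` in `L¹`. -/
theorem stmt11 {d : ℕ} (hd : 1 ≤ d)
    {Ωp : Type*} [MeasureSpace Ωp] [IsProbabilityMeasure (ℙ : Measure Ωp)]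
    (Ωs : Set (EucSp d)) (hΩo : IsOpen Ωs) (hΩb : Bornology.IsBounded Ωs)
    (κ : EucSp d → ℝ) (hκmeas : Measurable κ) (hκnn : ∀ x, 0 ≤ κ x)
    (hκ1 : ∫ x in Ωs, κ x = 1)
    (hκball : ∃ c > 0, ∀ x ∈ Ωs, ∀ r : ℝ, 0 < r → r ≤ 1 →
      c * r ^ d ≤ ∫ y in Metric.closedBall x r, κ y)
    (h : EucSp d → ℝ) (hh : ContDiff ℝ 2 h)
    (hgrad : ∃ M, ∀ x ∈ Ωs, ‖gradient h x‖ ≤ M)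
    (X : ℕ → Ωp → EucSp d) (hXmeas : ∀ i, Measurable (X i))
    (hiid : iIndepFun X ℙ)
    (hlaw : ∀ i, Measure.map (X i) ℙ
      = volume.withDensity fun x => ENNReal.ofReal (κ x))
    (e : ℕ → Ωp → ℝ) (σ : ℝ) (hemeas : ∀ i, Measurable (e i))
    (heiid : iIndepFun e ℙ)
    (heid : ∀ i, Measure.map (e i) ℙ = Measure.map (e 0) ℙ)
    (heL2 : ∀ i, MemLp (e i) 2 ℙ)
    (hemean : ∀ i, ∫ ω, e i ω ∂ℙ = 0)
    (hevar : ∀ i, ∫ ω, (e i ω) ^ 2 ∂ℙ = σ ^ 2)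
    (hXe : IndepFun (fun ω i => X i ω) (fun ω i => e i ω) ℙ)
    (J : ℕ → ℕ → ℕ → Ωp → ℕ) (hJmeas : ∀ i n k, Measurable (J i n k))
    (hJ : IsNNIndex X J) :
    Tendsto (fun n : ℕ => ∫ ω,
        |(n : ℝ) ^ (2 / (d : ℝ)) *
            ((gammaStat h X e J n 2 ω * nnMoment d 1 - gammaStat h X e J n 1 ω * nnMoment d 2)
              / (nnMoment d 1 - nnMoment d 2)) - σ ^ 2| ∂ℙ)
      atTop (𝓝 0) := by
  have hlaw' : ∀ i, Measure.map (X i) ℙ = muK κ := hlaw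
  haveI hP : IsProbabilityMeasure (muK κ) := by
    rw [← hlaw' 0]; exact Measure.isProbabilityMeasure_map (hXmeas 0).aemeasurable
  set μ := muK κ with hμ
  set lam : Measure ℝ := Measure.map (e 0) ℙ with hlam
  haveI hPl : IsProbabilityMeasure lam :=
    Measure.isProbabilityMeasure_map (hemeas 0).aemeasurable
  have hsph := muK_sphere hd κ
  have hhm : Measurable h := hh.continuous.measurable
  obtain ⟨⟨C, hC0, hdi, h2i, h4i, hdK, h4K⟩, hcancel⟩ :=
    analysis hd Ωs hΩo hΩb hκmeas hκnn hκ1 hκball hh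
  rw [← hμ] at hdi h2i h4i hdK h4K hcancel
  have he1 : Integrable (fun x => x) lam := by
    rw [hlam, integrable_map_measure (by fun_prop) (hemeas 0).aemeasurable]
    exact (heL2 0).integrable (by norm_num)
  have he2 : Integrable (fun x => x ^ 2) lam := by
    rw [hlam, integrable_map_measure (by fun_prop) (hemeas 0).aemeasurable]
    exact (heL2 0).integrable_sq
  have hme : ∫ x, x ∂lam = 0 := by
    rw [hlam, integral_map (hemeas 0).aemeasurable (by fun_prop)]
    exact hemean 0
  have hve : ∫ x, x ^ 2 ∂lam = σ ^ 2 := by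
    rw [hlam, integral_map (hemeas 0).aemeasurable (by fun_prop)]
    exact hevar 0
  have M : ∀ m : ℕ, Mdl (ℙ : Measure Ωp) (fun i : Fin (m+4) => X i) (fun i : Fin (m+4) => e i)
      μ lam := by
    intro m
    refine ⟨fun i => hXmeas i, hiid.precomp Fin.val_injective, fun i => hlaw' i, fun i => hemeas i,
      heiid.precomp Fin.val_injective, fun i => heid i, ?_, hsph⟩
    have p1 : Measurable fun (x : ℕ → EucSp d) (i : Fin (m+4)) => x i :=
      measurable_pi_iff.2 fun i => measurable_pi_apply _
    have p2 : Measurable fun (x : ℕ → ℝ) (i : Fin (m+4)) => x i :=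
      measurable_pi_iff.2 fun i => measurable_pi_apply _
    exact hXe.comp p1 p2
  have hN : ∀ m : ℕ, ∀ᵐ ω ∂(ℙ : Measure Ωp), NoTies fun i : Fin (m+4) => X i ω := fun m =>
    noties_ae (M m).hX (M m).hind μ (M m).hl hsph
  have hd0 : (0:ℝ) < d := by exact_mod_cast hd
  set α : ℝ := 2 / (d:ℝ) with hα
  have hα0 : 0 < α := by positivity
  set a : ℕ → ℝ := fun m => ((m + 4 : ℕ) : ℝ) ^ (1 / (d:ℝ)) with ha
  have ha2 : ∀ m, a m ^ 2 = ((m + 4 : ℕ) : ℝ) ^ α := by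
    intro m
    rw [ha, ← Real.rpow_natCast, ← Real.rpow_mul (by positivity)]
    congr 1
    rw [hα]; push_cast; ring
  have ha4 : ∀ m, a m ^ 4 = ((m + 4 : ℕ) : ℝ) ^ (2 * α) := by
    intro m
    rw [ha, ← Real.rpow_natCast, ← Real.rpow_mul (by positivity)]
    congr 1
    rw [hα]; push_cast; ring
  have hratio : ∀ (m : ℕ) (p : ℝ), 0 ≤ p →
      ((m + 4 : ℕ) : ℝ) ^ p ≤ 4 ^ p * ((m:ℝ) + 1) ^ p := by
    intro m p hp
    rw [← Real.mul_rpow (by norm_num) (by positivity)]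
    refine Real.rpow_le_rpow (by positivity) ?_ hp
    push_cast
    linarith [(Nat.cast_nonneg m : (0:ℝ) ≤ m)]
  set I : ℕ → ℕ → ℝ := fun r m =>
    ∫ w, (h w.2 - h w.1) ^ 2 * ww r m (pp μ w.1 w.2) ∂(μ.prod μ) with hI
  set S : ℕ → (m : ℕ) → Ωp → ℝ := fun r m ω =>
    SS Prod.fst (phi h (a m)) r (fun i : Fin (m+4) => (X i ω, e i ω)) with hS
  have hSi : ∀ r < 2, ∀ m, Integrable (S r m) ℙ := by
    intro r hr m
    exact (SS_mean (M m) r hhm h2i (gamma_eq (h := h) (e := e) hd hJ m r hr (hN m)).1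
      he1 he2 hme (a m)).1
  have hconv : ∀ r < 2, Tendsto (fun m => ∫ ω, |S r m ω - (a m ^ 2 * I r m + 2 * σ ^ 2)|)
      atTop (𝓝 0) := by
    intro r hr
    refine lim_abs (D := fun m => a m ^ 4 *
      (∫ w, (h w.2 - h w.1) ^ 4 * ww r m (pp μ w.1 w.2) ∂(μ.prod μ)))
      (K := fun m => C * ((m:ℝ) + 1) ^ (-α)) (t := fun τ => ∫ x, max (x ^ 2 - τ) 0 ∂lam)
      (η := fun ε => (μ.prod μ).real {w | dist w.1 w.2 ≤ 2 * ε}) r (B := 4 ^ (2 * α) * C)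
      (fun m => integral_nonneg fun _ => abs_nonneg _) ?_ (by positivity) ?_ (tail_lim he2)
      (eta_lim hsph) ?_
    · intro m
      rw [ha4]
      calc _ ≤ ((m + 4 : ℕ) : ℝ) ^ (2 * α) * (C * ((m:ℝ) + 1) ^ (-(2 * α))) := by
            gcongr; exact h4K r hr m
        _ ≤ (4 ^ (2 * α) * ((m:ℝ) + 1) ^ (2 * α)) * (C * ((m:ℝ) + 1) ^ (-(2 * α))) := by
            gcongr; exact hratio m _ (by positivity)
        _ = 4 ^ (2 * α) * C := by
            rw [Real.rpow_neg (by positivity)]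
            have : ((m:ℝ) + 1) ^ (2 * α) ≠ 0 := by positivity
            field_simp
    · have h1 : Tendsto (fun m : ℕ => (m:ℝ) + 1) atTop atTop :=
        tendsto_atTop_add_const_right _ _ tendsto_natCast_atTop_atTop
      have h2 := ((tendsto_rpow_neg_atTop hα0).comp h1).const_mul C
      simpa using h2
    · intro m ε hε τ hτ
      have := SS_conc (M m) r hhm h2i h4i
        (gamma_eq (h := h) (e := e) hd hJ m r hr (hN m)).1 he1 he2 hme (a m) hdi
        (K := C * ((m:ℝ) + 1) ^ (-α)) (by positivity)
        (fun s hs => hdK s (by omega) m) hε hτ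
      rw [hve] at this
      exact this
  obtain ⟨hc1, hc2⟩ := nnMoment_two hd
  rw [← hα] at hc2
  set c1 := nnMoment d 1
  have hdet : c1 - nnMoment d 2 = -(α * c1) := by rw [hc2]; ring
  have hαc : α * c1 ≠ 0 := by positivity
  set b : ℕ → ℝ := fun m => a m ^ 2 * (I 1 m - (1 + α) * I 0 m) with hb
  have hb0 : Tendsto (fun m => |b m|) atTop (𝓝 0) := by
    have h1 := (hcancel.abs).const_mul (4 ^ α)
    rw [abs_zero, mul_zero] at h1
    refine squeeze_zero (fun m => abs_nonneg _) (fun m => ?_) h1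
    rw [hb]
    simp only
    rw [abs_mul, abs_mul, ha2,
      abs_of_nonneg (by positivity : (0:ℝ) ≤ ((m + 4 : ℕ) : ℝ) ^ α),
      abs_of_nonneg (by positivity : (0:ℝ) ≤ ((m : ℝ) + 1) ^ α), ← mul_assoc]
    gcongr
    exact hratio m _ hα0.le
  rw [← tendsto_add_atTop_iff_nat 4]
  have hlim := ((((hconv 1 (by norm_num)).const_mul c1).add
    ((hconv 0 (by norm_num)).const_mul ((1 + α) * c1))).add
    (hb0.const_mul c1)).const_mul (2⁻¹ / (α * c1))
  simp only [mul_zero, add_zero] at hlim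
  refine squeeze_zero (fun m => integral_nonneg fun _ => abs_nonneg _) (fun m => ?_) hlim
  have hg0 := (gamma_eq (h := h) (e := e) hd hJ m 0 (by norm_num) (hN m)).2
  have hg1 := (gamma_eq (h := h) (e := e) hd hJ m 1 (by norm_num) (hN m)).2
  have iD : ∀ r < 2, Integrable (fun ω => |S r m ω - (a m ^ 2 * I r m + 2 * σ ^ 2)|) ℙ :=
    fun r hr => ((hSi r hr m).sub (integrable_const _)).abs
  have i1 : Integrable (fun ω => c1 * |S 1 m ω - (a m ^ 2 * I 1 m + 2 * σ ^ 2)|) ℙ :=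
    (iD 1 (by norm_num)).const_mul c1
  have i0 : Integrable (fun ω => ((1 + α) * c1) * |S 0 m ω - (a m ^ 2 * I 0 m + 2 * σ ^ 2)|) ℙ :=
    (iD 0 (by norm_num)).const_mul _
  have i10 : Integrable (fun ω => c1 * |S 1 m ω - (a m ^ 2 * I 1 m + 2 * σ ^ 2)| +
      ((1 + α) * c1) * |S 0 m ω - (a m ^ 2 * I 0 m + 2 * σ ^ 2)|) ℙ := i1.add i0
  have i2 : Integrable (fun ω => c1 * |S 1 m ω - (a m ^ 2 * I 1 m + 2 * σ ^ 2)| +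
      ((1 + α) * c1) * |S 0 m ω - (a m ^ 2 * I 0 m + 2 * σ ^ 2)| + c1 * |b m|) ℙ :=
    i10.add (integrable_const _)
  have hval : ∫ ω, (2⁻¹ / (α * c1)) * (c1 * |S 1 m ω - (a m ^ 2 * I 1 m + 2 * σ ^ 2)| +
      ((1 + α) * c1) * |S 0 m ω - (a m ^ 2 * I 0 m + 2 * σ ^ 2)| + c1 * |b m|) =
      2⁻¹ / (α * c1) * (c1 * (∫ ω, |S 1 m ω - (a m ^ 2 * I 1 m + 2 * σ ^ 2)|) +
      (1 + α) * c1 * (∫ ω, |S 0 m ω - (a m ^ 2 * I 0 m + 2 * σ ^ 2)|) + c1 * |b m|) := by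
    rw [integral_const_mul, integral_add i10 (integrable_const _), integral_add i1 i0,
      integral_const_mul, integral_const_mul]
    simp
  rw [← hval]
  refine integral_mono_of_nonneg (ae_of_all _ fun _ => abs_nonneg _) (i2.const_mul _) ?_
  filter_upwards [hg0, hg1] with ω h0 h1
  have key : ((m + 4 : ℕ) : ℝ) ^ α * ((gammaStat h X e J (m + 4) 2 ω * c1 -
      gammaStat h X e J (m + 4) 1 ω * nnMoment d 2) / (c1 - nnMoment d 2)) - σ ^ 2 =
      -(2⁻¹ / (α * c1)) * ((c1 * (S 1 m ω - (a m ^ 2 * I 1 m + 2 * σ ^ 2)) -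
      ((1 + α) * c1) * (S 0 m ω - (a m ^ 2 * I 0 m + 2 * σ ^ 2))) + c1 * b m) := by
    have e1 : ((m + 4 : ℕ) : ℝ) ^ α * ((gammaStat h X e J (m + 4) 2 ω * c1 -
      gammaStat h X e J (m + 4) 1 ω * nnMoment d 2) / (c1 - nnMoment d 2)) =
      (2⁻¹ * S 1 m ω * c1 - 2⁻¹ * S 0 m ω * ((1 + α) * c1)) / (-(α * c1)) := by
      rw [hdet, hc2, ← h0, ← h1]
      ring
    rw [e1, hb]
    field_simp
    ring
  rw [key, abs_mul, abs_neg, abs_of_nonneg (by positivity : (0:ℝ) ≤ 2⁻¹ / (α * c1))]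
  refine mul_le_mul_of_nonneg_left ?_ (by positivity)
  refine (abs_add_le _ _).trans (add_le_add ((abs_sub _ _).trans (le_of_eq ?_)) (le_of_eq ?_))
  · rw [abs_mul, abs_mul, abs_of_pos hc1, abs_of_pos (by positivity : 0 < (1 + α) * c1)]
  · rw [abs_mul, abs_of_pos hc1]
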